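/- Let X be one of A, B, C (with n ≥ 2) or D (with n ≥ 4), let A be the Cartan matrix of type X_n, and let ι be an admissible sequence in I = {1,…,n} adapted to A. Let Σ_ι := { a ∈ Z^∞ : φ(a) ≥ 0 for all φ ∈ Ξ_ι } be the polyhedral cone cut out by Ξ_ι, and let Tab^n_{X,ι} := { [j_1,…,j_k]^X_s ∈ Tab_{X,ι} : s ≤ n } (a finite set). Then Σ_ι = { a ∈ Z^∞ : φ(a) ≥ 0 for all φ ∈ Tab^n_{X,ι}, and a_{m,i} = 0 for all m > n and all i ∈ I }, where a_{m,i} denotes the coordinate of a at the position of the m-th occurrence of i in ι; in particular Σ_ι is described by finitely many inequalities in finitely many variables. -/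

import Mathlib

noncomputable section

/-- The coordinate linear form `x_k` (as a coefficient vector). -/
def xc (k : ℕ) : ℕ → ℚ := fun l => if l = k then 1 else 0

/-- Cartan matrix of type `A_n`. -/
def cartanA (_n : ℕ) (i j : ℕ) : ℤ :=
  if i = j then 2 else if i + 1 = j ∨ j + 1 = i then -1 else 0

/-- Cartan matrix of type `B_n`. -/
def cartanB (n : ℕ) (i j : ℕ) : ℤ :=
  if i = j then 2
  else if i = n ∧ j = n - 1 then -2
  else if i + 1 = j ∨ j + 1 = i then -1 else 0

/-- Cartan matrix of type `C_n`. -/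
def cartanC (n : ℕ) (i j : ℕ) : ℤ :=
  if i = j then 2
  else if i = n - 1 ∧ j = n then -2
  else if i + 1 = j ∨ j + 1 = i then -1 else 0

/-- Cartan matrix of type `D_n`. -/
def cartanD (n : ℕ) (i j : ℕ) : ℤ :=
  if i = j then 2
  else if (i = n - 1 ∧ j = n) ∨ (i = n ∧ j = n - 1) then 0
  else if (i + 1 = j ∨ j + 1 = i) ∨ (i = n ∧ j = n - 2) ∨ (i = n - 2 ∧ j = n) then -1
  else 0

/-- `ι` (with positions indexed by `k ≥ 1`) takes values in `{1,…,n}`, has no two equal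
consecutive entries, and every index occurs infinitely often. -/
def Admissible (n : ℕ) (ι : ℕ → ℕ) : Prop :=
  (∀ k, 1 ≤ k → 1 ≤ ι k ∧ ι k ≤ n) ∧
  (∀ k, 1 ≤ k → ι k ≠ ι (k + 1)) ∧
  (∀ i, 1 ≤ i → i ≤ n → ∀ N, ∃ k, N ≤ k ∧ ι k = i)

/-- `k^+`: the next position after `k` carrying the same letter. -/
def kplus (ι : ℕ → ℕ) (k : ℕ) : ℕ := sInf {l | k < l ∧ ι l = ι k}

/-- `k^-`: the previous position (`≥ 1`) carrying the same letter, `0` if none. -/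
def kminus (ι : ℕ → ℕ) (k : ℕ) : ℕ := sSup {l | 0 < l ∧ l < k ∧ ι l = ι k}

/-- The linear form `β_k` (with `β_0 = 0`). -/
def beta (A : ℕ → ℕ → ℤ) (ι : ℕ → ℕ) (k : ℕ) : ℕ → ℚ :=
  if k = 0 then 0
  else xc k + (∑ j ∈ Finset.Ioo k (kplus ι k), (A (ι k) (ι j) : ℚ) • xc j) + xc (kplus ι k)

/-- The piecewise-linear operator `S_k`. -/
def Sop (A : ℕ → ℕ → ℤ) (ι : ℕ → ℕ) (k : ℕ) (φ : ℕ → ℚ) : ℕ → ℚ :=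
  if 0 < φ k then φ - φ k • beta A ι k
  else φ - φ k • beta A ι (kminus ι k)

/-- Membership in `Ξ_ι`: forms obtained from some `x_{j_0}` by finitely many operators `S_k`. -/
inductive XiMem (A : ℕ → ℕ → ℤ) (ι : ℕ → ℕ) : (ℕ → ℚ) → Prop
  | base (k : ℕ) (hk : 1 ≤ k) : XiMem A ι (xc k)
  | step (k : ℕ) (hk : 1 ≤ k) (φ : ℕ → ℚ) (h : XiMem A ι φ) : XiMem A ι (Sop A ι k φ)

/-- The set `Ξ_ι`. -/
def Xi (A : ℕ → ℕ → ℤ) (ι : ℕ → ℕ) : Set (ℕ → ℚ) := { φ | XiMem A ι φ }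

/-- Forms obtained from a set `g` of generators by finitely many operators `S_k`. -/
inductive XiMemFrom (A : ℕ → ℕ → ℤ) (ι : ℕ → ℕ) (g : Set (ℕ → ℚ)) : (ℕ → ℚ) → Prop
  | base (φ : ℕ → ℚ) (h : φ ∈ g) : XiMemFrom A ι g φ
  | step (k : ℕ) (hk : 1 ≤ k) (φ : ℕ → ℚ) (h : XiMemFrom A ι g φ) :
      XiMemFrom A ι g (Sop A ι k φ)

/-- `ι` is adapted to the Cartan matrix `A`: for `i ≠ j` with `a_{i,j} ≠ 0`, consecutive
members of the subsequence of `ι` consisting of the letters `i`, `j` are distinct. -/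
def Adapted (n : ℕ) (A : ℕ → ℕ → ℤ) (ι : ℕ → ℕ) : Prop :=
  ∀ i j, 1 ≤ i → i ≤ n → 1 ≤ j → j ≤ n → i ≠ j → A i j ≠ 0 →
    ∀ k l, 1 ≤ k → k < l → (ι k = i ∨ ι k = j) → (ι l = i ∨ ι l = j) →
      (∀ m, k < m → m < l → ι m ≠ i ∧ ι m ≠ j) → ι k ≠ ι l

/-- Position of the first occurrence of the letter `i` in `ι`. -/
def firstOcc (ι : ℕ → ℕ) (i : ℕ) : ℕ := sInf {k | 1 ≤ k ∧ ι k = i}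

/-- `p_{i,j} = 1` iff the first occurrence of `i` precedes the first occurrence of `j`. -/
def pval (ι : ℕ → ℕ) (i j : ℕ) : ℕ := if firstOcc ι i < firstOcc ι j then 1 else 0

/-- The function `P(k)` for types A, B, C (and `P(k) = 0` for `k > n`, `k ≤ 1`). -/
def PABC (ι : ℕ → ℕ) (n k : ℕ) : ℕ :=
  if k ≤ n then ∑ t ∈ Finset.Icc 2 k, pval ι t (t - 1) else 0

/-- The function `P(k)` for type D. -/
def PD (ι : ℕ → ℕ) (n k : ℕ) : ℕ :=
  if k = n then (∑ t ∈ Finset.Icc 2 (n - 2), pval ι t (t - 1)) + pval ι n (n - 2)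
  else if k ≤ n then ∑ t ∈ Finset.Icc 2 k, pval ι t (t - 1) else 0

/-- `occPos ι j s`: the position of the `s`-th occurrence of the letter `j` in `ι`
(`0` for `s = 0`). -/
def occPos (ι : ℕ → ℕ) (j : ℕ) : ℕ → ℕ
  | 0 => 0
  | s + 1 => sInf {k | occPos ι j s < k ∧ ι k = j}

/-- The double-indexed coordinate form `x_{s,j}`, with the conventions
`x_{s,0} = x_{s,n+1} = 0` and `x_{s,j} = 0` for `s ≤ 0`. -/
def xsj (ι : ℕ → ℕ) (n : ℕ) (s : ℤ) (j : ℕ) : ℕ → ℚ :=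
  if 1 ≤ s ∧ 1 ≤ j ∧ j ≤ n then xc (occPos ι j s.toNat) else 0

/-- The double-indexed form `β_{s,j}`. -/
def betasj (A : ℕ → ℕ → ℤ) (ι : ℕ → ℕ) (s : ℤ) (j : ℕ) : ℕ → ℚ :=
  beta A ι (occPos ι j s.toNat)

/-- The double-indexed operator `S_{m,j}`. -/
def Ssj (A : ℕ → ℕ → ℤ) (ι : ℕ → ℕ) (m j : ℕ) (φ : ℕ → ℚ) : ℕ → ℚ :=
  Sop A ι (occPos ι j m) φ

/- Entries of the ordered sets `J_X` are encoded as natural numbers: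
an unbarred entry `j ∈ {1,…,n}` is encoded as `j`, a barred entry `j̄` is
encoded as `2n+1-j` (so that `n̄ = n+1, …, 1̄ = 2n` and the total order of
`J_B = J_C` is the numerical order), and the extra symbol `ovl(n+1)` of
types C and D is encoded as `0`. -/

/-- The box of type A. -/
def boxA (ι : ℕ → ℕ) (n : ℕ) (s : ℤ) (j : ℕ) : ℕ → ℚ :=
  xsj ι n (s + (PABC ι n j : ℤ)) j - xsj ι n (s + (PABC ι n (j - 1) : ℤ) + 1) (j - 1)

/-- The box of type B. -/
def boxB (ι : ℕ → ℕ) (n : ℕ) (s : ℤ) (e : ℕ) : ℕ → ℚ :=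
  if e ≤ n then
    xsj ι n (s + (PABC ι n e : ℤ)) e - xsj ι n (s + (PABC ι n (e - 1) : ℤ) + 1) (e - 1)
  else
    xsj ι n (s + (PABC ι n (2 * n - e) : ℤ) + (n : ℤ) - ((2 * n + 1 - e : ℕ) : ℤ) + 1)
        (2 * n - e)
      - xsj ι n (s + (PABC ι n (2 * n + 1 - e) : ℤ) + (n : ℤ) - ((2 * n + 1 - e : ℕ) : ℤ) + 1)
          (2 * n + 1 - e)

/-- The box of type C (`ovl(n+1)` encoded as `0`). -/
def boxC (ι : ℕ → ℕ) (n : ℕ) (s : ℤ) (e : ℕ) : ℕ → ℚ :=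
  if e = 0 then xsj ι n (s + (PABC ι n n : ℤ)) n
  else if e < n then
    xsj ι n (s + (PABC ι n e : ℤ)) e - xsj ι n (s + (PABC ι n (e - 1) : ℤ) + 1) (e - 1)
  else if e = n then
    (2 : ℚ) • xsj ι n (s + (PABC ι n n : ℤ)) n
      - xsj ι n (s + (PABC ι n (n - 1) : ℤ) + 1) (n - 1)
  else if e = n + 1 then
    xsj ι n (s + (PABC ι n (n - 1) : ℤ) + 1) (n - 1)
      - (2 : ℚ) • xsj ι n (s + (PABC ι n n : ℤ) + 1) n
  else
    xsj ι n (s + (PABC ι n (2 * n - e) : ℤ) + (n : ℤ) - ((2 * n + 1 - e : ℕ) : ℤ) + 1)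
        (2 * n - e)
      - xsj ι n (s + (PABC ι n (2 * n + 1 - e) : ℤ) + (n : ℤ) - ((2 * n + 1 - e : ℕ) : ℤ) + 1)
          (2 * n + 1 - e)

/-- The box of type D (`ovl(n+1)` encoded as `0`, `n̄` as `n+1`, `ovl(n-1)` as `n+2`). -/
def boxD (ι : ℕ → ℕ) (n : ℕ) (s : ℤ) (e : ℕ) : ℕ → ℚ :=
  if e = 0 then xsj ι n (s + (PD ι n n : ℤ)) n
  else if e ≤ n - 2 then
    xsj ι n (s + (PD ι n e : ℤ)) e - xsj ι n (s + (PD ι n (e - 1) : ℤ) + 1) (e - 1)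
  else if e = n - 1 then
    xsj ι n (s + (PD ι n (n - 1) : ℤ)) (n - 1) + xsj ι n (s + (PD ι n n : ℤ)) n
      - xsj ι n (s + (PD ι n (n - 2) : ℤ) + 1) (n - 2)
  else if e = n then
    xsj ι n (s + (PD ι n n : ℤ)) n - xsj ι n (s + (PD ι n (n - 1) : ℤ) + 1) (n - 1)
  else if e = n + 1 then
    xsj ι n (s + (PD ι n (n - 1) : ℤ)) (n - 1) - xsj ι n (s + (PD ι n n : ℤ) + 1) n
  else if e = n + 2 then
    xsj ι n (s + (PD ι n (n - 2) : ℤ) + 1) (n - 2)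
      - xsj ι n (s + (PD ι n (n - 1) : ℤ) + 1) (n - 1)
      - xsj ι n (s + (PD ι n n : ℤ) + 1) n
  else
    xsj ι n (s + (PD ι n (2 * n - e) : ℤ) + (n : ℤ) - ((2 * n + 1 - e : ℕ) : ℤ)) (2 * n - e)
      - xsj ι n (s + (PD ι n (2 * n + 1 - e) : ℤ) + (n : ℤ) - ((2 * n + 1 - e : ℕ) : ℤ))
          (2 * n + 1 - e)

/-- The column tableau `[j_1,…,j_k]_s = Σ_{i=1}^k box_{s+k-i}(j_i)`. -/
def tab (box : ℤ → ℕ → ℕ → ℚ) (s : ℤ) (k : ℕ) (j : ℕ → ℕ) : ℕ → ℚ :=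
  ∑ i ∈ Finset.Icc 1 k, box (s + (k : ℤ) - (i : ℤ)) (j i)

/-- The set `Tab_{A,ι}`. -/
def TabA (ι : ℕ → ℕ) (n : ℕ) : Set (ℕ → ℚ) :=
  { T | ∃ (k : ℕ) (s : ℤ) (j : ℕ → ℕ),
      1 ≤ k ∧ k ≤ n ∧
      (∀ i, 1 ≤ i → i ≤ k → 1 ≤ j i ∧ j i ≤ n + 1) ∧
      (∀ i, 1 ≤ i → i < k → j i < j (i + 1)) ∧
      1 - (PABC ι n k : ℤ) ≤ s ∧
      T = tab (boxA ι n) s k j }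

/-- `|·|` on encoded entries of `J_B = J_C`. -/
def absJ (n e : ℕ) : ℕ := if e ≤ n then e else 2 * n + 1 - e

/-- The set `Tab_{B,ι}`. -/
def TabB (ι : ℕ → ℕ) (n : ℕ) : Set (ℕ → ℚ) :=
  { T | ∃ (k : ℕ) (s : ℤ) (j : ℕ → ℕ),
      1 ≤ k ∧ k ≤ n ∧
      (∀ i, 1 ≤ i → i ≤ k → 1 ≤ j i ∧ j i ≤ 2 * n) ∧
      (∀ i, 1 ≤ i → i < k → j i < j (i + 1)) ∧
      (k = n → ∀ l m, 1 ≤ l → l < m → m ≤ k → absJ n (j l) ≠ absJ n (j m)) ∧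
      1 - (PABC ι n k : ℤ) ≤ s ∧
      T = tab (boxB ι n) s k j }

/-- Defining conditions of `Tab_{C,ι}` on the data `(k,s,j)`. -/
def TabCcond (ι : ℕ → ℕ) (n : ℕ) (k : ℕ) (s : ℤ) (j : ℕ → ℕ) : Prop :=
  (1 ≤ k ∧ k ≤ n - 1 ∧
    (∀ i, 1 ≤ i → i ≤ k → 1 ≤ j i ∧ j i ≤ 2 * n) ∧
    (∀ i, 1 ≤ i → i < k → j i < j (i + 1)) ∧
    1 - (PABC ι n k : ℤ) ≤ s)
  ∨
  (j 1 = 0 ∧ 1 ≤ k ∧ k ≤ n + 1 ∧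
    (∀ i, 2 ≤ i → i ≤ k → n + 1 ≤ j i ∧ j i ≤ 2 * n) ∧
    (∀ i, 2 ≤ i → i < k → j i < j (i + 1)) ∧
    1 - (PABC ι n n : ℤ) ≤ s)

/-- The set `Tab_{C,ι}`. -/
def TabC (ι : ℕ → ℕ) (n : ℕ) : Set (ℕ → ℚ) :=
  { T | ∃ k s j, TabCcond ι n k s j ∧ T = tab (boxC ι n) s k j }

/-- The partial order on (encoded) `J_D`: `a ≤ b` iff `a = b`, or `a < b` numerically and
`(a,b)` is not the incomparable pair `(n, n̄)`. -/
def leD (n a b : ℕ) : Prop := a = b ∨ (a < b ∧ ¬(a = n ∧ b = n + 1))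

/-- Defining conditions of `Tab_{D,ι}` on the data `(k,s,j)`. -/
def TabDcond (ι : ℕ → ℕ) (n : ℕ) (k : ℕ) (s : ℤ) (j : ℕ → ℕ) : Prop :=
  (1 ≤ k ∧ k ≤ n - 2 ∧
    (∀ i, 1 ≤ i → i ≤ k → 1 ≤ j i ∧ j i ≤ 2 * n) ∧
    (∀ i, 1 ≤ i → i < k → ¬ leD n (j (i + 1)) (j i)) ∧
    1 - (PD ι n k : ℤ) ≤ s)
  ∨
  (j 1 = 0 ∧ 1 ≤ k ∧ k ≤ n + 1 ∧
    (∀ i, 2 ≤ i → i ≤ k → n + 1 ≤ j i ∧ j i ≤ 2 * n) ∧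
    (∀ i, 2 ≤ i → i < k → j i < j (i + 1)) ∧
    (k % 2 = 0 → 1 - (PD ι n (n - 1) : ℤ) ≤ s) ∧
    (k % 2 = 1 → 1 - (PD ι n n : ℤ) ≤ s))

/-- The set `Tab_{D,ι}`. -/
def TabD (ι : ℕ → ℕ) (n : ℕ) : Set (ℕ → ℚ) :=
  { T | ∃ k s j, TabDcond ι n k s j ∧ T = tab (boxD ι n) s k j }

end

/-- Evaluation of a linear form on a finitely supported integer sequence. -/
def evalForm (φ : ℕ → ℚ) (a : ℕ →₀ ℤ) : ℚ := ∑ k ∈ a.support, φ k * (a k : ℚ)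

/-- The polyhedral cone `Σ_ι` cut out by `Ξ_ι`. -/
def Sig (A : ℕ → ℕ → ℤ) (ι : ℕ → ℕ) : Set (ℕ →₀ ℤ) :=
  { a | ∀ φ ∈ Xi A ι, 0 ≤ evalForm φ a }

/-- `Tab^n_{A,ι}`: tableaux of type A with parameter `s ≤ n`. -/
def TabAcut (ι : ℕ → ℕ) (n : ℕ) : Set (ℕ → ℚ) :=
  { T | ∃ (k : ℕ) (s : ℤ) (j : ℕ → ℕ),
      1 ≤ k ∧ k ≤ n ∧
      (∀ i, 1 ≤ i → i ≤ k → 1 ≤ j i ∧ j i ≤ n + 1) ∧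
      (∀ i, 1 ≤ i → i < k → j i < j (i + 1)) ∧
      1 - (PABC ι n k : ℤ) ≤ s ∧ s ≤ (n : ℤ) ∧
      T = tab (boxA ι n) s k j }

/-- `Tab^n_{B,ι}`: tableaux of type B with parameter `s ≤ n`. -/
def TabBcut (ι : ℕ → ℕ) (n : ℕ) : Set (ℕ → ℚ) :=
  { T | ∃ (k : ℕ) (s : ℤ) (j : ℕ → ℕ),
      1 ≤ k ∧ k ≤ n ∧
      (∀ i, 1 ≤ i → i ≤ k → 1 ≤ j i ∧ j i ≤ 2 * n) ∧
      (∀ i, 1 ≤ i → i < k → j i < j (i + 1)) ∧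
      (k = n → ∀ l m, 1 ≤ l → l < m → m ≤ k → absJ n (j l) ≠ absJ n (j m)) ∧
      1 - (PABC ι n k : ℤ) ≤ s ∧ s ≤ (n : ℤ) ∧
      T = tab (boxB ι n) s k j }

/-- `Tab^n_{C,ι}`: tableaux of type C with parameter `s ≤ n`. -/
def TabCcut (ι : ℕ → ℕ) (n : ℕ) : Set (ℕ → ℚ) :=
  { T | ∃ k s j, TabCcond ι n k s j ∧ s ≤ (n : ℤ) ∧ T = tab (boxC ι n) s k j }

/-- `Tab^n_{D,ι}`: tableaux of type D with parameter `s ≤ n`. -/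
def TabDcut (ι : ℕ → ℕ) (n : ℕ) : Set (ℕ → ℚ) :=
  { T | ∃ k s j, TabDcond ι n k s j ∧ s ≤ (n : ℤ) ∧ T = tab (boxD ι n) s k j }



/-! ### Counting occurrences -/

/-- number of occurrences of `i` among positions `1..q` -/
def cnt (ι : ℕ → ℕ) (i q : ℕ) : ℕ := ((Finset.Icc 1 q).filter (fun r => ι r = i)).card

lemma cnt_zero (ι : ℕ → ℕ) (i : ℕ) : cnt ι i 0 = 0 := by simp [cnt]

lemma cnt_succ (ι : ℕ → ℕ) (i q : ℕ) :
    cnt ι i (q + 1) = cnt ι i q + if ι (q + 1) = i then 1 else 0 := by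
  unfold cnt
  rw [← Finset.insert_Icc_right_eq_Icc_add_one (by omega : 1 ≤ q + 1), Finset.filter_insert]
  split_ifs with h
  · rw [Finset.card_insert_of_notMem (by simp)]
  · simp

lemma cnt_mono (ι : ℕ → ℕ) (i : ℕ) {p q : ℕ} (h : p ≤ q) : cnt ι i p ≤ cnt ι i q := by
  induction q, h using Nat.le_induction with
  | base => exact le_rfl
  | succ q _ ih => rw [cnt_succ]; omega

lemma cnt_lt (ι : ℕ → ℕ) (i : ℕ) {p q : ℕ} (h : p < q) (hq : ι q = i) :
    cnt ι i p < cnt ι i q := by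
  obtain ⟨q, rfl⟩ : ∃ q', q = q' + 1 := ⟨q - 1, by omega⟩
  have := cnt_mono ι i (show p ≤ q by omega)
  rw [cnt_succ, if_pos hq]; omega

lemma cnt_pos (ι : ℕ → ℕ) {p : ℕ} (hp : 1 ≤ p) : 1 ≤ cnt ι (ι p) p := by
  have := cnt_lt ι (ι p) (show 0 < p by omega) rfl
  omega

lemma cnt_const (ι : ℕ → ℕ) (i : ℕ) {p q : ℕ} (h : p ≤ q)
    (hn : ∀ r, p < r → r ≤ q → ι r ≠ i) : cnt ι i q = cnt ι i p := by
  induction q, h using Nat.le_induction with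
  | base => rfl
  | succ q hq ih =>
    rw [cnt_succ, if_neg (hn _ (by omega) le_rfl), add_zero, ih (fun r h1 h2 => hn r h1 (by omega))]

lemma cnt_inj (ι : ℕ → ℕ) {p q : ℕ} (h : ι p = ι q) (hc : cnt ι (ι p) p = cnt ι (ι q) q) :
    p = q := by
  rcases lt_trichotomy p q with h1 | h1 | h1
  · have := cnt_lt ι (ι q) h1 rfl
    rw [h] at hc; omega
  · exact h1
  · have := cnt_lt ι (ι p) h1 rfl
    rw [h] at hc this; omega

lemma occPos_spec {n : ℕ} {ι : ℕ → ℕ} (hadm : Admissible n ι) {i : ℕ} (h1 : 1 ≤ i) (h2 : i ≤ n) :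
    ∀ t, cnt ι i (occPos ι i t) = t ∧ (1 ≤ t → 1 ≤ occPos ι i t ∧ ι (occPos ι i t) = i) := by
  intro t
  induction t with
  | zero => simp [occPos, cnt_zero]
  | succ t ih =>
    have hne : {k | occPos ι i t < k ∧ ι k = i}.Nonempty := by
      obtain ⟨k, hk, hk'⟩ := hadm.2.2 i h1 h2 (occPos ι i t + 1)
      exact ⟨k, by omega, hk'⟩
    have hm := Nat.sInf_mem hne
    have hlt : ∀ r, occPos ι i t < r → r < sInf {k | occPos ι i t < k ∧ ι k = i} → ι r ≠ i := by
      intro r hr hr' h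
      exact Nat.notMem_of_lt_sInf hr' ⟨hr, h⟩
    simp only [occPos]
    set K := sInf {k | occPos ι i t < k ∧ ι k = i}
    obtain ⟨hm1, hm2⟩ := hm
    obtain ⟨K', hK'⟩ : ∃ q', K = q' + 1 := ⟨K - 1, by omega⟩
    refine ⟨?_, fun _ => ⟨by omega, hm2⟩⟩
    rw [hK', cnt_succ, ← hK', if_pos hm2, cnt_const ι i (show occPos ι i t ≤ K' by omega), ih.1]
    intro r hr hr'
    exact hlt r hr (by omega)

lemma occPos_cnt {n : ℕ} {ι : ℕ → ℕ} (hadm : Admissible n ι) {p : ℕ} (hp : 1 ≤ p) :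
    occPos ι (ι p) (cnt ι (ι p) p) = p := by
  obtain ⟨h1, h2⟩ := hadm.1 p hp
  have h := occPos_spec hadm h1 h2 (cnt ι (ι p) p)
  have h3 := (h.2 (cnt_pos ι hp)).2
  apply cnt_inj ι h3
  rw [h3, h.1]

lemma kplus_eq {n : ℕ} {ι : ℕ → ℕ} (hadm : Admissible n ι) {p : ℕ} (hp : 1 ≤ p) :
    kplus ι p = occPos ι (ι p) (cnt ι (ι p) p + 1) := by
  simp only [occPos, occPos_cnt hadm hp, kplus]

lemma kplus_spec {n : ℕ} {ι : ℕ → ℕ} (hadm : Admissible n ι) {p : ℕ} (hp : 1 ≤ p) :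
    p < kplus ι p ∧ ι (kplus ι p) = ι p ∧ cnt ι (ι p) (kplus ι p) = cnt ι (ι p) p + 1 := by
  obtain ⟨h1, h2⟩ := hadm.1 p hp
  have h := occPos_spec hadm h1 h2 (cnt ι (ι p) p + 1)
  rw [← kplus_eq hadm hp] at h
  refine ⟨?_, (h.2 (by omega)).2, h.1⟩
  by_contra hc
  have := cnt_mono ι (ι p) (not_lt.1 hc)
  omega

lemma kminus_spec {n : ℕ} {ι : ℕ → ℕ} (hadm : Admissible n ι) {p : ℕ} (hp : 1 ≤ p) :
    (cnt ι (ι p) p = 1 → kminus ι p = 0) ∧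
    (1 < cnt ι (ι p) p → 1 ≤ kminus ι p ∧ ι (kminus ι p) = ι p ∧
      cnt ι (ι p) (kminus ι p) + 1 = cnt ι (ι p) p) := by
  obtain ⟨h1, h2⟩ := hadm.1 p hp
  constructor
  · intro hc
    have : {l | 0 < l ∧ l < p ∧ ι l = ι p} = ∅ := by
      ext l
      simp only [Set.mem_ofPred_eq, Set.mem_empty_iff_false, iff_false]
      rintro ⟨a, b, c⟩
      have := cnt_lt ι (ι p) b rfl
      have := cnt_pos ι (show 1 ≤ l from a)
      rw [c] at this; omega
    unfold kminus
    rw [this]; simp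
  · intro hc
    obtain ⟨t, ht⟩ : ∃ t, cnt ι (ι p) p = t + 1 := ⟨cnt ι (ι p) p - 1, by omega⟩
    have h := occPos_spec hadm h1 h2 t
    obtain ⟨h3, h4⟩ := h.2 (by omega)
    have : kminus ι p = occPos ι (ι p) t := by
      unfold kminus
      apply IsGreatest.csSup_eq
      constructor
      · refine ⟨h3, ?_, h4⟩
        by_contra hc
        have := cnt_mono ι (ι p) (not_lt.1 hc)
        omega
      · rintro l ⟨a, b, c⟩
        by_contra hl
        have e1 := cnt_lt ι (ι p) (not_le.1 hl) c
        have e2 := cnt_lt ι (ι p) b rfl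
        omega
    rw [this]
    exact ⟨h3, h4, by rw [h.1, ht]⟩

/-! ### Alternation -/

lemma alt_aux {n : ℕ} {A : ℕ → ℕ → ℤ} {ι : ℕ → ℕ} (hadm : Admissible n ι) (had : Adapted n A ι)
    {i l : ℕ} (hi1 : 1 ≤ i) (hi2 : i ≤ n) (hl1 : 1 ≤ l) (hl2 : l ≤ n) (hil : i ≠ l)
    (hA : A i l ≠ 0) (hf : firstOcc ι i < firstOcc ι l) (q : ℕ) :
    (cnt ι i q = cnt ι l q ∧ ((cnt ι l q = 0 ∧ ∀ m, 1 ≤ m → m ≤ q → ι m ≠ i ∧ ι m ≠ l) ∨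
      ∃ r, 1 ≤ r ∧ r ≤ q ∧ ι r = l ∧ ∀ m, r < m → m ≤ q → ι m ≠ i ∧ ι m ≠ l)) ∨
    (cnt ι i q = cnt ι l q + 1 ∧
      ∃ r, 1 ≤ r ∧ r ≤ q ∧ ι r = i ∧ ∀ m, r < m → m ≤ q → ι m ≠ i ∧ ι m ≠ l) := by
  have had' := had i l hi1 hi2 hl1 hl2 hil hA
  induction q with
  | zero => left; refine ⟨by simp [cnt_zero], Or.inl ⟨by simp [cnt_zero], fun m h1 h2 => by omega⟩⟩
  | succ q ih =>
    by_cases h1 : ι (q + 1) = i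
    · have h2 : ι (q + 1) ≠ l := by omega
      rw [cnt_succ, cnt_succ, if_pos h1, if_neg h2]
      right
      rcases ih with ⟨e, _⟩ | ⟨e, r, r1, r2, r3, r4⟩
      · exact ⟨by omega, q + 1, by omega, le_rfl, h1, fun m _ _ => by omega⟩
      · exfalso
        exact had' r (q + 1) r1 (by omega) (Or.inl r3) (Or.inl h1)
          (fun m hm hm' => r4 m hm (by omega)) (by rw [r3, h1])
    · by_cases h2 : ι (q + 1) = l
      · rw [cnt_succ, cnt_succ, if_neg h1, if_pos h2]
        left
        rcases ih with ⟨e, ⟨_, f⟩ | ⟨r, r1, r2, r3, r4⟩⟩ | ⟨e, _⟩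
        · exfalso
          have hle : firstOcc ι l ≤ q + 1 := Nat.sInf_le ⟨by omega, h2⟩
          have hmem : firstOcc ι i ∈ {k | 1 ≤ k ∧ ι k = i} := by
            apply Nat.sInf_mem
            obtain ⟨k, a, b⟩ := hadm.2.2 i hi1 hi2 1
            exact ⟨k, a, b⟩
          exact (f (firstOcc ι i) hmem.1 (by omega)).1 hmem.2
        · exfalso
          exact had' r (q + 1) r1 (by omega) (Or.inr r3) (Or.inr h2)
            (fun m hm hm' => r4 m hm (by omega)) (by rw [r3, h2])
        · exact ⟨by omega, Or.inr ⟨q + 1, by omega, le_rfl, h2, fun m _ _ => by omega⟩⟩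
      · rw [cnt_succ, cnt_succ, if_neg h1, if_neg h2]
        have key : ∀ r, (∀ m, r < m → m ≤ q → ι m ≠ i ∧ ι m ≠ l) →
            (∀ m, r < m → m ≤ q + 1 → ι m ≠ i ∧ ι m ≠ l) := by
          intro r hr m hm hm'
          rcases Nat.lt_or_ge q m with h | h
          · obtain rfl : m = q + 1 := by omega
            exact ⟨h1, h2⟩
          · exact hr m hm h
        rcases ih with ⟨e, ⟨e0, f⟩ | ⟨r, r1, r2, r3, r4⟩⟩ | ⟨e, r, r1, r2, r3, r4⟩
        · exact Or.inl ⟨e, Or.inl ⟨e0, key 0 f⟩⟩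
        · exact Or.inl ⟨e, Or.inr ⟨r, r1, by omega, r3, key r r4⟩⟩
        · exact Or.inr ⟨e, r, r1, by omega, r3, key r r4⟩

lemma alt_cnt {n : ℕ} {A : ℕ → ℕ → ℤ} {ι : ℕ → ℕ} (hadm : Admissible n ι) (had : Adapted n A ι)
    {i l : ℕ} (hi1 : 1 ≤ i) (hi2 : i ≤ n) (hl1 : 1 ≤ l) (hl2 : l ≤ n) (hil : i ≠ l)
    (hA : A i l ≠ 0) (hA' : A l i ≠ 0) {q : ℕ} (hq : 1 ≤ q) (hq' : ι q = i) :
    cnt ι l q + pval ι i l = cnt ι i q ∧ pval ι l i + pval ι i l = 1 := by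
  obtain ⟨q, rfl⟩ : ∃ q', q = q' + 1 := ⟨q - 1, by omega⟩
  have hne : firstOcc ι i ≠ firstOcc ι l := by
    intro h
    have hmem : ∀ i, 1 ≤ i → i ≤ n → firstOcc ι i ∈ {k | 1 ≤ k ∧ ι k = i} := by
      intro i hi1 hi2
      apply Nat.sInf_mem
      obtain ⟨k, a, b⟩ := hadm.2.2 i hi1 hi2 1
      exact ⟨k, a, b⟩
    have a := (hmem i hi1 hi2).2
    have b := (hmem l hl1 hl2).2
    rw [h, b] at a
    exact hil a.symm
  have c1 := cnt_succ ι i q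
  have c2 := cnt_succ ι l q
  rw [if_pos hq'] at c1
  rw [if_neg (by omega)] at c2
  unfold pval
  rcases lt_or_gt_of_ne hne with h | h
  · have a1 := alt_aux hadm had hi1 hi2 hl1 hl2 hil hA h q
    have a2 := alt_aux hadm had hi1 hi2 hl1 hl2 hil hA h (q + 1)
    rw [if_pos h, if_neg (by omega)]
    omega
  · have a1 := alt_aux hadm had hl1 hl2 hi1 hi2 hil.symm hA' h q
    have a2 := alt_aux hadm had hl1 hl2 hi1 hi2 hil.symm hA' h (q + 1)
    rw [if_neg (by omega), if_pos h]
    omega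


/-! ### Untruncated forms -/

/-- The untruncated form `β` in shifted coordinates. -/
def bh (n : ℕ) (A : ℕ → ℕ → ℤ) (m : ℤ) (l : ℕ) : ℤ → ℕ → ℚ := fun m' i =>
  if 1 ≤ i ∧ i ≤ n then
    (if i = l then (if m' = m then 1 else 0) + (if m' = m + 1 then 1 else 0)
     else if m' = m + (if i < l then 1 else 0) then (A l i : ℚ) else 0)
  else 0

/-- the shifted coordinate form -/
def Yf (m : ℤ) (l : ℕ) : ℤ → ℕ → ℚ := fun m' i => if m' = m ∧ i = l then 1 else 0

/-- restriction of an untruncated form to actual positions -/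
def rho (ι : ℕ → ℕ) (P : ℕ → ℤ) (F : ℤ → ℕ → ℚ) : ℕ → ℚ := fun p =>
  if 1 ≤ p then F ((cnt ι (ι p) p : ℤ) - P (ι p)) (ι p) else 0

/-- compatibility of the potential `P` with the sequence. -/
def PotOK (n : ℕ) (A : ℕ → ℕ → ℤ) (ι : ℕ → ℕ) (P : ℕ → ℤ) : Prop :=
  ∀ i l, 1 ≤ i → i ≤ n → 1 ≤ l → l ≤ n → i ≠ l → A l i ≠ 0 →
    A i l ≠ 0 ∧ (pval ι i l : ℤ) = P i - P l + (if i < l then 1 else 0)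

lemma rho_sub_smul (ι : ℕ → ℕ) (P : ℕ → ℤ) (F G : ℤ → ℕ → ℚ) (c : ℚ) :
    rho ι P (F - c • G) = rho ι P F - c • rho ι P G := by
  funext p
  simp only [rho, Pi.sub_apply, Pi.smul_apply, smul_eq_mul]
  split_ifs <;> simp

lemma rho_sum {α : Type*} (ι : ℕ → ℕ) (P : ℕ → ℤ) (s : Finset α) (F : α → ℤ → ℕ → ℚ) :
    rho ι P (∑ i ∈ s, F i) = ∑ i ∈ s, rho ι P (F i) := by
  funext p
  simp only [rho, Finset.sum_apply]
  split_ifs <;> simp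

lemma beta_eval {n : ℕ} {A : ℕ → ℕ → ℤ} {ι : ℕ → ℕ} (hadm : Admissible n ι)
    {p : ℕ} (hp : 1 ≤ p) (q : ℕ) :
    beta A ι p q = (if q = p then 1 else 0) +
      (if p < q ∧ q < kplus ι p then (A (ι p) (ι q) : ℚ) else 0) +
      (if q = kplus ι p then 1 else 0) := by
  unfold beta
  rw [if_neg (by omega)]
  simp only [Pi.add_apply, Finset.sum_apply, Pi.smul_apply, smul_eq_mul, xc]
  congr 2
  simp [Finset.sum_ite_eq]

lemma beta_eq {n : ℕ} {A : ℕ → ℕ → ℤ} {ι : ℕ → ℕ} (hadm : Admissible n ι) (had : Adapted n A ι)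
    {P : ℕ → ℤ} (hP : PotOK n A ι P) {p : ℕ} (hp : 1 ≤ p) :
    beta A ι p = rho ι P (bh n A ((cnt ι (ι p) p : ℤ) - P (ι p)) (ι p)) := by
  funext q
  rw [beta_eval hadm hp]
  obtain ⟨k1, k2, k3⟩ := kplus_spec hadm hp
  unfold rho bh
  by_cases hq : 1 ≤ q
  · obtain ⟨q1, q2⟩ := hadm.1 q hq
    obtain ⟨p1, p2⟩ := hadm.1 p hp
    rw [if_pos hq, if_pos (show 1 ≤ ι q ∧ ι q ≤ n from ⟨q1, q2⟩)]
    by_cases h : ι q = ι p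
    · rw [if_pos h]
      have e1 : q = p ↔ ((cnt ι (ι q) q : ℤ) - P (ι q) = (cnt ι (ι p) p : ℤ) - P (ι p)) := by
        constructor
        · rintro rfl; rfl
        · intro e; apply cnt_inj ι h; rw [h] at e ⊢; omega
      have e2 : q = kplus ι p ↔
          ((cnt ι (ι q) q : ℤ) - P (ι q) = (cnt ι (ι p) p : ℤ) - P (ι p) + 1) := by
        constructor
        · intro e; subst e; rw [k2, k3]; push_cast; ring
        · intro e; apply cnt_inj ι (by rw [h, k2]); rw [k2, k3]; rw [h] at e ⊢; omega
      have e3 : ¬ (p < q ∧ q < kplus ι p) := by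
        rintro ⟨a, b⟩
        have := cnt_lt ι (ι p) a h
        have := cnt_lt ι (ι p) b k2
        omega
      rw [if_neg e3]
      simp only [e1, e2]
      ring
    · rw [if_neg h, if_neg (show ¬ q = p from fun e => h (by rw [e])),
        if_neg (show ¬ q = kplus ι p from fun e => h (by rw [e, k2]))]
      by_cases hA : A (ι p) (ι q) = 0
      · simp [hA]
      · obtain ⟨hA', hv⟩ := hP (ι q) (ι p) q1 q2 p1 p2 h hA
        have key := (alt_cnt hadm had q1 q2 p1 p2 h hA' hA hq rfl).1
        have e : (p < q ∧ q < kplus ι p) ↔ cnt ι (ι p) q = cnt ι (ι p) p := by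
          constructor
          · rintro ⟨a, b⟩
            have := cnt_mono ι (ι p) a.le
            have := cnt_lt ι (ι p) b k2
            omega
          · intro e
            constructor
            · by_contra hc
              rcases Nat.lt_or_ge q p with h3 | h3
              · have := cnt_lt ι (ι p) h3 rfl
                omega
              · exact h (by rw [show q = p by omega])
            · by_contra hc
              have := cnt_mono ι (ι p) (not_lt.1 hc)
              omega
        have e' : (cnt ι (ι p) q = cnt ι (ι p) p) ↔ ((cnt ι (ι q) q : ℤ) - P (ι q) =
            (cnt ι (ι p) p : ℤ) - P (ι p) + (if ι q < ι p then 1 else 0)) := by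
          constructor
          · intro; omega
          · intro; omega
        simp only [e.trans e']
        simp
  · rw [if_neg hq, if_neg (by omega), if_neg (by omega), if_neg (by omega)]; simp

lemma Sop_pos {n : ℕ} {A : ℕ → ℕ → ℤ} {ι : ℕ → ℕ} (hadm : Admissible n ι) (had : Adapted n A ι)
    {P : ℕ → ℤ} (hP : PotOK n A ι P) {p : ℕ} (hp : 1 ≤ p) (F : ℤ → ℕ → ℚ) {m : ℤ}
    (hm : m = (cnt ι (ι p) p : ℤ) - P (ι p)) (h : 0 < F m (ι p)) :
    Sop A ι p (rho ι P F) = rho ι P (F - F m (ι p) • bh n A m (ι p)) := by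
  have e : rho ι P F p = F m (ι p) := by rw [rho, if_pos hp, hm]
  unfold Sop
  rw [e, if_pos h, rho_sub_smul, beta_eq hadm had hP hp, hm]

lemma Sop_nonpos {n : ℕ} {A : ℕ → ℕ → ℤ} {ι : ℕ → ℕ} (hadm : Admissible n ι) (had : Adapted n A ι)
    {P : ℕ → ℤ} (hP : PotOK n A ι P) {p : ℕ} (hp : 1 ≤ p) (F : ℤ → ℕ → ℚ) {m : ℤ}
    (hm : m = (cnt ι (ι p) p : ℤ) - P (ι p)) (h : ¬ 0 < F m (ι p)) :
    Sop A ι p (rho ι P F) = rho ι P F ∨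
    Sop A ι p (rho ι P F) = rho ι P (F - F m (ι p) • bh n A (m - 1) (ι p)) := by
  have e : rho ι P F p = F m (ι p) := by rw [rho, if_pos hp, hm]
  unfold Sop
  rw [e, if_neg h]
  obtain ⟨k1, k2⟩ := kminus_spec hadm hp
  have := cnt_pos ι hp
  by_cases h1 : cnt ι (ι p) p = 1
  · left
    rw [k1 h1, beta, if_pos rfl]; simp
  · right
    obtain ⟨a, b, c⟩ := k2 (by omega)
    rw [rho_sub_smul, beta_eq hadm had hP a, b, hm]
    have e2 : (cnt ι (ι p) (kminus ι p) : ℤ) - P (ι p) = cnt ι (ι p) p - P (ι p) - 1 := by omega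
    rw [e2]

/-- Step in `Ξ` on restricted forms. -/
lemma Xi_step {n : ℕ} {A : ℕ → ℕ → ℤ} {ι : ℕ → ℕ} (hadm : Admissible n ι) (had : Adapted n A ι)
    {P : ℕ → ℤ} (hP : PotOK n A ι P) {F F' : ℤ → ℕ → ℚ} {m : ℤ} {l : ℕ} (hl1 : 1 ≤ l)
    (hl2 : l ≤ n) (hm : 1 ≤ m + P l) (hF : rho ι P F ∈ Xi A ι) (hpos : 0 < F m l)
    (hF' : F' = F - F m l • bh n A m l) : rho ι P F' ∈ Xi A ι := by
  have h := occPos_spec hadm hl1 hl2 (m + P l).toNat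
  obtain ⟨h1, h2⟩ := h.2 (by omega)
  have h3 := h.1
  set p := occPos ι l (m + P l).toNat
  have hm' : m = (cnt ι (ι p) p : ℤ) - P (ι p) := by rw [h2, h3]; omega
  have := Sop_pos hadm had hP h1 F hm' (by rw [h2]; exact hpos)
  rw [hF', ← h2, ← this]
  exact XiMem.step p h1 _ hF

lemma xsj_eval {n : ℕ} {ι : ℕ → ℕ} (hadm : Admissible n ι) (z : ℤ) (l p : ℕ) :
    xsj ι n z l p = if 1 ≤ p ∧ ι p = l ∧ (cnt ι (ι p) p : ℤ) = z then 1 else 0 := by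
  unfold xsj
  by_cases h : 1 ≤ z ∧ 1 ≤ l ∧ l ≤ n
  · rw [if_pos h]
    obtain ⟨a, b, c⟩ := h
    have h := occPos_spec hadm b c z.toNat
    obtain ⟨h1, h2⟩ := h.2 (by omega)
    have h3 := h.1
    unfold xc
    congr 1
    apply propext
    constructor
    · intro e; rw [e, h2, h3]; exact ⟨h1, rfl, by omega⟩
    · rintro ⟨e1, e2, e3⟩
      apply cnt_inj ι (by rw [h2, e2])
      rw [h2, h3]; omega
  · rw [if_neg h, if_neg]
    · rfl
    rintro ⟨e1, e2, e3⟩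
    have := cnt_pos ι e1
    have := hadm.1 p e1
    omega

lemma rho_Yf {n : ℕ} {ι : ℕ → ℕ} (hadm : Admissible n ι) (P : ℕ → ℤ) (m : ℤ) (l : ℕ) :
    rho ι P (Yf m l) = xsj ι n (m + P l) l := by
  funext p
  rw [xsj_eval hadm]
  unfold rho Yf
  by_cases hp : 1 ≤ p
  · rw [if_pos hp]
    congr 1
    apply propext
    constructor
    · rintro ⟨a, b⟩; rw [← b]; exact ⟨hp, rfl, by omega⟩
    · rintro ⟨a, b, c⟩; rw [b] at c ⊢; exact ⟨by omega, rfl⟩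
  · rw [if_neg hp, if_neg (by tauto)]

lemma Xi_base {n : ℕ} {A : ℕ → ℕ → ℤ} {ι : ℕ → ℕ} (hadm : Admissible n ι)
    {P : ℕ → ℤ} {m : ℤ} {l : ℕ} (hl1 : 1 ≤ l)
    (hl2 : l ≤ n) (hm : 1 ≤ m + P l) : rho ι P (Yf m l) ∈ Xi A ι := by
  rw [rho_Yf hadm, xsj, if_pos ⟨hm, hl1, hl2⟩]
  exact XiMem.base _ ((occPos_spec hadm hl1 hl2 _).2 (by omega)).1

lemma evalForm_xc (a : ℕ →₀ ℤ) (k : ℕ) : evalForm (xc k) a = (a k : ℚ) := by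
  unfold evalForm xc
  simp only [ite_mul, one_mul, zero_mul, Finset.sum_ite_eq']
  split_ifs with h
  · rfl
  · rw [Finsupp.notMem_support_iff.1 h]; simp

/-- Abstract reduction: a graded family of untruncated forms closed under the moves. -/
theorem generic {n : ℕ} {A : ℕ → ℕ → ℤ} {ι : ℕ → ℕ} (hadm : Admissible n ι) (had : Adapted n A ι)
    {P : ℕ → ℤ} (hP : PotOK n A ι P) (hP0 : ∀ l, 0 ≤ P l)
    (G : ℤ → (ℤ → ℕ → ℚ) → Prop) (cut : Set (ℕ → ℚ))
    (hdown : ∀ s F m l, G s F → 1 ≤ l → l ≤ n → 0 < F m l → G s (F - F m l • bh n A m l))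
    (hup : ∀ s F m l, G s F → 1 ≤ l → l ≤ n → F m l < 0 → G s (F - F m l • bh n A (m - 1) l))
    (hbase : ∀ (m : ℤ) l, 1 ≤ m → 1 ≤ l → l ≤ n → ∃ s, G s (Yf (m - P l) l))
    (hreach : ∀ s F, G s F → rho ι P F ∈ Xi A ι)
    (hsupp : ∀ s F m l, G s F → F m l ≠ 0 → s ≤ m)
    (hlow : ∀ (m : ℤ) l, n < m → 1 ≤ l → l ≤ n → ∃ s, G s (- Yf (m - P l) l))
    (hcut : ∀ φ, φ ∈ cut ↔ ∃ s F, G s F ∧ s ≤ n ∧ φ = rho ι P F) :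
    Sig A ι = { a | (∀ φ ∈ cut, 0 ≤ evalForm φ a) ∧
              ∀ m i, n < m → 1 ≤ i → i ≤ n → a (occPos ι i m) = 0 } := by
  have hXi : ∀ φ ∈ Xi A ι, ∃ s F, G s F ∧ φ = rho ι P F := by
    intro φ hφ
    induction hφ with
    | base k hk =>
      obtain ⟨h1, h2⟩ := hadm.1 k hk
      have hc := cnt_pos ι hk
      obtain ⟨s, hs⟩ := hbase (cnt ι (ι k) k) (ι k) (by omega) h1 h2
      refine ⟨s, _, hs, ?_⟩
      rw [rho_Yf hadm, xsj, if_pos ⟨by omega, h1, h2⟩]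
      simp [occPos_cnt hadm hk]
    | step k hk φ h ih =>
      obtain ⟨s, F, hG, rfl⟩ := ih
      obtain ⟨h1, h2⟩ := hadm.1 k hk
      by_cases hpos : 0 < F ((cnt ι (ι k) k : ℤ) - P (ι k)) (ι k)
      · exact ⟨s, _, hdown s F _ _ hG h1 h2 hpos, Sop_pos hadm had hP hk F rfl hpos⟩
      · rcases Sop_nonpos hadm had hP hk F rfl hpos with h' | h'
        · exact ⟨s, F, hG, h'⟩
        · rcases lt_or_eq_of_le (not_lt.1 hpos) with h3 | h3
          · exact ⟨s, _, hup s F _ _ hG h1 h2 h3, h'⟩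
          · refine ⟨s, F, hG, ?_⟩
            rw [h', h3]; simp
  apply Set.eq_of_subset_of_subset
  · intro a ha
    refine ⟨?_, ?_⟩
    · intro φ hφ
      obtain ⟨s, F, hG, _, rfl⟩ := (hcut φ).1 hφ
      exact ha _ (hreach s F hG)
    · intro m i hm hi1 hi2
      obtain ⟨s, hs⟩ := hlow m i (by omega) hi1 hi2
      have h1 := ha _ (hreach s _ hs)
      have h2 : rho ι P (-Yf (m - P i) i) = - xc (occPos ι i m) := by
        have : -Yf (m - P i) i = (0 : ℤ → ℕ → ℚ) - (1 : ℚ) • Yf (m - P i) i := by simp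
        rw [this, rho_sub_smul, rho_Yf hadm, xsj, if_pos ⟨by omega, hi1, hi2⟩]
        have : rho ι P 0 = 0 := by funext p; simp [rho]
        rw [this]; simp
      have h3 : 0 ≤ evalForm (xc (occPos ι i m)) a :=
        ha _ (XiMem.base _ ((occPos_spec hadm hi1 hi2 m).2 (by omega)).1)
      have h4 : evalForm (- xc (occPos ι i m)) a = - evalForm (xc (occPos ι i m)) a := by
        simp [evalForm]
      rw [h2, h4] at h1
      rw [evalForm_xc] at h1 h3
      have : (a (occPos ι i m) : ℚ) = 0 := by linarith
      exact_mod_cast this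
  · rintro a ⟨ha1, ha2⟩ φ hφ
    obtain ⟨s, F, hG, rfl⟩ := hXi φ hφ
    by_cases hs : s ≤ n
    · exact ha1 _ ((hcut _).2 ⟨s, F, hG, hs, rfl⟩)
    · apply le_of_eq
      symm
      apply Finset.sum_eq_zero
      intro p _
      unfold rho
      split_ifs with hp
      · by_cases hF : F ((cnt ι (ι p) p : ℤ) - P (ι p)) (ι p) = 0
        · simp [hF]
        · have h1 := hsupp s F _ _ hG hF
          have h2 := hP0 (ι p)
          obtain ⟨h3, h4⟩ := hadm.1 p hp
          have := ha2 (cnt ι (ι p) p) (ι p) (by omega) h3 h4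
          rw [occPos_cnt hadm hp] at this
          simp [this]
      · simp


/-! ### Vector columns -/

/-- combinatorial data of a family of columns -/
structure VP where
  n : ℕ
  top : ℕ
  w : ℕ
  a : ℕ → ℕ
  a' : ℕ → ℕ
  b : ℕ → ℕ
  b' : ℕ → ℕ
  d : ℕ → ℕ
  c : ℕ → ℚ

namespace VP

/-- single box -/
def bx (V : VP) (u : ℤ) (e : ℕ) : ℤ → ℕ → ℚ := fun m l =>
  if 1 ≤ l ∧ l ≤ V.n then
    V.c l * ((if e = V.a l ∧ m = u then 1 else 0) - (if e = V.a' l ∧ m = u + 1 then 1 else 0)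
      + (if e = V.b l ∧ m = u + V.d l then 1 else 0)
      - (if e = V.b' l ∧ m = u + V.d l + 1 then 1 else 0))
  else 0

/-- a column -/
def col (V : VP) (s : ℤ) (k : ℕ) (J : ℤ → ℕ) : ℤ → ℕ → ℚ := fun m l =>
  if 1 ≤ l ∧ l ≤ V.n then
    V.c l * ((if J (s + k - m) = V.a l then 1 else 0)
      - (if J (s + k - m + 1) = V.a' l then 1 else 0)
      + (if J (s + k - m + V.d l) = V.b l then 1 else 0)
      - (if J (s + k - m + V.d l + 1) = V.b' l then 1 else 0))
  else 0

/-- adjacency in columns -/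
def R (V : VP) (x y : ℕ) : Prop := x < y ∨ (x = V.w + 1 ∧ y = V.w)

/-- admissible column fillings -/
structure VCol (V : VP) (k : ℕ) (J : ℤ → ℕ) : Prop where
  lo : ∀ z, z ≤ 0 → J z = 0
  hi : ∀ z, (k : ℤ) < z → J z = V.top
  mid : ∀ z : ℤ, 1 ≤ z → z ≤ k → 1 ≤ J z ∧ J z < V.top
  adj : ∀ z : ℤ, 0 ≤ z → z ≤ k → V.R (J z) (J (z + 1))

/-- properties of the data -/
structure OK (V : VP) (A : ℕ → ℕ → ℤ) : Prop where
  hc : ∀ l, 1 ≤ l → l ≤ V.n → 0 < V.c l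
  ha : ∀ l, 1 ≤ l → l ≤ V.n → 1 ≤ V.a l ∧ V.a l < V.a' l ∧ V.a' l < V.top
  hb : ∀ l, 1 ≤ l → l ≤ V.n → (V.top < V.b l ∧ V.top < V.b' l ∧ V.d l = 0) ∨
    (V.a l < V.b l ∧ V.a' l < V.b' l ∧ V.b l ≠ V.a' l ∧ V.b l < V.b' l ∧ V.b' l < V.top)
  kind : ∀ l, 1 ≤ l → l ≤ V.n →
    (V.a' l = V.a l + 1 ∧ V.a l ≠ V.w ∧ V.a l ≠ V.w + 1 ∧ V.a' l ≠ V.w ∧ V.a' l ≠ V.w + 1 ∧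
      (V.top < V.b l ∨ (V.b' l = V.b l + 1 ∧ V.b l ≠ V.w ∧ V.b l ≠ V.w + 1 ∧ V.b' l ≠ V.w ∧
        V.b' l ≠ V.w + 1))) ∨
    (V.a l + 1 = V.w ∧ V.a' l = V.w ∧ V.b l = V.w + 1 ∧ V.b' l = V.w + 2 ∧ V.d l = 0) ∨
    (V.a l + 1 = V.w ∧ V.a' l = V.w + 1 ∧ V.b l = V.w ∧ V.b' l = V.w + 2 ∧ V.d l = 0)
  rela : ∀ u l, 1 ≤ l → l ≤ V.n → V.bx u (V.a l) - V.bx u (V.a' l) = V.c l • bh V.n A u l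
  relb : ∀ u l, 1 ≤ l → l ≤ V.n → V.b l < V.top →
    V.bx u (V.b l) - V.bx u (V.b' l) = V.c l • bh V.n A (u + V.d l) l

/-- properties for the induction -/
structure OK2 (V : VP) (P : ℕ → ℤ) (wt : ℕ → ℕ) (K : ℕ) : Prop where
  hwa : ∀ l, 1 ≤ l → l ≤ V.n → wt (V.a l) < wt (V.a' l)
  hwb : ∀ l, 1 ≤ l → l ≤ V.n → V.b l < V.top → wt (V.b l) < wt (V.b' l) ∧
    wt (V.a l) + wt (V.b' l) < wt (V.a' l) + wt (V.b l)
  hex : ∀ e, 2 ≤ e → e < V.top → ∃ l, 1 ≤ l ∧ l ≤ V.n ∧ (V.a' l = e ∨ V.b' l = e)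
  hK : K ≤ V.n
  hw : K ≤ V.w
  hck : ∀ k, 1 ≤ k → k ≤ K → V.c k = 1
  hak : ∀ k l, 1 ≤ k → k ≤ K → 1 ≤ l → l ≤ V.n → (V.a l = k ↔ l = k)
  hak' : ∀ k l, 1 ≤ k → k ≤ K → 1 ≤ l → l ≤ V.n → (k < V.a l ∨ V.a' l = V.a l + 1)
  hbk : ∀ k l, 1 ≤ k → k ≤ K → 1 ≤ l → l ≤ V.n → k < V.b l
  hdk : ∀ k l, 1 ≤ k → k ≤ K → 1 ≤ l → l ≤ V.n → 0 < V.d l → k < V.a l + V.d l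
  hPb : ∀ k l, 1 ≤ k → k ≤ K → 1 ≤ l → l ≤ V.n → V.b l < V.top → 0 ≤ V.d l + P l - P k
  hPa : ∀ (k l i : ℕ), 1 ≤ k → k ≤ K → 1 ≤ l → l ≤ V.n → i ≤ V.a l → i ≤ k →
    0 ≤ (k : ℤ) - i + P l - P k

variable {V : VP} {A : ℕ → ℕ → ℤ} {P : ℕ → ℤ} {wt : ℕ → ℕ} {K : ℕ}

lemma neg_of_cmul {c x : ℚ} (hc : 0 < c) (h : c * x < 0) : x < 0 := by
  by_contra hcon
  exact absurd (mul_nonneg hc.le (not_lt.1 hcon)) (not_le.2 h)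

lemma ind_cases {p1 p2 q1 q2 : Prop} [Decidable p1] [Decidable p2] [Decidable q1] [Decidable q2]
    (h : (0 : ℚ) < (if p1 then 1 else 0) - (if p2 then 1 else 0) + (if q1 then 1 else 0)
      - (if q2 then 1 else 0)) :
    ((p1 ∧ ¬ p2) ∧ (q1 ∧ ¬ q2)) ∨
    ((p1 ∧ ¬ p2) ∧ ((if q1 then 1 else 0) - (if q2 then 1 else 0) : ℚ) = 0 ∧ ¬ (¬ q1 ∧ q2)) ∨
    ((q1 ∧ ¬ q2) ∧ ((if p1 then 1 else 0) - (if p2 then 1 else 0) : ℚ) = 0 ∧ ¬ (¬ p1 ∧ p2)) := by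
  by_cases p1 <;> by_cases p2 <;> by_cases q1 <;> by_cases q2 <;> simp_all <;> norm_num at h

lemma ind_cases' {p1 p2 q1 q2 : Prop} [Decidable p1] [Decidable p2] [Decidable q1] [Decidable q2]
    (h : (if p1 then 1 else 0) - (if p2 then 1 else 0) + (if q1 then 1 else 0)
      - (if q2 then 1 else 0) < (0 : ℚ)) :
    ((¬ p1 ∧ p2) ∧ (¬ q1 ∧ q2)) ∨
    ((¬ p1 ∧ p2) ∧ ((if q1 then 1 else 0) - (if q2 then 1 else 0) : ℚ) = 0 ∧ ¬ (q1 ∧ ¬ q2)) ∨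
    ((¬ q1 ∧ q2) ∧ ((if p1 then 1 else 0) - (if p2 then 1 else 0) : ℚ) = 0 ∧ ¬ (p1 ∧ ¬ p2)) := by
  by_cases p1 <;> by_cases p2 <;> by_cases q1 <;> by_cases q2 <;> simp_all <;> norm_num at h

lemma ind_update (J : ℤ → ℕ) (i : ℤ) (e x : ℕ) (y : ℤ) (q : Prop) [Decidable q] (hq : y = i ↔ q) :
    (if Function.update J i e y = x then (1 : ℚ) else 0) =
      (if J y = x then 1 else 0) + ((if e = x ∧ q then 1 else 0) - (if J i = x ∧ q then 1 else 0)) := by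
  by_cases h : y = i
  · have := hq.1 h
    subst h
    simp [this]
  · have : ¬ q := fun hh => h (hq.2 hh)
    simp [this, Function.update_of_ne h]

lemma col_update (s : ℤ) (k : ℕ) (J : ℤ → ℕ) (i : ℤ) (e : ℕ) :
    V.col s k (Function.update J i e) =
      V.col s k J + (V.bx (s + k - i) e - V.bx (s + k - i) (J i)) := by
  funext m l
  simp only [Pi.add_apply, Pi.sub_apply, col, bx]
  by_cases h : 1 ≤ l ∧ l ≤ V.n
  · simp only [if_pos h]
    rw [ind_update J i e (V.a l) (s + k - m) (m = s + k - i) (by omega),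
      ind_update J i e (V.a' l) (s + k - m + 1) (m = s + k - i + 1) (by omega),
      ind_update J i e (V.b l) (s + k - m + V.d l) (m = s + k - i + V.d l) (by omega),
      ind_update J i e (V.b' l) (s + k - m + V.d l + 1) (m = s + k - i + V.d l + 1) (by omega)]
    ring
  · simp only [if_neg h]; ring

lemma VCol.le_top {k : ℕ} {J : ℤ → ℕ} (hJ : V.VCol k J) (z : ℤ) : J z ≤ V.top := by
  rcases le_or_gt z 0 with h | h
  · rw [hJ.lo z h]; omega
  · rcases le_or_gt z k with h' | h'
    · exact (hJ.mid z h h').2.le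
    · rw [hJ.hi z h']

lemma VCol.range {k : ℕ} {J : ℤ → ℕ} (hJ : V.VCol k J) {z : ℤ} (h1 : 1 ≤ J z) (h2 : J z < V.top) :
    1 ≤ z ∧ z ≤ k := by
  constructor
  · by_contra h; rw [hJ.lo z (by omega)] at h1; omega
  · by_contra h; rw [hJ.hi z (by omega)] at h2; omega

/-- changing one entry -/
lemma VCol.upd {k : ℕ} {J : ℤ → ℕ} (hJ : V.VCol k J) {z : ℤ} (hz1 : 1 ≤ z) (hz2 : z ≤ k)
    {e : ℕ} (he1 : 1 ≤ e) (he2 : e < V.top) (h1 : V.R (J (z - 1)) e) (h2 : V.R e (J (z + 1))) :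
    V.VCol k (Function.update J z e) := by
  constructor
  · intro y hy; rw [Function.update_of_ne (by omega)]; exact hJ.lo y hy
  · intro y hy; rw [Function.update_of_ne (by omega)]; exact hJ.hi y hy
  · intro y hy hy'
    by_cases h : y = z
    · subst h; simp [he1, he2]
    · rw [Function.update_of_ne h]; exact hJ.mid y hy hy'
  · intro y hy hy'
    by_cases h : y = z
    · subst h; rw [Function.update_self, Function.update_of_ne (by omega)]; exact h2
    · by_cases h' : y + 1 = z
      · subst h'
        rw [Function.update_self, Function.update_of_ne (by omega)]
        simpa using h1
      · rw [Function.update_of_ne h, Function.update_of_ne h']; exact hJ.adj y hy hy'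

lemma VCol.adj' {k : ℕ} {J : ℤ → ℕ} (hJ : V.VCol k J) {z : ℤ} (h1 : 1 ≤ z) (h2 : z ≤ k) :
    V.R (J (z - 1)) (J z) ∧ V.R (J z) (J (z + 1)) := by
  have := hJ.adj (z - 1) (by omega) (by omega)
  rw [sub_add_cancel] at this
  exact ⟨this, hJ.adj z (by omega) h2⟩

section edges

lemma down_a {l : ℕ} (hV : V.OK A) (hl1 : 1 ≤ l) (hl2 : l ≤ V.n)
    {k : ℕ} {J : ℤ → ℕ} (hJ : V.VCol k J) {z : ℤ} (h : J z = V.a l)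
    (h' : J (z + 1) ≠ V.a' l) : V.VCol k (Function.update J z (V.a' l)) := by
  have ha := hV.ha l hl1 hl2
  have hk := hV.kind l hl1 hl2
  obtain ⟨z1, z2⟩ := hJ.range (z := z) (by omega) (by omega)
  obtain ⟨r1, r2⟩ := hJ.adj' z1 z2
  rw [h] at r1 r2
  apply hJ.upd z1 z2 (by omega) (by omega) <;> unfold R at * <;> omega

lemma down_b {l : ℕ} (hV : V.OK A) (hl1 : 1 ≤ l) (hl2 : l ≤ V.n)
    {k : ℕ} {J : ℤ → ℕ} (hJ : V.VCol k J) {z : ℤ} (h : J z = V.b l)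
    (h' : J (z + 1) ≠ V.b' l) (h'' : V.d l = 0 → J (z + 1) ≠ V.a' l) :
    V.VCol k (Function.update J z (V.b' l)) := by
  have ha := hV.ha l hl1 hl2
  have hk := hV.kind l hl1 hl2
  have hb := hV.hb l hl1 hl2
  have := hJ.le_top z
  obtain ⟨z1, z2⟩ := hJ.range (z := z) (by omega) (by omega)
  obtain ⟨r1, r2⟩ := hJ.adj' z1 z2
  rw [h] at r1 r2
  apply hJ.upd z1 z2 (by omega) (by omega) <;> unfold R at * <;> omega

lemma up_a {l : ℕ} (hV : V.OK A) (hl1 : 1 ≤ l) (hl2 : l ≤ V.n)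
    {k : ℕ} {J : ℤ → ℕ} (hJ : V.VCol k J) {z : ℤ} (h : J (z + 1) = V.a' l)
    (h' : J z ≠ V.a l) (h'' : V.d l = 0 → J z ≠ V.b l) :
    V.VCol k (Function.update J (z + 1) (V.a l)) := by
  have ha := hV.ha l hl1 hl2
  have hk := hV.kind l hl1 hl2
  obtain ⟨z1, z2⟩ := hJ.range (z := z + 1) (by omega) (by omega)
  obtain ⟨r1, r2⟩ := hJ.adj' z1 z2
  rw [h] at r1 r2
  rw [add_sub_cancel_right] at r1
  apply hJ.upd z1 z2 (by omega) (by omega)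
  · rw [add_sub_cancel_right]; unfold R at *; omega
  · unfold R at *; omega

lemma up_b {l : ℕ} (hV : V.OK A) (hl1 : 1 ≤ l) (hl2 : l ≤ V.n)
    {k : ℕ} {J : ℤ → ℕ} (hJ : V.VCol k J) {z : ℤ} (h : J (z + 1) = V.b' l)
    (h' : J z ≠ V.b l) :
    V.VCol k (Function.update J (z + 1) (V.b l)) := by
  have ha := hV.ha l hl1 hl2
  have hk := hV.kind l hl1 hl2
  have hb := hV.hb l hl1 hl2
  have := hJ.le_top (z + 1)
  obtain ⟨z1, z2⟩ := hJ.range (z := z + 1) (by omega) (by omega)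
  obtain ⟨r1, r2⟩ := hJ.adj' z1 z2
  rw [h] at r1 r2
  rw [add_sub_cancel_right] at r1
  apply hJ.upd z1 z2 (by omega) (by omega)
  · rw [add_sub_cancel_right]; unfold R at *; omega
  · unfold R at *; omega

lemma col_upd_a {l : ℕ} (hV : V.OK A) (hl1 : 1 ≤ l) (hl2 : l ≤ V.n)
    {s : ℤ} {k : ℕ} {J : ℤ → ℕ} {z : ℤ} (h : J z = V.a l) :
    V.col s k (Function.update J z (V.a' l)) = V.col s k J - V.c l • bh V.n A (s + k - z) l := by
  rw [col_update, h, ← hV.rela _ l hl1 hl2]; ring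

lemma col_upd_a' {l : ℕ} (hV : V.OK A) (hl1 : 1 ≤ l) (hl2 : l ≤ V.n)
    {s : ℤ} {k : ℕ} {J : ℤ → ℕ} {z : ℤ} (h : J z = V.a' l) :
    V.col s k (Function.update J z (V.a l)) = V.col s k J + V.c l • bh V.n A (s + k - z) l := by
  rw [col_update, h, ← hV.rela _ l hl1 hl2]

lemma col_upd_b {l : ℕ} (hV : V.OK A) (hl1 : 1 ≤ l) (hl2 : l ≤ V.n)
    {s : ℤ} {k : ℕ} {J : ℤ → ℕ} {z : ℤ} (hJ : V.VCol k J) (h : J z = V.b l) :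
    V.col s k (Function.update J z (V.b' l)) =
      V.col s k J - V.c l • bh V.n A (s + k - z + V.d l) l := by
  have hb := hV.hb l hl1 hl2
  have := hJ.le_top z
  rw [col_update, h, ← hV.relb _ l hl1 hl2 (by omega)]; ring

lemma col_upd_b' {l : ℕ} (hV : V.OK A) (hl1 : 1 ≤ l) (hl2 : l ≤ V.n)
    {s : ℤ} {k : ℕ} {J : ℤ → ℕ} {z : ℤ} (hJ : V.VCol k J) (h : J z = V.b' l) :
    V.col s k (Function.update J z (V.b l)) =
      V.col s k J + V.c l • bh V.n A (s + k - z + V.d l) l := by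
  have hb := hV.hb l hl1 hl2
  have := hJ.le_top z
  rw [col_update, h, ← hV.relb _ l hl1 hl2 (by omega)]

/-- evaluation of a column -/
lemma col_apply {l : ℕ} (hl1 : 1 ≤ l) (hl2 : l ≤ V.n)
    (s : ℤ) (k : ℕ) (J : ℤ → ℕ) (m : ℤ) (z : ℤ) (hz : z = s + k - m) :
    V.col s k J m l = V.c l * ((if J z = V.a l then 1 else 0)
      - (if J (z + 1) = V.a' l then 1 else 0)
      + (if J (z + V.d l) = V.b l then 1 else 0)
      - (if J (z + V.d l + 1) = V.b' l then 1 else 0)) := by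
  rw [col, if_pos ⟨hl1, hl2⟩, hz]

theorem col_down {l : ℕ} (hV : V.OK A) (hl1 : 1 ≤ l) (hl2 : l ≤ V.n)
    {s : ℤ} {k : ℕ} {J : ℤ → ℕ} (hJ : V.VCol k J) {m : ℤ} (h : 0 < V.col s k J m l) :
    ∃ J', V.VCol k J' ∧ V.col s k J' = V.col s k J - V.col s k J m l • bh V.n A m l := by
  have ha := hV.ha l hl1 hl2
  have hb := hV.hb l hl1 hl2
  have hc := hV.hc l hl1 hl2
  obtain ⟨z, hz⟩ : ∃ z : ℤ, z = s + k - m := ⟨_, rfl⟩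
  have hv := col_apply hl1 hl2 s k J m z hz
  have hm : s + k - z = m := by omega
  have hm' : s + k - (z + V.d l) + V.d l = m := by omega
  rw [hv] at h
  have h := (mul_pos_iff_of_pos_left hc).1 h
  rcases ind_cases h with ⟨h1, h2⟩ | ⟨h1, h2, _⟩ | ⟨h2, h3, h4⟩
  · have hd : V.d l ≠ 0 := by
      intro e; have := h2.1; rw [e] at this; simp at this; omega
    have d1 := down_b hV hl1 hl2 hJ h2.1 h2.2 (by omega)
    have e1 : Function.update J (z + V.d l) (V.b' l) z = V.a l := by
      rw [Function.update_of_ne (by omega)]; exact h1.1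
    refine ⟨_, down_a hV hl1 hl2 d1 e1 ?_, ?_⟩
    · by_cases e : z + 1 = z + V.d l
      · rw [e, Function.update_self]; omega
      · rw [Function.update_of_ne e]; exact h1.2
    · rw [col_upd_a hV hl1 hl2 e1, col_upd_b hV hl1 hl2 hJ h2.1, hv, hm, hm',
        if_pos h1.1, if_neg h1.2, if_pos h2.1, if_neg h2.2]
      module
  · refine ⟨_, down_a hV hl1 hl2 hJ h1.1 h1.2, ?_⟩
    rw [col_upd_a hV hl1 hl2 h1.1, hv, hm, if_pos h1.1, if_neg h1.2,
      show ∀ x y : ℚ, 1 - 0 + x - y = 1 + (x - y) by intros; ring, h2]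
    module
  · refine ⟨_, down_b hV hl1 hl2 hJ h2.1 h2.2 ?_, ?_⟩
    · intro e hh
      have h5 := h2.1
      rw [e] at h5 hh; simp at h5 hh
      exact h4 ⟨by omega, hh⟩
    · rw [col_upd_b hV hl1 hl2 hJ h2.1, hv, hm', h3, if_pos h2.1, if_neg h2.2]
      module

theorem col_up {l : ℕ} (hV : V.OK A) (hl1 : 1 ≤ l) (hl2 : l ≤ V.n)
    {s : ℤ} {k : ℕ} {J : ℤ → ℕ} (hJ : V.VCol k J) {m : ℤ} (h : V.col s k J m l < 0) :
    ∃ J', V.VCol k J' ∧ V.col s k J' = V.col s k J - V.col s k J m l • bh V.n A (m - 1) l := by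
  have ha := hV.ha l hl1 hl2
  have hb := hV.hb l hl1 hl2
  have hc := hV.hc l hl1 hl2
  obtain ⟨z, hz⟩ : ∃ z : ℤ, z = s + k - m := ⟨_, rfl⟩
  have hv := col_apply hl1 hl2 s k J m z hz
  have hm : s + k - (z + 1) = m - 1 := by omega
  have hm' : s + k - (z + V.d l + 1) + V.d l = m - 1 := by omega
  rw [hv] at h
  have h := neg_of_cmul hc h
  rcases ind_cases' h with ⟨h1, h2⟩ | ⟨h1, h3, h4⟩ | ⟨h2, h3, _⟩
  · have hd : V.d l ≠ 0 := by
      intro e; have := h2.2; rw [e] at this; simp at this; omega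
    have d1 := up_a hV hl1 hl2 hJ h1.2 h1.1 (by omega)
    have e1 : Function.update J (z + 1) (V.a l) (z + V.d l + 1) = V.b' l := by
      rw [Function.update_of_ne (by omega)]; exact h2.2
    refine ⟨_, up_b hV hl1 hl2 d1 e1 ?_, ?_⟩
    · by_cases e : z + V.d l = z + 1
      · rw [e, Function.update_self]; omega
      · rw [Function.update_of_ne e]; exact h2.1
    · rw [col_upd_b' hV hl1 hl2 d1 e1, col_upd_a' hV hl1 hl2 h1.2, hv, hm, hm',
        if_pos h1.2, if_neg h1.1, if_pos h2.2, if_neg h2.1]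
      module
  · refine ⟨_, up_a hV hl1 hl2 hJ h1.2 h1.1 ?_, ?_⟩
    · intro e hh
      have h5 := h1.2
      rw [e] at h4; simp at h4
      have := h4 hh
      omega
    · rw [col_upd_a' hV hl1 hl2 h1.2, hv, hm, if_pos h1.2, if_neg h1.1,
        show ∀ x y : ℚ, 0 - 1 + x - y = -1 + (x - y) by intros; ring, h3]
      module
  · refine ⟨_, up_b hV hl1 hl2 hJ h2.2 h2.1, ?_⟩
    rw [col_upd_b' hV hl1 hl2 hJ h2.2, hv, hm', h3, if_pos h2.2, if_neg h2.1]
    module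

end edges

lemma col_supp (hV : V.OK A) {s : ℤ} {k : ℕ} {J : ℤ → ℕ} (hJ : V.VCol k J) {m : ℤ} {l : ℕ}
    (h : V.col s k J m l ≠ 0) : s ≤ m := by
  by_contra hc
  apply h
  by_cases hl : 1 ≤ l ∧ l ≤ V.n
  · have ha := hV.ha l hl.1 hl.2
    have hb := hV.hb l hl.1 hl.2
    rw [col_apply hl.1 hl.2 s k J m _ rfl]
    rw [hJ.hi (s + k - m) (by omega), hJ.hi (s + k - m + 1) (by omega),
      hJ.hi (s + k - m + V.d l) (by omega), hJ.hi (s + k - m + V.d l + 1) (by omega)]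
    rw [if_neg (by omega), if_neg (by omega), if_neg (by omega), if_neg (by omega)]
    ring
  · rw [col, if_neg hl]

end VP


namespace VP

variable {V : VP} {A : ℕ → ℕ → ℤ} {P : ℕ → ℤ} {wt : ℕ → ℕ} {K : ℕ}

/-- induction measure -/
noncomputable def mu (wt : ℕ → ℕ) (k : ℕ) (J : ℤ → ℕ) : ℕ := ∑ i ∈ Finset.Icc (1 : ℤ) k, wt (J i)

lemma mu_update (wt : ℕ → ℕ) (k : ℕ) (J : ℤ → ℕ) {i : ℤ} (h1 : 1 ≤ i) (h2 : i ≤ k) (e : ℕ) :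
    mu wt k (Function.update J i e) + wt (J i) = mu wt k J + wt e := by
  have hi : i ∈ Finset.Icc (1 : ℤ) k := Finset.mem_Icc.2 ⟨h1, h2⟩
  unfold mu
  rw [← Finset.add_sum_erase _ _ hi, ← Finset.add_sum_erase _ (fun i => wt (J i)) hi]
  have : ∑ x ∈ (Finset.Icc (1 : ℤ) k).erase i, wt (Function.update J i e x) =
      ∑ x ∈ (Finset.Icc (1 : ℤ) k).erase i, wt (J x) := by
    apply Finset.sum_congr rfl
    intro x hx
    rw [Function.update_of_ne (Finset.ne_of_mem_erase hx)]
  rw [this, Function.update_self]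
  ring

lemma col_base (hV : V.OK A) (h2 : V.OK2 P wt K) {s : ℤ} {k : ℕ} (hk1 : 1 ≤ k) (hk2 : k ≤ K)
    {J : ℤ → ℕ} (hJ : V.VCol k J) (h : ∀ i : ℕ, 1 ≤ i → i ≤ k → J i = i) :
    V.col s k J = Yf s k := by
  have hK := h2.hK
  have hval : ∀ z : ℤ, ∀ x : ℕ, 1 ≤ x → x ≠ V.top → (J z = x ↔ z = x ∧ x ≤ k) := by
    intro z x hx1 hx2
    rcases le_or_gt z 0 with hz | hz
    · rw [hJ.lo z hz]; omega
    · rcases le_or_gt z k with hz' | hz'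
      · have := h z.toNat (by omega) (by omega)
        rw [Int.toNat_of_nonneg hz.le] at this
        rw [this]; omega
      · rw [hJ.hi z hz']; omega
  funext m l
  by_cases hl : 1 ≤ l ∧ l ≤ V.n
  · have ha := hV.ha l hl.1 hl.2
    have hb := hV.hb l hl.1 hl.2
    have hak := h2.hak k l hk1 hk2 hl.1 hl.2
    have hak' := h2.hak' k l hk1 hk2 hl.1 hl.2
    have hbk := h2.hbk k l hk1 hk2 hl.1 hl.2
    have hka := hV.ha k hk1 (by omega)
    have hkk := (h2.hak k k hk1 hk2 hk1 (by omega)).2 rfl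
    rw [col_apply hl.1 hl.2 s k J m _ rfl]
    simp only [hval _ (V.a l) (by omega) (by omega), hval _ (V.a' l) (by omega) (by omega),
      hval _ (V.b l) (by omega) (by omega), hval _ (V.b' l) (by omega) (by omega)]
    rw [if_neg (show ¬ (s + k - m + V.d l = V.b l ∧ V.b l ≤ k) by omega),
      if_neg (show ¬ (s + k - m + V.d l + 1 = V.b' l ∧ V.b' l ≤ k) by omega)]
    unfold Yf
    by_cases h4 : V.a l = k
    · have h5 := hak.1 h4
      rw [if_neg (show ¬ (s + k - m + 1 = V.a' l ∧ V.a' l ≤ k) by omega)]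
      have hc := h2.hck k hk1 hk2
      rw [← h5] at hc
      rw [hc]
      by_cases h6 : m = s
      · rw [if_pos ⟨by omega, by omega⟩, if_pos ⟨h6, h5⟩]; ring
      · rw [if_neg (by omega), if_neg (by omega)]; ring
    · rw [if_neg (show ¬ (m = s ∧ l = k) by tauto)]
      by_cases h6 : s + k - m = V.a l ∧ V.a l ≤ k
      · rw [if_pos h6, if_pos (by omega)]; ring
      · rw [if_neg h6, if_neg (by omega)]; ring
  · rw [col, if_neg hl, Yf, if_neg (by omega)]

set_option maxHeartbeats 4000000 in
/-- The low column. -/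
lemma col_low (hV : V.OK A) {s : ℤ} {k q : ℕ} {D : ℤ} (hq : 1 ≤ q ∧ q ≤ V.n) (hkt : k + 1 < V.top)
    (hc : V.c q = 1)
    (hl : ∀ l, 1 ≤ l → l ≤ V.n →
      ((V.a' l + k < V.top ∨ (V.a' l = V.a l + 1 ∧ V.a' l < V.top))) ∧
      ((V.b' l + k < V.top ∧ V.b l + k < V.top) ∨ (V.b' l = V.b l + 1 ∧ V.b' l < V.top) ∨
        V.top < V.b l) ∧
      (V.a' l + k = V.top ↔ (l = q ∧ D = k)) ∧
      (V.b' l + k = V.top ↔ (l = q ∧ D = k + V.d l ∧ ¬ V.a' l + k = V.top)) ∧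
      (l = q → D = k ∨ D = k + V.d l) ∧ ¬ (V.a' l + k = V.top ∧ V.b' l + k = V.top)) :
    ∃ J, V.VCol k J ∧ V.col s k J = - Yf (s + D) q := by
  let J : ℤ → ℕ := fun z => if z ≤ 0 then 0 else if (k : ℤ) < z then V.top else
    V.top - 1 - k + z.toNat
  have hJ : V.VCol k J := by
    constructor
    · intro z hz; simp [J, hz]
    · intro z hz; simp only [J]; rw [if_neg (by omega), if_pos hz]
    · intro z h1 h2; simp only [J]; rw [if_neg (by omega), if_neg (by omega)]; omega
    · intro z h1 h2
      simp only [J, R]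
      left
      split_ifs <;> omega
  refine ⟨J, hJ, ?_⟩
  have hval : ∀ z : ℤ, ∀ x : ℕ, 1 ≤ x → x ≠ V.top → (J z = x ↔
      z + V.top = x + k + 1 ∧ V.top ≤ x + k ∧ x < V.top) := by
    intro z x hx1 hx2
    simp only [J]
    split_ifs <;> omega
  funext m l
  by_cases hl' : 1 ≤ l ∧ l ≤ V.n
  · have ha := hV.ha l hl'.1 hl'.2
    have hb := hV.hb l hl'.1 hl'.2
    have hll := hl l hl'.1 hl'.2
    obtain ⟨c1, c2, c3, c4, c5, c6⟩ := hll
    rw [col_apply hl'.1 hl'.2 s k J m _ rfl]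
    simp only [hval _ (V.a l) (by omega) (by omega), hval _ (V.a' l) (by omega) (by omega),
      hval _ (V.b l) (by omega) (by omega), hval _ (V.b' l) (by omega) (by omega)]
    simp only [Pi.neg_apply, Yf]
    by_cases h1 : V.a' l + k = V.top
    · have h3 := c3.1 h1
      have h2 : V.b' l + k ≠ V.top := fun h => c6 ⟨h1, h⟩
      rw [show V.c l = 1 by rw [h3.1]; exact hc]
      clear c3 c4 c5 c6 c1 hval hl hJ
      have hbb : V.top < V.b l ∧ V.top < V.b' l ∨ V.b' l + k < V.top ∧ V.b l + k < V.top ∨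
        (V.b' l = V.b l + 1 ∧ V.b' l < V.top) := by
        omega
      clear c2 hb
      have e1 : ¬ (s + k - m + V.top = V.a l + k + 1 ∧ V.top ≤ V.a l + k ∧ V.a l < V.top) := by
        omega
      rw [if_neg e1]
      by_cases h6 : m = s + D
      · rw [if_pos (show s + k - m + 1 + V.top = V.a' l + k + 1 ∧ V.top ≤ V.a' l + k ∧
          V.a' l < V.top by omega), if_pos (⟨h6, h3.1⟩ : _ ∧ _)]
        by_cases h7 : s + k - m + V.d l + V.top = V.b l + k + 1 ∧ V.top ≤ V.b l + k ∧ V.b l < V.top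
        · rw [if_pos h7, if_pos (by omega)]; ring
        · rw [if_neg h7, if_neg (by omega)]; ring
      · rw [if_neg (show ¬ (s + k - m + 1 + V.top = V.a' l + k + 1 ∧ V.top ≤ V.a' l + k ∧
          V.a' l < V.top) by omega), if_neg (show ¬ (m = s + D ∧ l = q) from fun h => h6 h.1)]
        by_cases h7 : s + k - m + V.d l + V.top = V.b l + k + 1 ∧ V.top ≤ V.b l + k ∧ V.b l < V.top
        · rw [if_pos h7, if_pos (by omega)]; ring
        · rw [if_neg h7, if_neg (by omega)]; ring
    · have e1 : ((if s + k - m + V.top = V.a l + k + 1 ∧ V.top ≤ V.a l + k ∧ V.a l < V.top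
          then 1 else 0) - (if s + k - m + 1 + V.top = V.a' l + k + 1 ∧ V.top ≤ V.a' l + k ∧
          V.a' l < V.top then 1 else 0) : ℚ) = 0 := by
        clear c2 c3 c4 c5 c6 hb hval hl hJ
        by_cases h7 : s + k - m + V.top = V.a l + k + 1 ∧ V.top ≤ V.a l + k ∧ V.a l < V.top
        · rw [if_pos h7, if_pos (by omega)]; ring
        · rw [if_neg h7, if_neg (by omega)]; ring
      rw [e1]
      by_cases h2 : V.b' l + k = V.top
      · have h3 := c4.1 h2
        rw [show V.c l = 1 by rw [h3.1]; exact hc]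
        clear c1 c3 c4 c5 c6 hval hl hJ e1 ha
        rw [if_neg (show ¬ (s + k - m + V.d l + V.top = V.b l + k + 1 ∧ V.top ≤ V.b l + k ∧
          V.b l < V.top) by omega)]
        by_cases h6 : m = s + D
        · rw [if_pos (by omega), if_pos ⟨h6, h3.1⟩]; ring
        · rw [if_neg (by omega), if_neg (fun h => h6 h.1)]; ring
      · have h8 : l ≠ q := by
          intro e
          rcases c5 e with h | h
          · exact h1 (c3.2 ⟨e, h⟩)
          · exact h2 (c4.2 ⟨e, h, h1⟩)
        rw [if_neg (show ¬ (m = s + D ∧ l = q) from fun h => h8 h.2)]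
        clear c3 c4 c5 c6 c1 hval hl hJ e1 ha
        have hbb : V.top < V.b l ∧ V.top < V.b' l ∨ V.b' l + k < V.top ∧ V.b l + k < V.top ∨
          (V.b' l = V.b l + 1 ∧ V.b' l < V.top) := by
          omega
        clear c2 hb
        by_cases h7 : s + k - m + V.d l + V.top = V.b l + k + 1 ∧ V.top ≤ V.b l + k ∧ V.b l < V.top
        · rw [if_pos h7, if_pos (by omega)]; ring
        · rw [if_neg h7, if_neg (by omega)]; ring
  · rw [col, if_neg hl', Pi.neg_apply, Pi.neg_apply, Yf, if_neg]
    · simp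
    · rintro ⟨_, e⟩; exact hl' (e ▸ hq)

lemma step_back {ι : ℕ → ℕ} (hadm : Admissible V.n ι) (had : Adapted V.n A ι)
    (hP : PotOK V.n A ι P) {l : ℕ} (hl1 : 1 ≤ l) (hl2 : l ≤ V.n) (hV : V.OK A) {s : ℤ} {k : ℕ}
    {J J1 : ℤ → ℕ} {m : ℤ} (h1 : rho ι P (V.col s k J1) ∈ Xi A ι)
    (h2 : V.col s k J1 = V.col s k J + V.c l • bh V.n A m l) (h3 : V.col s k J1 m l = V.c l)
    (h4 : 1 ≤ m + P l) : rho ι P (V.col s k J) ∈ Xi A ι := by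
  apply Xi_step hadm had hP hl1 hl2 h4 h1 (by rw [h3]; exact hV.hc l hl1 hl2)
  rw [h3, h2]; ring

lemma R_a (hV : V.OK A) {l : ℕ} (hl1 : 1 ≤ l) (hl2 : l ≤ V.n) :
    ∀ y, V.R (V.a' l) y → V.R (V.a l) y ∧ y ≠ V.a l := by
  intro y hy
  have ha := hV.ha l hl1 hl2
  unfold R at *
  rcases hV.kind l hl1 hl2 with h | h | h
  · obtain ⟨h1, h2, h3, h4, h5, -⟩ := h
    omega
  · omega
  · omega

lemma R_b (hV : V.OK A) {l : ℕ} (hl1 : 1 ≤ l) (hl2 : l ≤ V.n) :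
    ∀ y, V.b l ≤ V.top → V.R (V.b' l) y → V.R (V.b l) y ∧ y ≠ V.a' l := by
  intro y hy hy'
  have ha := hV.ha l hl1 hl2
  rcases hV.hb l hl1 hl2 with hb | hb
  · omega
  unfold R at *
  rcases hV.kind l hl1 hl2 with h | h | h
  · obtain ⟨h1, h2, h3, h4, h5, h6 | h6⟩ := h <;> omega
  · omega
  · omega

set_option maxHeartbeats 4000000 in
theorem reach {ι : ℕ → ℕ} (hadm : Admissible V.n ι) (had : Adapted V.n A ι)
    (hP : PotOK V.n A ι P) (hV : V.OK A) (h2 : V.OK2 P wt K) {s : ℤ} {k : ℕ} (hk1 : 1 ≤ k)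
    (hk2 : k ≤ K) (hs : 1 - P k ≤ s) : ∀ (N : ℕ) (J : ℤ → ℕ), mu wt k J = N → V.VCol k J →
      rho ι P (V.col s k J) ∈ Xi A ι := by
  have hK := h2.hK
  intro N
  induction N using Nat.strong_induction_on with
  | _ N ih =>
  intro J hN hJ
  by_cases hall : ∀ i : ℕ, 1 ≤ i → i ≤ k → J i = i
  · rw [col_base hV h2 hk1 hk2 hJ hall]
    exact Xi_base hadm hk1 (by omega) (by omega)
  have hex : ∃ i : ℕ, 1 ≤ i ∧ i ≤ k ∧ J i ≠ i := by push Not at hall; exact hall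
  classical
  obtain ⟨i1, i2, i3⟩ := Nat.find_spec hex
  have hmin : ∀ y : ℕ, 1 ≤ y → y < Nat.find hex → J y = y := by
    intro y hy1 hy2
    have := Nat.find_min hex hy2
    by_contra hc
    exact this ⟨hy1, by omega, hc⟩
  generalize Nat.find hex = i at i1 i2 i3 hmin
  have hmin' : ∀ z : ℤ, z < i → J z = z.toNat := by
    intro z hz
    rcases le_or_gt z 0 with h | h
    · rw [hJ.lo z h]; omega
    · have := hmin z.toNat (by omega) (by omega)
      rw [Int.toNat_of_nonneg h.le] at this
      exact this
  have hpred : J ((i : ℤ) - 1) = i - 1 := by rw [hmin' _ (by omega)]; omega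
  obtain ⟨r1, r2⟩ := hJ.adj' (z := i) (by omega) (by omega)
  have hw := h2.hw
  have hgt : i < J i := by rw [hpred] at r1; unfold R at r1; omega
  have htop := (hJ.mid i (by omega) (by omega)).2
  have irr : ∀ z : ℤ, 1 ≤ J z → J z < V.top → J (z + 1) ≠ J z := by
    intro z hz hz' e
    obtain ⟨q1, q2⟩ := hJ.range hz hz'
    have := (hJ.adj' q1 q2).2
    unfold R at this; omega
  obtain ⟨l, hl1, hl2, hl⟩ := h2.hex (J i) (by omega) htop
  have ha := hV.ha l hl1 hl2
  have hb := hV.hb l hl1 hl2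
  have hc := hV.hc l hl1 hl2
  have hkind := hV.kind l hl1 hl2
  have hak' := h2.hak' k l hk1 hk2 hl1 hl2
  have hbk := h2.hbk k l hk1 hk2 hl1 hl2
  have hdk := h2.hdk k l hk1 hk2 hl1 hl2
  have hwa := h2.hwa l hl1 hl2
  have hwb := h2.hwb l hl1 hl2
  have g1 := R_a hV hl1 hl2
  have g2 := R_b hV hl1 hl2
  have g5 : V.d l ≠ 0 → V.a' l ≠ V.w ∧ V.a' l ≠ V.w + 1 ∧ V.a' l = V.a l + 1 := by
    intro hd
    rcases hkind with h | h | h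
    · exact ⟨h.2.2.2.1, h.2.2.2.2.1, h.1⟩
    · exact absurd h.2.2.2.2 hd
    · exact absurd h.2.2.2.2 hd
  clear hkind
  have hPb := h2.hPb k l hk1 hk2 hl1 hl2
  by_cases hcase : J i = V.a' l
  · -- Case I
    have hia : i ≤ V.a l := by omega
    rw [hcase] at r2
    obtain ⟨g11, g12⟩ := g1 _ r2
    have hPa := h2.hPa k l i hk1 hk2 hl1 hl2 hia i2
    have v1 : V.VCol k (Function.update J i (V.a l)) := by
      apply hJ.upd (by omega) (by omega) (by omega) (by omega)
      · rw [hpred]; unfold R; omega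
      · exact g11
    have m1 := mu_update wt k J (i := i) (by omega) (by omega) (V.a l)
    rw [hcase] at m1
    have c1 := col_upd_a' hV hl1 hl2 (s := s) (k := k) hcase
    set J1 := Function.update J i (V.a l) with hJ1
    have w1 : J1 i = V.a l := Function.update_self _ _ _
    have w2 : ∀ z : ℤ, z ≠ (i : ℤ) → J1 z = J z := fun z hz => Function.update_of_ne hz _ _
    have w3 : J (i + 1) ≠ V.a' l := by
      have := irr i (by omega) (by omega); omega
    have hval := col_apply hl1 hl2 s k J1 (s + k - i) i (by omega)
    rw [if_pos w1, if_neg (by rw [w2 _ (by omega)]; exact w3)] at hval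
    by_cases x1 : J1 (i + V.d l) = V.b l
    · have hd : V.d l ≠ 0 := by
        intro e; rw [e] at x1; simp at x1; omega
      by_cases x2 : J1 (i + V.d l + 1) = V.b' l
      · refine step_back hadm had hP hl1 hl2 hV (ih _ ?_ J1 rfl v1) c1 ?_ (by omega)
        · omega
        · rw [hval, if_pos x1, if_pos x2]; ring
      · have v2 := down_b hV hl1 hl2 v1 x1 x2 (by omega)
        have ltop := v1.le_top (i + V.d l)
        obtain ⟨q1, q2⟩ := v1.range (z := i + V.d l) (by omega) (by omega)
        have m2 := mu_update wt k J1 q1 q2 (V.b' l)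
        have c2 := col_upd_b hV hl1 hl2 (s := s) v1 x1
        rw [x1] at m2
        have hwb := hwb (by omega)
        have := ih _ (by omega) _ rfl v2
        rw [c2, c1, show s + k - ((i : ℤ) + V.d l) + V.d l = s + k - i by ring,
          add_sub_cancel_right] at this
        exact this
    · by_cases x2 : J1 (i + V.d l + 1) = V.b' l
      · rw [w2 _ (by omega)] at x2
        have x1' : J (i + V.d l) ≠ V.b l := by
          by_cases e : V.d l = 0
          · rw [e]; simp; omega
          · rw [← w2 _ (by omega)]; exact x1
        have ltop := hJ.le_top (i + V.d l + 1)
        replace hb : V.a l < V.b l ∧ V.a' l < V.b' l ∧ V.b l ≠ V.a' l ∧ V.b l < V.b' l ∧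
            V.b' l < V.top := by
          rcases hb with h | h
          · exfalso; rw [x2] at ltop; exact absurd h.2.1 (not_lt.2 ltop)
          · exact h
        have hne := irr (i + V.d l + 1) (by rw [x2]; exact Nat.one_le_of_lt hb.2.1)
          (by rw [x2]; exact hb.2.2.2.2)
        rw [x2] at hne
        obtain ⟨q1, q2⟩ := hJ.range (z := i + V.d l + 1) (by omega) (by omega)
        have hbt' : V.b l ≤ V.top := by omega
        have v3 := up_b hV hl1 hl2 hJ x2 x1'
        have m3 := mu_update wt k J q1 q2 (V.b l)
        have c3 := col_upd_b' hV hl1 hl2 (s := s) hJ x2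
        rw [x2] at m3
        have hwb := hwb (by omega)
        have hPb := hPb (by omega)
        refine step_back hadm had hP hl1 hl2 hV (ih _ ?_ _ rfl v3) c3 ?_ (by omega)
        · omega
        · rw [col_apply hl1 hl2 s k _ _ (i + 1) (by omega)]
          set J3 := Function.update J (i + V.d l + 1) (V.b l) with hJ3
          have u1 : J3 (i + V.d l + 1) = V.b l := Function.update_self _ _ _
          have u2 : ∀ z : ℤ, z ≠ (i : ℤ) + V.d l + 1 → J3 z = J z := fun z hz => Function.update_of_ne hz _ _
          have t1 : J3 (i + 1) ≠ V.a l := by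
            by_cases e : V.d l = 0
            · rw [e] at u1; simp at u1; omega
            · rw [u2 _ (by omega)]; exact g12
          have t2 : J3 (i + 1 + 1) ≠ V.a' l := by
            by_cases e : V.d l = 0
            · rw [u2 _ (by omega)]
              rw [e] at x2; simp at x2
              have := (hJ.adj' (z := i + 1) (by omega) (by omega)).2
              rw [x2] at this
              exact (g2 _ hbt' this).2
            · by_cases e' : V.d l = 1
              · have u1' : J3 ((i : ℤ) + 1 + 1) = V.b l := by
                  rw [← u1]; congr 1; omega
                rw [u1']; omega
              · rw [u2 _ (by omega)]
                have := (hJ.adj' (z := i + 1) (by omega) (by omega)).2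
                have g5 := g5 e
                unfold R at this r2
                obtain ⟨g51, g52, g53⟩ := g5
                intro hcon
                rw [hcon] at this
                clear hb hN m1 m3 hwa hwb hbk hdk hak' ha irr hmin' hmin ih hPa hPb g1 g2
                rcases r2 with r2 | r2
                · rcases this with this | this
                  · exact absurd (lt_trans r2 this) (lt_irrefl _)
                  · exact g51 this.2
                · exact g52 r2.1
          have t3 : J3 (i + 1 + V.d l) = V.b l := by rw [← u1]; congr 1; ring
          have t4 : J3 (i + 1 + V.d l + 1) ≠ V.b' l := by
            rw [u2 _ (by omega)]
            rw [show (i : ℤ) + 1 + V.d l + 1 = i + V.d l + 1 + 1 by ring]; exact hne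
          rw [if_neg t1, if_neg t2, if_pos t3, if_neg t4]; ring
      · refine step_back hadm had hP hl1 hl2 hV (ih _ ?_ J1 rfl v1) c1 ?_ (by omega)
        · omega
        · rw [hval, if_neg x1, if_neg x2]; ring
  · -- Case II
    have hcase2 : J i = V.b' l := by omega
    have hbt : V.b l < V.top := by omega
    rw [hcase2] at r2
    obtain ⟨g21, g22⟩ := g2 _ hbt.le r2
    have v1 : V.VCol k (Function.update J i (V.b l)) := by
      apply hJ.upd (by omega) (by omega) (by omega) (by omega)
      · rw [hpred]; unfold R; omega
      · exact g21
    have m1 := mu_update wt k J (i := i) (by omega) (by omega) (V.b l)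
    rw [hcase2] at m1
    have c1 := col_upd_b' hV hl1 hl2 (s := s) hJ hcase2
    have hwb := hwb (by omega)
    have hPb := hPb (by omega)
    refine step_back hadm had hP hl1 hl2 hV (ih _ (by omega) _ rfl v1) c1 ?_ (by omega)
    rw [col_apply hl1 hl2 s k _ _ (i - V.d l) (by omega)]
    set J1 := Function.update J i (V.b l) with hJ1
    have w1 : J1 i = V.b l := Function.update_self _ _ _
    have w2 : ∀ z : ℤ, z ≠ (i : ℤ) → J1 z = J z := fun z hz => Function.update_of_ne hz _ _
    have t3 : J1 (i - V.d l + V.d l) = V.b l := by rw [← w1]; congr 1; ring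
    have t4 : J1 (i - V.d l + V.d l + 1) ≠ V.b' l := by
      rw [sub_add_cancel, w2 _ (by omega)]
      have := irr i (by omega) (by omega)
      omega
    have t1 : J1 (i - V.d l) ≠ V.a l := by
      by_cases e : V.d l = 0
      · rw [e]; simp; omega
      · have hdk' := hdk (by omega)
        clear hb hwb hN m1 hbk hak' hl r1 r2 hPb hgt htop hwa hcase
        rw [w2 _ (by omega), hmin' _ (by omega)]; omega
    have t2 : J1 (i - V.d l + 1) ≠ V.a' l := by
      by_cases e : V.d l = 0
      · rw [e]; simp
        rw [w2 _ (by omega)]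
        exact g22
      · by_cases e' : V.d l = 1
        · rw [e']; simp; omega
        · have hdk' := hdk (by omega)
          clear hb hwb hN m1 hbk hl r1 r2 hPb hgt htop hwa hcase hdk
          have ha' := (g5 e).2.2
          clear g5 hak'
          rw [w2 _ (by omega), hmin' _ (by omega)]; omega
    rw [if_neg t1, if_neg t2, if_pos t3, if_neg t4]; ring

/-- A list of entries as a column filling. -/
def ext (V : VP) (k : ℕ) (j : ℕ → ℕ) : ℤ → ℕ := fun z =>
  if z ≤ 0 then 0 else if (k : ℤ) < z then V.top else j z.toNat

lemma ext_VCol {k : ℕ} {j : ℕ → ℕ} (hk : 1 ≤ k)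
    (h1 : ∀ i, 1 ≤ i → i ≤ k → 1 ≤ j i ∧ j i < V.top)
    (h2 : ∀ i, 1 ≤ i → i < k → V.R (j i) (j (i + 1))) : V.VCol k (V.ext k j) := by
  constructor
  · intro z hz; simp [ext, hz]
  · intro z hz; simp only [ext]; rw [if_neg (by omega), if_pos hz]
  · intro z hz hz'; simp only [ext]; rw [if_neg (by omega), if_neg (by omega)]
    exact h1 _ (by omega) (by omega)
  · intro z hz hz'
    simp only [ext]
    by_cases e : z = 0
    · rw [if_pos (by omega), if_neg (by omega), if_neg (by omega)]
      left; exact (h1 _ (by omega) (by omega)).1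
    · rw [if_neg (by omega), if_neg (by omega), if_neg (by omega)]
      by_cases e' : z = k
      · rw [if_pos (by omega)]; left; exact (h1 _ (by omega) (by omega)).2
      · rw [if_neg (by omega)]
        have := h2 z.toNat (by omega) (by omega)
        rwa [show (z + 1).toNat = z.toNat + 1 by omega]

lemma ext_of_VCol {k : ℕ} {J : ℤ → ℕ} (hJ : V.VCol k J) : V.ext k (fun i => J i) = J := by
  funext z
  simp only [ext]
  split_ifs with h1 h2
  · rw [hJ.lo z h1]
  · rw [hJ.hi z h2]
  · rw [Int.toNat_of_nonneg (by omega)]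

lemma sum_ind (k : ℕ) (f : ℕ → ℕ) (x : ℕ) (z : ℤ) (V : VP) (hx : 1 ≤ x) (hx' : x ≠ V.top) :
    ∑ i ∈ Finset.Icc 1 k, (if f i = x ∧ (i : ℤ) = z then (1 : ℚ) else 0) =
      if V.ext k f z = x then 1 else 0 := by
  simp only [ext]
  split_ifs with h1 h2 h3 h4 h5
  · omega
  · apply Finset.sum_eq_zero
    intro i hi
    rw [Finset.mem_Icc] at hi
    rw [if_neg (by omega)]
  · omega
  · apply Finset.sum_eq_zero
    intro i hi
    rw [Finset.mem_Icc] at hi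
    rw [if_neg (by omega)]
  · rw [Finset.sum_eq_single z.toNat]
    · rw [if_pos ⟨h5, by omega⟩]
    · intro i _ hi; rw [if_neg (by omega)]
    · intro hn; rw [Finset.mem_Icc] at hn; omega
  · apply Finset.sum_eq_zero
    intro i hi
    rw [if_neg]
    rintro ⟨e1, e2⟩
    exact h5 (by rw [← e2]; simpa using e1)

lemma col_eq_sum (hV : V.OK A) (s : ℤ) (k : ℕ) (j : ℕ → ℕ) :
    ∑ i ∈ Finset.Icc 1 k, V.bx (s + k - (i : ℤ)) (j i) = V.col s k (V.ext k j) := by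
  funext m l
  simp only [Finset.sum_apply]
  by_cases hl : 1 ≤ l ∧ l ≤ V.n
  · have ha := hV.ha l hl.1 hl.2
    have hb := hV.hb l hl.1 hl.2
    rw [col_apply hl.1 hl.2 s k _ m _ rfl]
    simp only [bx, if_pos hl]
    rw [← Finset.mul_sum]
    rw [Finset.sum_sub_distrib, Finset.sum_add_distrib, Finset.sum_sub_distrib]
    rw [← sum_ind k j (V.a l) _ V (by omega) (by omega),
      ← sum_ind k j (V.a' l) _ V (by omega) (by omega),
      ← sum_ind k j (V.b l) _ V (by omega) (by omega),
      ← sum_ind k j (V.b' l) _ V (by omega) (by omega)]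
    congr 1
    congr 1
    · congr 1
      · congr 1
        · apply Finset.sum_congr rfl; intro i _
          exact if_congr (and_congr_right fun _ => by omega) rfl rfl
        · apply Finset.sum_congr rfl; intro i _
          exact if_congr (and_congr_right fun _ => by omega) rfl rfl
      · apply Finset.sum_congr rfl; intro i _
        exact if_congr (and_congr_right fun _ => by omega) rfl rfl
    · apply Finset.sum_congr rfl; intro i _
      exact if_congr (and_congr_right fun _ => by omega) rfl rfl
  · simp [bx, col, if_neg hl]

/-- vector family -/
def VG (V : VP) (P : ℕ → ℤ) (K : ℕ) (s : ℤ) (F : ℤ → ℕ → ℚ) : Prop :=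
  ∃ k J, 1 ≤ k ∧ k ≤ K ∧ 1 - P k ≤ s ∧ V.VCol k J ∧ F = V.col s k J

lemma VG_cut {ι : ℕ → ℕ} (hV : V.OK A) {box : ℤ → ℕ → ℕ → ℚ}
    (hbox : ∀ u e, 1 ≤ e → e < V.top → box u e = rho ι P (V.bx u e)) {s : ℤ} (φ : ℕ → ℚ) :
    (∃ F, V.VG P K s F ∧ φ = rho ι P F) ↔ ∃ (k : ℕ) (j : ℕ → ℕ), 1 ≤ k ∧ k ≤ K ∧
      (∀ i, 1 ≤ i → i ≤ k → 1 ≤ j i ∧ j i < V.top) ∧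
      (∀ i, 1 ≤ i → i < k → V.R (j i) (j (i + 1))) ∧ 1 - P k ≤ s ∧ φ = tab box s k j := by
  have key : ∀ (k : ℕ) (j : ℕ → ℕ), (∀ i, 1 ≤ i → i ≤ k → 1 ≤ j i ∧ j i < V.top) →
      tab box s k j = rho ι P (V.col s k (V.ext k j)) := by
    intro k j h
    rw [← col_eq_sum hV, rho_sum, tab]
    apply Finset.sum_congr rfl
    intro i hi
    rw [Finset.mem_Icc] at hi
    have := h i hi.1 hi.2
    rw [hbox _ _ this.1 this.2]
  constructor
  · rintro ⟨F, ⟨k, J, h1, h2, h3, h4, rfl⟩, rfl⟩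
    have h5 : ∀ i : ℕ, 1 ≤ i → i ≤ k → 1 ≤ J i ∧ J i < V.top :=
      fun i hi hi' => h4.mid i (by omega) (by omega)
    refine ⟨k, fun i => J i, h1, h2, h5, ?_, h3, ?_⟩
    · intro i hi hi'
      have := h4.adj i (by omega) (by omega)
      exact_mod_cast this
    · rw [key k _ h5, ext_of_VCol h4]
  · rintro ⟨k, j, h1, h2, h3, h4, h5, rfl⟩
    exact ⟨_, ⟨k, _, h1, h2, h5, ext_VCol h1 h3 h4, rfl⟩, key k j h3⟩

lemma VG_base (hV : V.OK A) (h2 : V.OK2 P wt K) (hKt : K < V.top) {k : ℕ} (hk1 : 1 ≤ k)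
    (hk2 : k ≤ K) {s : ℤ} (hs : 1 - P k ≤ s) : V.VG P K s (Yf s k) := by
  have hJ : V.VCol k (V.ext k id) := by
    apply ext_VCol hk1
    · intro i h1 h2; simp only [id]; omega
    · intro i h1 h2; simp only [id]; left; omega
  refine ⟨k, _, hk1, hk2, hs, hJ, ?_⟩
  rw [col_base hV h2 hk1 hk2 hJ]
  intro i h1 h2
  simp only [ext, id]
  rw [if_neg (by omega), if_neg (by omega)]; simp

end VP


/-! ### Potentials -/

/-- type A vector data -/
def VA (n : ℕ) : VP where
  n := n
  top := n + 2
  w := n + 50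
  a := fun l => l
  a' := fun l => l + 1
  b := fun _ => n + 5
  b' := fun _ => n + 6
  d := fun _ => 0
  c := fun _ => 1

/-- type B and C vector data -/
def VBC (n : ℕ) (cn : ℚ) : VP where
  n := n
  top := 2 * n + 1
  w := 2 * n + 50
  a := fun l => l
  a' := fun l => l + 1
  b := fun l => if l < n then 2 * n - l else 2 * n + 5
  b' := fun l => if l < n then 2 * n + 1 - l else 2 * n + 6
  d := fun l => n - l
  c := fun l => if l = n then cn else 1

/-- type D vector data -/
def VD (n : ℕ) : VP where
  n := n
  top := 2 * n + 1
  w := n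
  a := fun l => if l < n then l else n - 1
  a' := fun l => if l < n then l + 1 else n + 1
  b := fun l => if l < n then 2 * n - l else n
  b' := fun l => if l < n then 2 * n + 1 - l else n + 2
  d := fun l => n - l - 1
  c := fun _ => 1

lemma VA_OK (n : ℕ) : (VA n).OK (cartanA n) := by
  constructor
  · intros; simp [VA]
  · intro l h1 h2; simp only [VA] at *; omega
  · intro l h1 h2; simp only [VA, and_true] at *; omega
  · intro l h1 h2; simp only [VA, and_true, true_and] at *; omega
  · intro u l h1 h2
    funext m i
    simp only [VA] at *
    simp only [VP.bx, bh, cartanA, Pi.sub_apply, Pi.smul_apply, smul_eq_mul]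
    by_cases hi : 1 ≤ i ∧ i ≤ n
    swap
    · simp [hi]
    simp only [if_pos hi]
    repeat' (first | (exfalso; omega) | split)
    all_goals norm_num
  · intro u l h1 h2 h; simp only [VA] at *; omega

set_option maxHeartbeats 1000000 in
lemma VBC_OK (n : ℕ) (hn : 2 ≤ n) (cn : ℚ) (A : ℕ → ℕ → ℤ) 
    (hA : (A = cartanB n ∧ cn = 1) ∨ (A = cartanC n ∧ cn = 2)) : (VBC n cn).OK A := by
  have hcn : 0 < cn := by rcases hA with ⟨_, h⟩ | ⟨_, h⟩ <;> rw [h] <;> norm_num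
  constructor
  · intro l _ _; simp only [VBC]; split <;> norm_num [hcn]
  · intro l h1 h2; simp only [VBC] at *; omega
  · intro l h1 h2; simp only [VBC] at *; split <;> omega
  · intro l h1 h2; simp only [VBC, true_and] at *; split <;> omega
  · intro u l h1 h2
    funext m i
    simp only [VBC] at *
    simp only [VP.bx, bh, Pi.sub_apply, Pi.smul_apply, smul_eq_mul]
    by_cases hi : 1 ≤ i ∧ i ≤ n
    swap
    · simp [hi]
    simp only [if_pos hi]
    have c1 : (i = l ∧ l < n) ∨ (i = l ∧ l = n) ∨ (i = l + 1 ∧ i < n) ∨ (i = l + 1 ∧ i = n) ∨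
      (l = i + 1 ∧ l < n) ∨ (l = i + 1 ∧ l = n) ∨ (i ≠ l ∧ i ≠ l + 1 ∧ l ≠ i + 1 ∧ i < n) ∨
      (i ≠ l ∧ i ≠ l + 1 ∧ l ≠ i + 1 ∧ i = n) := by omega
    have c3 : m = u ∨ m = u + 1 ∨ (m ≠ u ∧ m ≠ u + 1) := by omega
    rcases hA with ⟨h, rfl⟩ | ⟨h, rfl⟩ <;> rw [h] <;> clear h
    · unfold cartanB
      rcases c1 with c1 | c1 | c1 | c1 | c1 | c1 | c1 | c1 <;> rcases c3 with c3 | c3 | c3 <;>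
      first
      | (exfalso; omega)
      | (simp (disch := omega) only [if_pos, if_neg]; norm_num)
    · unfold cartanC
      rcases c1 with c1 | c1 | c1 | c1 | c1 | c1 | c1 | c1 <;> rcases c3 with c3 | c3 | c3 <;>
      first
      | (exfalso; omega)
      | (simp (disch := omega) only [if_pos, if_neg]; norm_num)
  · intro u l h1 h2 h3
    funext m i
    simp only [VBC] at *
    have hln : l < n := by split at h3 <;> omega
    clear h3
    simp only [VP.bx, bh, Pi.sub_apply, Pi.smul_apply, smul_eq_mul, if_pos hln]
    by_cases hi : 1 ≤ i ∧ i ≤ n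
    swap
    · simp [hi]
    simp only [if_pos hi]
    have c1 : (i = l ∧ l < n) ∨ (i = l ∧ l = n) ∨ (i = l + 1 ∧ i < n) ∨ (i = l + 1 ∧ i = n) ∨
      (l = i + 1 ∧ l < n) ∨ (l = i + 1 ∧ l = n) ∨ (i ≠ l ∧ i ≠ l + 1 ∧ l ≠ i + 1 ∧ i < n) ∨
      (i ≠ l ∧ i ≠ l + 1 ∧ l ≠ i + 1 ∧ i = n) := by omega
    have c3 : m = u + (n - l : ℕ) ∨ m = u + (n - l : ℕ) + 1 ∨
      (m ≠ u + (n - l : ℕ) ∧ m ≠ u + (n - l : ℕ) + 1) := by omega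
    rcases hA with ⟨h, rfl⟩ | ⟨h, rfl⟩ <;> rw [h] <;> clear h
    · unfold cartanB
      rcases c1 with c1 | c1 | c1 | c1 | c1 | c1 | c1 | c1 <;> rcases c3 with c3 | c3 | c3 <;>
      first
      | (exfalso; omega)
      | (simp (disch := omega) only [if_pos, if_neg]; norm_num)
    · unfold cartanC
      rcases c1 with c1 | c1 | c1 | c1 | c1 | c1 | c1 | c1 <;> rcases c3 with c3 | c3 | c3 <;>
      first
      | (exfalso; omega)
      | (simp (disch := omega) only [if_pos, if_neg]; norm_num)

set_option maxHeartbeats 1000000 in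
lemma VD_OK (n : ℕ) (hn : 4 ≤ n) : (VD n).OK (cartanD n) := by
  constructor
  · intro l _ _; simp [VD]
  · intro l h1 h2; simp only [VD] at *; split <;> omega
  · intro l h1 h2; simp only [VD] at *; split <;> omega
  · intro l h1 h2; simp only [VD] at *
    by_cases hl : l < n
    · simp only [if_pos hl, true_and, and_true]; omega
    · simp only [if_neg hl, true_and, and_true]; omega
  · intro u l h1 h2
    funext m i
    simp only [VD] at *
    simp only [VP.bx, bh, Pi.sub_apply, Pi.smul_apply, smul_eq_mul, one_mul, cartanD]
    by_cases hi : 1 ≤ i ∧ i ≤ n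
    swap
    · simp [hi]
    simp only [if_pos hi]
    have c3 : m = u ∨ m = u + 1 ∨ (m ≠ u ∧ m ≠ u + 1) := by omega
    have c1 : (i < n ∧ l < n ∧ ((i = l ∧ l + 1 < n) ∨ (i = l ∧ l + 1 = n) ∨ (i = l + 1 ∧ i + 1 < n) ∨
        (i = l + 1 ∧ i + 1 = n) ∨
      (l = i + 1 ∧ l + 1 < n) ∨ (l = i + 1 ∧ l + 1 = n) ∨ (i ≠ l ∧ i ≠ l + 1 ∧ l ≠ i + 1 ∧ i + 1 < n) ∨
      (i ≠ l ∧ i ≠ l + 1 ∧ l ≠ i + 1 ∧ i + 1 = n))) ∨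
      (i = n ∧ l < n ∧ (l + 1 = n ∨ l + 2 = n ∨ l + 2 < n)) ∨
      (i < n ∧ l = n ∧ (i + 1 = n ∨ i + 2 = n ∨ i + 2 < n)) ∨ (i = n ∧ l = n) := by omega
    rcases c1 with ⟨d1, d2, d3⟩ | ⟨d1, d2, d3⟩ | ⟨d1, d2, d3⟩ | ⟨d1, d2⟩
    · rcases d3 with c1 | c1 | c1 | c1 | c1 | c1 | c1 | c1 <;> rcases c3 with c3 | c3 | c3 <;>
      first
      | (exfalso; omega)
      | (simp (disch := omega) only [if_pos, if_neg]; norm_num)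
    · rcases d3 with c1 | c1 | c1 <;> rcases c3 with c3 | c3 | c3 <;>
      (simp (disch := omega) only [if_pos, if_neg]; norm_num)
    · rcases d3 with c1 | c1 | c1 <;> rcases c3 with c3 | c3 | c3 <;>
      (simp (disch := omega) only [if_pos, if_neg]; norm_num)
    · rcases c3 with c3 | c3 | c3 <;>
      (simp (disch := omega) only [if_pos, if_neg]; norm_num; try omega)
  · intro u l h1 h2 h3
    funext m i
    clear h3
    simp only [VD] at *
    simp only [VP.bx, bh, Pi.sub_apply, Pi.smul_apply, smul_eq_mul, one_mul, cartanD]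
    by_cases hi : 1 ≤ i ∧ i ≤ n
    swap
    · simp [hi]
    simp only [if_pos hi]
    have c3 : m = u + (n - l - 1 : ℕ) ∨ m = u + (n - l - 1 : ℕ) + 1 ∨
      (m ≠ u + (n - l - 1 : ℕ) ∧ m ≠ u + (n - l - 1 : ℕ) + 1) := by omega
    have c1 : (i < n ∧ l < n ∧ ((i = l ∧ l + 1 < n) ∨ (i = l ∧ l + 1 = n) ∨ (i = l + 1 ∧ i + 1 < n) ∨
        (i = l + 1 ∧ i + 1 = n) ∨
      (l = i + 1 ∧ l + 1 < n) ∨ (l = i + 1 ∧ l + 1 = n) ∨ (i ≠ l ∧ i ≠ l + 1 ∧ l ≠ i + 1 ∧ i + 1 < n) ∨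
      (i ≠ l ∧ i ≠ l + 1 ∧ l ≠ i + 1 ∧ i + 1 = n))) ∨
      (i = n ∧ l < n ∧ (l + 1 = n ∨ l + 2 = n ∨ l + 2 < n)) ∨
      (i < n ∧ l = n ∧ (i + 1 = n ∨ i + 2 = n ∨ i + 2 < n)) ∨ (i = n ∧ l = n) := by omega
    rcases c1 with ⟨d1, d2, d3⟩ | ⟨d1, d2, d3⟩ | ⟨d1, d2, d3⟩ | ⟨d1, d2⟩
    · rcases d3 with c1 | c1 | c1 | c1 | c1 | c1 | c1 | c1 <;> rcases c3 with c3 | c3 | c3 <;>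
      first
      | (exfalso; omega)
      | (simp (disch := omega) only [if_pos, if_neg]; norm_num)
    · rcases d3 with c1 | c1 | c1 <;> rcases c3 with c3 | c3 | c3 <;>
      (simp (disch := omega) only [if_pos, if_neg]; norm_num)
    · rcases d3 with c1 | c1 | c1 <;> rcases c3 with c3 | c3 | c3 <;>
      (simp (disch := omega) only [if_pos, if_neg]; norm_num)
    · rcases c3 with c3 | c3 | c3 <;>
      (simp (disch := omega) only [if_pos, if_neg]; norm_num; try omega)


/-! ### Potentials -/

lemma pval_add {n : ℕ} {A : ℕ → ℕ → ℤ} {ι : ℕ → ℕ} (hadm : Admissible n ι) (had : Adapted n A ι)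
    {i l : ℕ} (h1 : 1 ≤ i) (h2 : i ≤ n) (h3 : 1 ≤ l) (h4 : l ≤ n) (h5 : i ≠ l) (h6 : A i l ≠ 0)
    (h7 : A l i ≠ 0) : pval ι l i + pval ι i l = 1 := by
  obtain ⟨q, hq, hq'⟩ := hadm.2.2 i h1 h2 1
  exact (alt_cnt hadm had h1 h2 h3 h4 h5 h6 h7 hq hq').2

lemma pval_le (ι : ℕ → ℕ) (i l : ℕ) : pval ι i l ≤ 1 := by unfold pval; split <;> omega

lemma PABC_succ (ι : ℕ → ℕ) {n k : ℕ} (h : 1 ≤ k) (hk : k + 1 ≤ n) :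
    PABC ι n (k + 1) = PABC ι n k + pval ι (k + 1) k := by
  unfold PABC
  rw [if_pos hk, if_pos (by omega), Finset.sum_Icc_succ_top (by omega)]
  simp

lemma PABC_mono (ι : ℕ → ℕ) {n i : ℕ} (hi : 1 ≤ i) : ∀ t, i + t ≤ n →
    PABC ι n i ≤ PABC ι n (i + t) ∧ PABC ι n (i + t) ≤ PABC ι n i + t := by
  intro t
  induction t with
  | zero => simp
  | succ t ih =>
    intro h
    have := ih (by omega)
    have h2 := PABC_succ ι (n := n) (k := i + t) (by omega) (by omega)
    have h3 := pval_le ι (i + t + 1) (i + t)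
    rw [← add_assoc]; omega

/-- slope condition of the potential -/
def Slope (n : ℕ) (P : ℕ → ℤ) : Prop :=
  ∀ i j : ℕ, 1 ≤ i → i ≤ j → j ≤ n → P i ≤ P j ∧ P j ≤ P i + (j - i)

lemma PABC_slope (ι : ℕ → ℕ) (n : ℕ) : Slope n (fun l => (PABC ι n l : ℤ)) := by
  intro i j h1 h2 h3
  obtain ⟨t, rfl⟩ := Nat.exists_eq_add_of_le h2
  have := PABC_mono ι h1 t h3
  dsimp only
  omega

lemma PABC_pot {n : ℕ} {A : ℕ → ℕ → ℤ} {ι : ℕ → ℕ} (hadm : Admissible n ι) (had : Adapted n A ι)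
    (hA : ∀ i l, i ≠ l → (A i l ≠ 0 ↔ (i = l + 1 ∨ l = i + 1))) :
    PotOK n A ι (fun l => (PABC ι n l : ℤ)) := by
  intro i l h1 h2 h3 h4 h5 h6
  have h7 := (hA l i (Ne.symm h5)).1 h6
  have h8 := (hA i l h5).2 (by omega)
  refine ⟨h8, ?_⟩
  have h9 := pval_add hadm had h1 h2 h3 h4 h5 h8 h6
  dsimp only
  rcases h7 with h7 | h7
  · subst h7
    have := PABC_succ ι h1 h4
    rw [if_pos (by omega)]; omega
  · subst h7
    have := PABC_succ ι h3 h2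
    rw [if_neg (by omega)]; omega

lemma cartanA_ne (n i l : ℕ) (h : i ≠ l) : cartanA n i l ≠ 0 ↔ (i = l + 1 ∨ l = i + 1) := by
  unfold cartanA; rw [if_neg h]; split <;> simp <;> omega

lemma cartanB_ne (n : ℕ) (hn : 2 ≤ n) (i l : ℕ) (h : i ≠ l) :
    cartanB n i l ≠ 0 ↔ (i = l + 1 ∨ l = i + 1) := by
  unfold cartanB; rw [if_neg h]; split
  · simp; omega
  · split <;> simp <;> omega

lemma cartanC_ne (n : ℕ) (hn : 2 ≤ n) (i l : ℕ) (h : i ≠ l) :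
    cartanC n i l ≠ 0 ↔ (i = l + 1 ∨ l = i + 1) := by
  unfold cartanC; rw [if_neg h]; split
  · simp; omega
  · split <;> simp <;> omega

lemma cartanD_ne (n : ℕ) (hn : 4 ≤ n) (i l : ℕ) (h1 : i ≤ n) (h2 : l ≤ n) (h : i ≠ l) :
    cartanD n i l ≠ 0 ↔ ((i = l + 1 ∧ i ≠ n) ∨ (l = i + 1 ∧ l ≠ n) ∨ (i = n ∧ l + 2 = n) ∨
      (l = n ∧ i + 2 = n)) := by
  unfold cartanD; rw [if_neg h]; split
  · simp; omega
  · split <;> simp <;> omega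

lemma PD_eq (ι : ℕ → ℕ) {n k : ℕ} (h : k < n) : PD ι n k = PABC ι n k := by
  unfold PD PABC; rw [if_neg (by omega)]

lemma PD_top (ι : ℕ → ℕ) {n : ℕ} (h : 4 ≤ n) :
    PD ι n n = PABC ι n (n - 2) + pval ι n (n - 2) := by
  unfold PD PABC; rw [if_pos rfl, if_pos (by omega)]

lemma PD_pot {n : ℕ} {ι : ℕ → ℕ} (hn : 4 ≤ n) (hadm : Admissible n ι)
    (had : Adapted n (cartanD n) ι) :
    PotOK n (cartanD n) ι (fun l => (PD ι n l : ℤ)) := by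
  intro i l h1 h2 h3 h4 h5 h6
  have h7 := (cartanD_ne n hn l i h4 h2 (Ne.symm h5)).1 h6
  have h8 := (cartanD_ne n hn i l h2 h4 h5).2 (by omega)
  refine ⟨h8, ?_⟩
  have h9 := pval_add hadm had h1 h2 h3 h4 h5 h8 h6
  dsimp only
  rcases h7 with ⟨h7, h10⟩ | ⟨h7, h10⟩ | ⟨h7, h10⟩ | ⟨h7, h10⟩
  · subst h7
    have := PABC_succ ι h1 h4
    rw [if_pos (by omega), PD_eq ι (by omega), PD_eq ι (by omega)]; omega
  · subst h7
    have := PABC_succ ι h3 h2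
    rw [if_neg (by omega), PD_eq ι (by omega), PD_eq ι (by omega)]; omega
  · subst h7
    have h11 := PD_top ι hn
    obtain rfl : i = l - 2 := by omega
    rw [if_pos (by omega), PD_eq ι (k := l - 2) (by omega)]; omega
  · subst h7
    have h11 := PD_top ι hn
    obtain rfl : l = i - 2 := by omega
    rw [if_neg (by omega), PD_eq ι (k := i - 2) (by omega)]; omega

/-- slope condition for type D -/
def SlopeD (n : ℕ) (P : ℕ → ℤ) : Prop :=
  Slope (n - 1) P ∧ P (n - 2) ≤ P n ∧ P n ≤ P (n - 2) + 1

lemma PD_slope (ι : ℕ → ℕ) {n : ℕ} (hn : 4 ≤ n) : SlopeD n (fun l => (PD ι n l : ℤ)) := by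
  refine ⟨?_, ?_⟩
  · intro i j h1 h2 h3
    have := PABC_slope ι n i j h1 h2 (by omega)
    dsimp only at *
    rw [PD_eq ι (by omega), PD_eq ι (by omega)]; exact this
  · have h11 := PD_top ι hn
    have := pval_le ι n (n - 2)
    dsimp only
    rw [PD_eq ι (k := n - 2) (by omega)]; omega

/-! ### Induction data -/

lemma VA_OK2 (n : ℕ) (P : ℕ → ℤ) (hP : Slope n P) : (VA n).OK2 P id n := by
  constructor
  · intros; simp [VA]
  · intro l h1 h2 h3; simp only [VA] at *; omega
  · intro e h1 h2; exact ⟨e - 1, by simp only [VA] at *; omega⟩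
  · simp [VA]
  · simp [VA]
  · intros; simp [VA]
  · intro k l _ _ _ _; simp [VA]
  · intro k l _ _ _ _; simp [VA]
  · intro k l _ _ _ _; simp only [VA]; omega
  · intro k l _ _ _ _; simp [VA]
  · intro k l _ _ _ _; simp [VA]
  · intro k l i h1 h2 h3 h4 h5 h6
    simp only [VA] at *
    rcases le_total l k with h | h
    · have := hP l k (by omega) h (by omega); omega
    · have := hP k l (by omega) h (by omega); omega

lemma VBC_OK2 (n : ℕ) (hn : 2 ≤ n) (cn : ℚ) (P : ℕ → ℤ) (hP : Slope n P) :
    (VBC n cn).OK2 P (fun e => e + min e n) (n - 1) := by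
  constructor
  · intro l h1 h2; simp only [VBC] at *; omega
  · intro l h1 h2 h3; simp only [VBC] at *
    by_cases h : l < n
    · simp only [if_pos h] at *; omega
    · simp only [if_neg h] at *; omega
  · intro e h1 h2
    by_cases he : e ≤ n + 1
    · exact ⟨e - 1, by simp only [VBC] at *; omega⟩
    · refine ⟨2 * n + 1 - e, ?_⟩
      simp only [VBC] at *
      rw [if_pos (by omega)]; omega
  · simp [VBC]
  · simp only [VBC]; omega
  · intro k _ _; simp only [VBC]; rw [if_neg (by omega)]
  · intro k l _ _ _ _; simp [VBC]
  · intro k l _ _ _ _; simp [VBC]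
  · intro k l _ _ _ _; simp only [VBC] at *; split <;> omega
  · intro k l _ _ _ _; simp only [VBC] at *; omega
  · intro k l h1 h2 h3 h4 h5
    simp only [VBC] at *
    rcases le_total l k with h | h
    · have := hP l k (by omega) h (by omega); omega
    · have := hP k l (by omega) h (by omega); omega
  · intro k l i h1 h2 h3 h4 h5 h6
    simp only [VBC] at *
    rcases le_total l k with h | h
    · have := hP l k (by omega) h (by omega); omega
    · have := hP k l (by omega) h (by omega); omega

lemma VD_OK2 (n : ℕ) (hn : 4 ≤ n) (P : ℕ → ℤ) (hP : SlopeD n P) :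
    (VD n).OK2 P (fun e => e + min e n) (n - 2) := by
  constructor
  · intro l h1 h2; simp only [VD] at *; split <;> omega
  · intro l h1 h2 h3; simp only [VD] at *
    by_cases h : l < n
    · simp only [if_pos h] at *; omega
    · simp only [if_neg h] at *; omega
  · intro e h1 h2
    by_cases he : e ≤ n
    · refine ⟨e - 1, ?_⟩
      simp only [VD] at *
      rw [if_pos (by omega)]; omega
    · by_cases he : e ≤ n + 1
      · refine ⟨n, ?_⟩
        simp only [VD] at *
        rw [if_neg (by omega)]; omega
      · refine ⟨2 * n + 1 - e, ?_⟩
        simp only [VD] at *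
        rw [if_pos (by omega), if_pos (by omega)]; omega
  · simp [VD]
  · simp only [VD]; omega
  · intro k _ _; simp only [VD]
  · intro k l _ _ _ _; simp only [VD] at *; split <;> omega
  · intro k l _ _ _ _; simp only [VD] at *; split <;> omega
  · intro k l _ _ _ _; simp only [VD] at *; split <;> omega
  · intro k l _ _ _ _; simp only [VD] at *; split <;> omega
  · intro k l h1 h2 h3 h4 h5
    clear h5
    simp only [VD] at *
    by_cases hl : l = n
    · subst hl
      have := hP.1 k (l - 2) (by omega) (by omega) (by omega)
      have := hP.2
      omega
    · rcases le_total l k with h | h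
      · have := hP.1 l k (by omega) h (by omega); omega
      · have := hP.1 k l (by omega) h (by omega); omega
  · intro k l i h1 h2 h3 h4 h5 h6
    simp only [VD] at *
    by_cases hl : l = n
    · subst hl
      have := hP.1 k (l - 2) (by omega) (by omega) (by omega)
      have := hP.2
      omega
    · rw [if_pos (by omega)] at h5
      rcases le_total l k with h | h
      · have := hP.1 l k (by omega) h (by omega); omega
      · have := hP.1 k l (by omega) h (by omega); omega


/-! ### Boxes and low columns -/

lemma rho_congr {n : ℕ} {ι : ℕ → ℕ} (hadm : Admissible n ι) (P : ℕ → ℤ) (F G : ℤ → ℕ → ℚ)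
    (h : ∀ m i, 1 ≤ i → i ≤ n → F m i = G m i) : rho ι P F = rho ι P G := by
  funext p
  unfold rho
  by_cases hp : 1 ≤ p
  · simp only [if_pos hp]
    exact h _ _ (hadm.1 p hp).1 (hadm.1 p hp).2
  · simp only [if_neg hp]

lemma rho_sub (ι : ℕ → ℕ) (P : ℕ → ℤ) (F G : ℤ → ℕ → ℚ) :
    rho ι P F - rho ι P G = rho ι P (F - G) := by
  funext p; simp only [rho, Pi.sub_apply]; split <;> simp

lemma rho_add (ι : ℕ → ℕ) (P : ℕ → ℤ) (F G : ℤ → ℕ → ℚ) :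
    rho ι P F + rho ι P G = rho ι P (F + G) := by
  funext p; simp only [rho, Pi.add_apply]; split <;> simp

lemma rho_smul (ι : ℕ → ℕ) (P : ℕ → ℤ) (c : ℚ) (F : ℤ → ℕ → ℚ) :
    c • rho ι P F = rho ι P (c • F) := by
  funext p; simp only [rho, Pi.smul_apply]; split <;> simp

lemma xsj_rho {n : ℕ} {ι : ℕ → ℕ} (hadm : Admissible n ι) (P : ℕ → ℤ) (z m : ℤ) (l : ℕ)
    (h : z = m + P l) : xsj ι n z l = rho ι P (Yf m l) := by
  rw [h, rho_Yf hadm]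

lemma boxA_rho {n : ℕ} {ι : ℕ → ℕ} (hadm : Admissible n ι) (u : ℤ) (e : ℕ) (h1 : 1 ≤ e)
    (h2 : e < (VA n).top) :
    boxA ι n u e = rho ι (fun l => (PABC ι n l : ℤ)) ((VA n).bx u e) := by
  simp only [VA] at h2
  unfold boxA
  rw [xsj_rho hadm (fun l => (PABC ι n l : ℤ)) _ u e rfl,
    xsj_rho hadm (fun l => (PABC ι n l : ℤ)) _ (u + 1) (e - 1) (by ring), rho_sub]
  apply rho_congr hadm
  intro m i hi1 hi2
  simp only [VA]
  simp only [VP.bx, Yf, Pi.sub_apply]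
  simp only [if_pos (And.intro hi1 hi2)]
  repeat' (first | (exfalso; omega) | split)
  all_goals norm_num

lemma boxB_rho {n : ℕ} {ι : ℕ → ℕ} (hadm : Admissible n ι) (u : ℤ) (e : ℕ) (h1 : 1 ≤ e)
    (h2 : e < (VBC n 1).top) :
    boxB ι n u e = rho ι (fun l => (PABC ι n l : ℤ)) ((VBC n 1).bx u e) := by
  simp only [VBC] at h2
  unfold boxB
  split
  · rw [xsj_rho hadm (fun l => (PABC ι n l : ℤ)) _ u e rfl,
      xsj_rho hadm (fun l => (PABC ι n l : ℤ)) _ (u + 1) (e - 1) (by ring), rho_sub]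
    apply rho_congr hadm
    intro m i hi1 hi2
    simp only [VBC]
    simp only [VP.bx, Yf, Pi.sub_apply]
    simp only [if_pos (And.intro hi1 hi2)]
    rcases lt_or_ge i n with h | h
    all_goals
      simp (disch := omega) only [if_pos, if_neg]
      repeat' (first | (exfalso; omega) | split)
      all_goals norm_num
  · rw [xsj_rho hadm (fun l => (PABC ι n l : ℤ)) _ (u + n - ((2 * n + 1 - e : ℕ) : ℤ) + 1) (2 * n - e) (by ring),
      xsj_rho hadm (fun l => (PABC ι n l : ℤ)) _ (u + n - ((2 * n + 1 - e : ℕ) : ℤ) + 1) (2 * n + 1 - e) (by ring), rho_sub]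
    apply rho_congr hadm
    intro m i hi1 hi2
    simp only [VBC]
    simp only [VP.bx, Yf, Pi.sub_apply]
    simp only [if_pos (And.intro hi1 hi2)]
    rcases lt_or_ge i n with h | h
    all_goals
      simp (disch := omega) only [if_pos, if_neg]
      repeat' (first | (exfalso; omega) | split)
      all_goals norm_num

lemma boxC_rho {n : ℕ} {ι : ℕ → ℕ} (hadm : Admissible n ι) (hn : 2 ≤ n) (u : ℤ) (e : ℕ) (h1 : 1 ≤ e)
    (h2 : e < (VBC n 2).top) :
    boxC ι n u e = rho ι (fun l => (PABC ι n l : ℤ)) ((VBC n 2).bx u e) := by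
  simp only [VBC] at h2
  unfold boxC
  rw [if_neg (by omega)]
  split
  · rw [xsj_rho hadm (fun l => (PABC ι n l : ℤ)) _ u e rfl,
      xsj_rho hadm (fun l => (PABC ι n l : ℤ)) _ (u + 1) (e - 1) (by ring), rho_sub]
    apply rho_congr hadm
    intro m i hi1 hi2
    simp only [VBC]
    simp only [VP.bx, Yf, Pi.sub_apply]
    simp only [if_pos (And.intro hi1 hi2)]
    rcases lt_or_ge i n with h | h
    all_goals
      simp (disch := omega) only [if_pos, if_neg]
      repeat' (first | (exfalso; omega) | split)
      all_goals norm_num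
  split
  · rw [xsj_rho hadm (fun l => (PABC ι n l : ℤ)) _ u n rfl,
      xsj_rho hadm (fun l => (PABC ι n l : ℤ)) _ (u + 1) (n - 1) (by ring), rho_smul, rho_sub]
    apply rho_congr hadm
    intro m i hi1 hi2
    simp only [VBC]
    simp only [VP.bx, Yf, Pi.sub_apply, Pi.smul_apply, smul_eq_mul]
    simp only [if_pos (And.intro hi1 hi2)]
    rcases lt_or_ge i n with h | h
    all_goals
      simp (disch := omega) only [if_pos, if_neg]
      repeat' (first | (exfalso; omega) | split)
      all_goals norm_num
  split
  · rw [xsj_rho hadm (fun l => (PABC ι n l : ℤ)) _ (u + 1) n (by ring),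
      xsj_rho hadm (fun l => (PABC ι n l : ℤ)) _ (u + 1) (n - 1) (by ring), rho_smul, rho_sub]
    apply rho_congr hadm
    intro m i hi1 hi2
    simp only [VBC]
    simp only [VP.bx, Yf, Pi.sub_apply, Pi.smul_apply, smul_eq_mul]
    simp only [if_pos (And.intro hi1 hi2)]
    rcases lt_or_ge i n with h | h
    all_goals
      simp (disch := omega) only [if_pos, if_neg]
      repeat' (first | (exfalso; omega) | split)
      all_goals norm_num
  · rw [xsj_rho hadm (fun l => (PABC ι n l : ℤ)) _ (u + n - ((2 * n + 1 - e : ℕ) : ℤ) + 1) (2 * n - e) (by ring),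
      xsj_rho hadm (fun l => (PABC ι n l : ℤ)) _ (u + n - ((2 * n + 1 - e : ℕ) : ℤ) + 1) (2 * n + 1 - e) (by ring), rho_sub]
    apply rho_congr hadm
    intro m i hi1 hi2
    simp only [VBC]
    simp only [VP.bx, Yf, Pi.sub_apply]
    simp only [if_pos (And.intro hi1 hi2)]
    rcases lt_or_ge i n with h | h
    all_goals
      simp (disch := omega) only [if_pos, if_neg]
      repeat' (first | (exfalso; omega) | split)
      all_goals norm_num

lemma boxD_rho {n : ℕ} {ι : ℕ → ℕ} (hadm : Admissible n ι) (hn : 4 ≤ n) (u : ℤ) (e : ℕ) (h1 : 1 ≤ e)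
    (h2 : e < (VD n).top) :
    boxD ι n u e = rho ι (fun l => (PD ι n l : ℤ)) ((VD n).bx u e) := by
  simp only [VD] at h2
  unfold boxD
  rw [if_neg (by omega)]
  split
  · rw [xsj_rho hadm (fun l => (PD ι n l : ℤ)) _ u e rfl,
      xsj_rho hadm (fun l => (PD ι n l : ℤ)) _ (u + 1) (e - 1) (by ring), rho_sub]
    apply rho_congr hadm
    intro m i hi1 hi2
    simp only [VD]
    simp only [VP.bx, Yf, Pi.sub_apply]
    simp only [if_pos (And.intro hi1 hi2)]
    rcases lt_or_ge i n with h | h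
    all_goals
      simp (disch := omega) only [if_pos, if_neg]
      repeat' (first | (exfalso; omega) | split)
      all_goals norm_num
  split
  · rw [xsj_rho hadm (fun l => (PD ι n l : ℤ)) _ u n rfl, xsj_rho hadm (fun l => (PD ι n l : ℤ)) _ u (n - 1) rfl,
      xsj_rho hadm (fun l => (PD ι n l : ℤ)) _ (u + 1) (n - 2) (by ring), rho_add, rho_sub]
    apply rho_congr hadm
    intro m i hi1 hi2
    simp only [VD]
    simp only [VP.bx, Yf, Pi.sub_apply, Pi.add_apply]
    simp only [if_pos (And.intro hi1 hi2)]
    rcases lt_or_ge i n with h | h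
    all_goals
      simp (disch := omega) only [if_pos, if_neg]
      repeat' (first | (exfalso; omega) | split)
      all_goals norm_num
  split
  · rw [xsj_rho hadm (fun l => (PD ι n l : ℤ)) _ u n rfl,
      xsj_rho hadm (fun l => (PD ι n l : ℤ)) _ (u + 1) (n - 1) (by ring), rho_sub]
    apply rho_congr hadm
    intro m i hi1 hi2
    simp only [VD]
    simp only [VP.bx, Yf, Pi.sub_apply, Pi.add_apply]
    simp only [if_pos (And.intro hi1 hi2)]
    rcases lt_or_ge i n with h | h
    all_goals
      simp (disch := omega) only [if_pos, if_neg]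
      repeat' (first | (exfalso; omega) | split)
      all_goals norm_num
  split
  · rw [xsj_rho hadm (fun l => (PD ι n l : ℤ)) _ (u + 1) n (by ring),
      xsj_rho hadm (fun l => (PD ι n l : ℤ)) _ u (n - 1) rfl, rho_sub]
    apply rho_congr hadm
    intro m i hi1 hi2
    simp only [VD]
    simp only [VP.bx, Yf, Pi.sub_apply, Pi.add_apply]
    simp only [if_pos (And.intro hi1 hi2)]
    rcases lt_or_ge i n with h | h
    all_goals
      simp (disch := omega) only [if_pos, if_neg]
      repeat' (first | (exfalso; omega) | split)
      all_goals norm_num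
  split
  · rw [xsj_rho hadm (fun l => (PD ι n l : ℤ)) _ (u + 1) n (by ring),
      xsj_rho hadm (fun l => (PD ι n l : ℤ)) _ (u + 1) (n - 1) (by ring),
      xsj_rho hadm (fun l => (PD ι n l : ℤ)) _ (u + 1) (n - 2) (by ring), rho_sub, rho_sub]
    apply rho_congr hadm
    intro m i hi1 hi2
    simp only [VD]
    simp only [VP.bx, Yf, Pi.sub_apply, Pi.add_apply]
    simp only [if_pos (And.intro hi1 hi2)]
    rcases lt_or_ge i n with h | h
    all_goals
      simp (disch := omega) only [if_pos, if_neg]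
      repeat' (first | (exfalso; omega) | split)
      all_goals norm_num
  · rw [xsj_rho hadm (fun l => (PD ι n l : ℤ)) _ (u + n - ((2 * n + 1 - e : ℕ) : ℤ)) (2 * n - e) (by ring),
      xsj_rho hadm (fun l => (PD ι n l : ℤ)) _ (u + n - ((2 * n + 1 - e : ℕ) : ℤ)) (2 * n + 1 - e) (by ring), rho_sub]
    apply rho_congr hadm
    intro m i hi1 hi2
    simp only [VD]
    simp only [VP.bx, Yf, Pi.sub_apply]
    simp only [if_pos (And.intro hi1 hi2)]
    rcases lt_or_ge i n with h | h
    all_goals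
      simp (disch := omega) only [if_pos, if_neg]
      repeat' (first | (exfalso; omega) | split)
      all_goals norm_num


namespace VP
variable {V : VP} {A : ℕ → ℕ → ℤ} {P : ℕ → ℤ} {wt : ℕ → ℕ} {K : ℕ}

lemma VG_down (hV : V.OK A) {s : ℤ} {F : ℤ → ℕ → ℚ} {m : ℤ} {l : ℕ} (h : V.VG P K s F)
    (h1 : 1 ≤ l) (h2 : l ≤ V.n) (hpos : 0 < F m l) : V.VG P K s (F - F m l • bh V.n A m l) := by
  obtain ⟨k, J, hk1, hk2, hs, hJ, rfl⟩ := h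
  obtain ⟨J', hJ', he⟩ := col_down hV h1 h2 hJ hpos
  exact ⟨k, J', hk1, hk2, hs, hJ', he.symm⟩

lemma VG_up (hV : V.OK A) {s : ℤ} {F : ℤ → ℕ → ℚ} {m : ℤ} {l : ℕ} (h : V.VG P K s F)
    (h1 : 1 ≤ l) (h2 : l ≤ V.n) (hneg : F m l < 0) :
    V.VG P K s (F - F m l • bh V.n A (m - 1) l) := by
  obtain ⟨k, J, hk1, hk2, hs, hJ, rfl⟩ := h
  obtain ⟨J', hJ', he⟩ := col_up hV h1 h2 hJ hneg
  exact ⟨k, J', hk1, hk2, hs, hJ', he.symm⟩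

lemma VG_supp (hV : V.OK A) {s : ℤ} {F : ℤ → ℕ → ℚ} {m : ℤ} {l : ℕ} (h : V.VG P K s F)
    (hne : F m l ≠ 0) : s ≤ m := by
  obtain ⟨k, J, hk1, hk2, hs, hJ, rfl⟩ := h
  exact col_supp hV hJ hne

lemma VG_reach {ι : ℕ → ℕ} (hadm : Admissible V.n ι) (had : Adapted V.n A ι)
    (hP : PotOK V.n A ι P) (hV : V.OK A) (h2 : V.OK2 P wt K) {s : ℤ} {F : ℤ → ℕ → ℚ}
    (h : V.VG P K s F) : rho ι P F ∈ Xi A ι := by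
  obtain ⟨k, J, hk1, hk2, hs, hJ, rfl⟩ := h
  exact reach hadm had hP hV h2 hk1 hk2 hs _ J rfl hJ

end VP

lemma VA_low (n : ℕ) (s : ℤ) (k : ℕ) (h1 : 1 ≤ k) (h2 : k ≤ n) :
    ∃ J, (VA n).VCol k J ∧ (VA n).col s k J = - Yf (s + k) (n + 1 - k) := by
  apply VP.col_low (VA_OK n) (hq := by simp only [VA]; omega)
  · simp only [VA]; omega
  · rfl
  · intro l hl1 hl2
    simp only [VA, and_true, true_and, Nat.cast_zero, add_zero, or_self, implies_true] at *
    refine ⟨?_, ?_, ?_, ?_, ?_⟩ <;> omega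

lemma VBC_low (n : ℕ) (hn : 2 ≤ n) (cn : ℚ) (A : ℕ → ℕ → ℤ)
    (hA : (A = cartanB n ∧ cn = 1) ∨ (A = cartanC n ∧ cn = 2)) (s : ℤ) (k : ℕ) (h1 : 1 ≤ k)
    (h2 : k ≤ n - 1) :
    ∃ J, (VBC n cn).VCol k J ∧ (VBC n cn).col s k J = - Yf (s + n) k := by
  apply VP.col_low (VBC_OK n hn cn A hA) (hq := by simp only [VBC]; omega)
  · simp only [VBC]; omega
  · simp only [VBC]; rw [if_neg (by omega)]
  · intro l hl1 hl2
    simp only [VBC] at *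
    rcases lt_or_ge l n with h | h
    · simp only [if_pos h]
      omega
    · simp only [if_neg (not_lt.mpr h)]
      omega

lemma VD_low (n : ℕ) (hn : 4 ≤ n) (s : ℤ) (k : ℕ) (h1 : 1 ≤ k)
    (h2 : k ≤ n - 2) :
    ∃ J, (VD n).VCol k J ∧ (VD n).col s k J = - Yf (s + (n - 1)) k := by
  apply VP.col_low (VD_OK n hn) (hq := by simp only [VD]; omega)
  · simp only [VD]; omega
  · rfl
  · intro l hl1 hl2
    simp only [VD] at *
    rcases lt_or_ge l n with h | h
    · simp only [if_pos h]
      omega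
    · simp only [if_neg (not_lt.mpr h)]
      omega

lemma PABC_one (ι : ℕ → ℕ) (n : ℕ) : PABC ι n 1 = 0 := by
  simp [PABC]

theorem typeA (n : ℕ) (ι : ℕ → ℕ) (hadm : Admissible n ι) (hn : 2 ≤ n)
    (had : Adapted n (cartanA n) ι) :
      Sig (cartanA n) ι =
        { a | (∀ φ ∈ TabAcut ι n, 0 ≤ evalForm φ a) ∧
              ∀ m i, n < m → 1 ≤ i → i ≤ n → a (occPos ι i m) = 0 } := by
  set P : ℕ → ℤ := fun l => (PABC ι n l : ℤ) with hPdef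
  have hsl : Slope n P := PABC_slope ι n
  have hP : PotOK n (cartanA n) ι P := PABC_pot hadm had (cartanA_ne n)
  have hV := VA_OK n
  have h2 : (VA n).OK2 P id n := VA_OK2 n P hsl
  apply generic hadm had hP (fun l => by simp [hPdef]) (fun s F => (VA n).VG P n s F)
  · intro s F m l h h1 h2 hp
    exact VP.VG_down hV h h1 h2 hp
  · intro s F m l h h1 h2 hp
    exact VP.VG_up hV h h1 h2 hp
  · intro m l hm h1 h3
    exact ⟨m - P l, VP.VG_base hV h2 (by simp only [VA]; omega) h1 h3 (by omega)⟩
  · intro s F h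
    exact VP.VG_reach (V := VA n) hadm had hP hV h2 h
  · intro s F m l h hne
    exact VP.VG_supp hV h hne
  · intro m l hm h1 h3
    obtain ⟨J, hJ, he⟩ := VA_low n (m - P l - (n + 1 - l : ℕ)) (n + 1 - l) (by omega) (by omega)
    refine ⟨m - P l - (n + 1 - l : ℕ), n + 1 - l, J, by omega, by omega, ?_, hJ, ?_⟩
    · have h := (hsl 1 l (by omega) h1 h3).2
      have h' : P 1 = 0 := by simp [hPdef, PABC_one]
      have h'' : 0 ≤ P (n + 1 - l) := by simp [hPdef]
      omega
    · rw [he]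
      congr 2
      · ring
      · omega
  · intro φ
    have hc := fun s => VP.VG_cut (K := n) (s := s) (ι := ι) (P := P) hV
      (box := boxA ι n) (boxA_rho hadm) φ
    constructor
    · rintro ⟨k, s, j, hk1, hk2, hj, hR, hs, hsn, he⟩
      obtain ⟨F, hF, hφ⟩ := (hc s).mpr ⟨k, j, hk1, hk2, fun i h1 h2 => ⟨(hj i h1 h2).1, by
        have := (hj i h1 h2).2; simp only [VA]; omega⟩, fun i h1 h2 => Or.inl (hR i h1 h2), hs, he⟩
      exact ⟨s, F, hF, hsn, hφ⟩
    · rintro ⟨s, F, hF, hsn, hφ⟩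
      obtain ⟨k, j, hk1, hk2, hj, hR, hs, he⟩ := (hc s).mp ⟨F, hF, hφ⟩
      refine ⟨k, s, j, hk1, hk2, fun i h1 h2 => ⟨(hj i h1 h2).1, ?_⟩, fun i h1 h2 => ?_, hs, hsn, he⟩
      · have := (hj i h1 h2).2; simp only [VA] at this; omega
      · have h3 := hR i h1 h2
        have h4 := (hj i h1 (by omega)).2
        simp only [VA, VP.R] at h3 h4
        omega


/-! ### Spin columns, types B and C -/

/-- lattice paths -/
def LP (n : ℕ) (h : ℕ → ℤ) : Prop :=
  h 0 = 0 ∧ ∀ j, 1 ≤ j → j ≤ n → h j = h (j - 1) ∨ h j = h (j - 1) + 1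

lemma LP.nonneg {n : ℕ} {h : ℕ → ℤ} (H : LP n h) : ∀ j, j ≤ n → 0 ≤ h j := by
  intro j
  induction j with
  | zero => intro _; rw [H.1]
  | succ j ih =>
    intro hj
    have h1 := ih (by omega)
    have h2 := H.2 (j + 1) (by omega) hj
    rw [Nat.add_sub_cancel] at h2
    omega

/-- change of a path at one place -/
def upd (h : ℕ → ℤ) (l : ℕ) (v : ℤ) : ℕ → ℤ := fun j => if j = l then v else h j

lemma upd_same (h : ℕ → ℤ) (l : ℕ) (v : ℤ) : upd h l v l = v := by simp [upd]

lemma upd_ne (h : ℕ → ℤ) {l j : ℕ} (v : ℤ) (hj : j ≠ l) : upd h l v j = h j := by simp [upd, hj]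

lemma upd_upd (h : ℕ → ℤ) (l : ℕ) (v : ℤ) : upd (upd h l v) l (h l) = h := by
  funext j; simp only [upd]; split_ifs with hj
  · rw [hj]
  · rfl

lemma LP.upd_mem {n : ℕ} {h : ℕ → ℤ} (H : LP n h) {l : ℕ} (h1 : 1 ≤ l) {v : ℤ}
    (ha : v = h (l - 1) ∨ v = h (l - 1) + 1)
    (hb : l < n → h (l + 1) = v ∨ h (l + 1) = v + 1) : LP n (upd h l v) := by
  refine ⟨?_, ?_⟩
  · rw [upd_ne _ _ (by omega)]; exact H.1
  · intro j hj1 hj2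
    by_cases e1 : j = l
    · subst e1
      rw [upd_same, upd_ne _ _ (by omega)]; exact ha
    · by_cases e2 : j = l + 1
      · subst e2
        rw [upd_ne _ _ e1, Nat.add_sub_cancel, upd_same]
        exact hb (by omega)
      · rw [upd_ne _ _ e1, upd_ne _ _ (by omega)]
        exact H.2 j hj1 hj2

/-- curvature -/
def sg (n : ℕ) (h : ℕ → ℤ) (j : ℕ) : ℤ :=
  if j < n then h (j + 1) - 2 * h j + h (j - 1) else 1 - 2 * (h n - h (n - 1))

/-- spin forms of types B, C -/
def SF (n : ℕ) (κ : ℕ → ℚ) (s : ℤ) (h : ℕ → ℤ) : ℤ → ℕ → ℚ := fun m j =>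
  if 1 ≤ j ∧ j ≤ n then (if m = s + h j + n - j then κ j * (sg n h j : ℚ) else 0) else 0

/-- compatibility of weights with the Cartan matrix -/
structure KOK (n : ℕ) (A : ℕ → ℕ → ℤ) (κ : ℕ → ℚ) : Prop where
  pos : ∀ l, 1 ≤ l → l ≤ n → 0 < κ l
  last : κ n = 1
  lft : ∀ l, 2 ≤ l → l ≤ n → κ (l - 1) = - (κ l * (A l (l - 1) : ℚ))
  rgt : ∀ l, 1 ≤ l → l < n → κ (l + 1) * (if l + 1 = n then 2 else 1) = - (κ l * (A l (l + 1) : ℚ))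
  far : ∀ l i, 1 ≤ l → l ≤ n → i ≠ l → i ≠ l + 1 → l ≠ i + 1 → A l i = 0

lemma SF_shift {n : ℕ} {A : ℕ → ℕ → ℤ} {κ : ℕ → ℚ} (hK : KOK n A κ) {h : ℕ → ℤ} {l : ℕ}
    (h1 : 1 ≤ l) (h2 : l ≤ n) (ha : h (l - 1) = h l) (hb : l < n → h (l + 1) = h l + 1) (s : ℤ) :
    SF n κ s (upd h l (h l + 1)) = SF n κ s h - κ l • bh n A (s + h l + n - l) l ∧
    SF n κ s h (s + h l + n - l) l = κ l := by
  constructor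
  · funext m i
    by_cases hi : 1 ≤ i ∧ i ≤ n
    swap
    · simp [SF, bh, hi]
    simp only [SF, bh, Pi.sub_apply, Pi.smul_apply, smul_eq_mul, if_pos hi]
    by_cases e1 : i = l
    · subst e1
      have s1 : sg n (upd h i (h i + 1)) i = -1 := by
        unfold sg
        rcases h2.lt_or_eq with h3 | h3
        · rw [if_pos h3, upd_same, upd_ne _ _ (by omega), upd_ne _ _ (by omega), ha, hb h3]; ring
        · rw [if_neg (by omega), ← h3, upd_same, upd_ne _ _ (by omega), ha]; ring
      have s2 : sg n h i = 1 := by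
        unfold sg
        rcases h2.lt_or_eq with h3 | h3
        · rw [if_pos h3, ha, hb h3]; ring
        · rw [if_neg (by omega), ← h3, ha]; ring
      rw [s1, s2, upd_same]
      by_cases e2 : m = s + h i + n - i
      · rw [if_neg (by omega), if_pos e2, if_pos rfl, if_pos e2, if_neg (by omega)]; push_cast; ring
      · by_cases e3 : m = s + h i + n - i + 1
        · rw [if_pos (by omega), if_neg e2, if_pos rfl, if_neg e2, if_pos e3]; push_cast; ring
        · rw [if_neg (by omega), if_neg e2, if_pos rfl, if_neg e2, if_neg e3]; ring
    · rw [if_neg e1, upd_ne _ _ e1]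
      by_cases e2 : l = i + 1
      · subst e2
        rw [Nat.add_sub_cancel] at ha
        have s1 : sg n (upd h (i + 1) (h (i + 1) + 1)) i = sg n h i + 1 := by
          unfold sg
          rw [if_pos (by omega), if_pos (by omega), upd_same, upd_ne _ _ (by omega), upd_ne _ _ (by omega)]
          ring
        have hk := hK.lft (i + 1) (by omega) h2
        rw [Nat.add_sub_cancel] at hk
        rw [s1, if_pos (by omega : i < i + 1)]
        by_cases e3 : m = s + h i + n - i
        · rw [if_pos e3, if_pos e3, if_pos (by push_cast; omega)]; push_cast; rw [hk]; ring
        · rw [if_neg e3, if_neg e3, if_neg (by push_cast; omega)]; ring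
      · by_cases e3 : i = l + 1
        · subst e3
          have hb' := hb (by omega)
          have hk := hK.rgt l h1 (by omega)
          obtain ⟨c, s1, hc⟩ : ∃ c : ℤ, sg n (upd h l (h l + 1)) (l + 1) = sg n h (l + 1) + c ∧
              κ (l + 1) * (c : ℚ) = - (κ l * (A l (l + 1) : ℚ)) := by
            unfold sg
            by_cases h3 : l + 1 < n
            · refine ⟨1, ?_, ?_⟩
              · rw [if_pos h3, if_pos h3, upd_ne _ _ (by omega), upd_ne _ _ (by omega),
                  Nat.add_sub_cancel, upd_same]
                ring
              · rw [← hk, if_neg (by omega)]; norm_num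
            · have h4 : n = l + 1 := by omega
              refine ⟨2, ?_, ?_⟩
              · rw [if_neg h3, if_neg h3, h4, Nat.add_sub_cancel, upd_same, upd_ne _ _ (by omega)]
                ring
              · rw [← hk, if_pos h4.symm]; norm_num
          rw [s1, if_neg (by omega : ¬ (l + 1 < l))]
          by_cases e3 : m = s + h (l + 1) + n - (l + 1 : ℕ)
          · rw [if_pos e3, if_pos e3, if_pos (by push_cast at e3; omega)]
            push_cast
            rw [mul_add, hc]; ring
          · rw [if_neg e3, if_neg e3, if_neg (by push_cast at e3; omega)]; ring
        · have s1 : sg n (upd h l (h l + 1)) i = sg n h i := by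
            unfold sg
            by_cases h3 : i < n
            · rw [if_pos h3, if_pos h3, upd_ne _ _ (by omega), upd_ne _ _ (by omega), upd_ne _ _ (by omega)]
            · rw [if_neg h3, if_neg h3, upd_ne _ _ (by omega), upd_ne _ _ (by omega)]
          rw [s1, hK.far l i h1 h2 e1 e3 e2]
          simp
  · simp only [SF]
    rw [if_pos ⟨h1, h2⟩, if_pos trivial]
    have s2 : sg n h l = 1 := by
      unfold sg
      rcases h2.lt_or_eq with h3 | h3
      · rw [if_pos h3, ha, hb h3]; ring
      · rw [if_neg (by omega), ← h3, ha]; ring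
    rw [s2]; simp

lemma SF_apply {n : ℕ} {A : ℕ → ℕ → ℤ} {κ : ℕ → ℚ} (hK : KOK n A κ) {h : ℕ → ℤ} (H : LP n h) {l : ℕ}
    (h1 : 1 ≤ l) (h2 : l ≤ n) {s m : ℤ} (hne : SF n κ s h m l ≠ 0) : m = s + h l + n - l ∧
    ((0 < SF n κ s h m l ∧ h (l - 1) = h l ∧ (l < n → h (l + 1) = h l + 1)) ∨
     (SF n κ s h m l = - κ l ∧ h (l - 1) = h l - 1 ∧ (l < n → h (l + 1) = h l))) := by
  simp only [SF] at *
  rw [if_pos ⟨h1, h2⟩] at *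
  by_cases e : m = s + h l + n - l
  swap
  · rw [if_neg e] at hne; exact absurd rfl hne
  rw [if_pos e] at *
  refine ⟨e, ?_⟩
  have a1 := H.2 l h1 h2
  have hp := hK.pos l h1 h2
  have key : (sg n h l = 0) ∨ (sg n h l = 1 ∧ h (l - 1) = h l ∧ (l < n → h (l + 1) = h l + 1)) ∨
      (sg n h l = -1 ∧ h (l - 1) = h l - 1 ∧ (l < n → h (l + 1) = h l)) := by
    unfold sg
    rcases h2.lt_or_eq with h3 | h3
    · have a2 := H.2 (l + 1) (by omega) h3
      rw [Nat.add_sub_cancel] at a2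
      rw [if_pos h3]; omega
    · subst h3
      rw [if_neg (by omega)]; omega
  rcases key with k | ⟨k, k1, k2⟩ | ⟨k, k1, k2⟩
  · rw [k] at hne; simp at hne
  · left; rw [k]; simpa using ⟨hp, k1, k2⟩
  · right; rw [k]; simpa using ⟨k1, k2⟩

/-- spin family -/
def SG (n : ℕ) (κ : ℕ → ℚ) (P : ℕ → ℤ) (s : ℤ) (F : ℤ → ℕ → ℚ) : Prop :=
  ∃ h, LP n h ∧ 1 - P n ≤ s ∧ F = SF n κ s h

lemma SG_down {n : ℕ} {A : ℕ → ℕ → ℤ} {κ : ℕ → ℚ} (hK : KOK n A κ) {P : ℕ → ℤ} {s : ℤ}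
    {F : ℤ → ℕ → ℚ} {m : ℤ} {l : ℕ} (h : SG n κ P s F)
    (h1 : 1 ≤ l) (h2 : l ≤ n) (hpos : 0 < F m l) : SG n κ P s (F - F m l • bh n A m l) := by
  obtain ⟨h, H, hs, rfl⟩ := h
  obtain ⟨e, ⟨_, h3, h4⟩ | ⟨h3, _⟩⟩ := SF_apply hK H h1 h2 (ne_of_gt hpos)
  · obtain ⟨h5, h6⟩ := SF_shift hK h1 h2 h3 h4 s
    rw [e, h6]
    exact ⟨_, H.upd_mem h1 (by omega) (by omega), hs, h5.symm⟩
  · rw [h3] at hpos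
    have := hK.pos l h1 h2
    linarith

lemma SG_up {n : ℕ} {A : ℕ → ℕ → ℤ} {κ : ℕ → ℚ} (hK : KOK n A κ) {P : ℕ → ℤ} {s : ℤ}
    {F : ℤ → ℕ → ℚ} {m : ℤ} {l : ℕ} (h : SG n κ P s F)
    (h1 : 1 ≤ l) (h2 : l ≤ n) (hneg : F m l < 0) : SG n κ P s (F - F m l • bh n A (m - 1) l) := by
  obtain ⟨h, H, hs, rfl⟩ := h
  obtain ⟨e, ⟨h3, _⟩ | ⟨h3, h4, h5⟩⟩ := SF_apply hK H h1 h2 (ne_of_lt hneg)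
  · linarith
  · rw [h3, e]
    refine ⟨upd h l (h l - 1), H.upd_mem h1 (by omega) (by omega), hs, ?_⟩
    obtain ⟨h6, h7⟩ := SF_shift hK (h := upd h l (h l - 1)) h1 h2
      (by rw [upd_same, upd_ne _ _ (by omega)]; exact h4)
      (by intro h8; rw [upd_same, upd_ne _ _ (by omega), h5 h8]; ring) s
    rw [upd_same, sub_add_cancel, upd_upd] at h6
    rw [h6, show s + (h l - 1) + n - l = s + h l + n - l - 1 by ring]
    module

lemma SG_supp {n : ℕ} {A : ℕ → ℕ → ℤ} {κ : ℕ → ℚ} (hK : KOK n A κ) {P : ℕ → ℤ} {s : ℤ}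
    {F : ℤ → ℕ → ℚ} {m : ℤ} {l : ℕ} (h : SG n κ P s F) (hne : F m l ≠ 0) : s ≤ m := by
  obtain ⟨h, H, hs, rfl⟩ := h
  by_cases hl : 1 ≤ l ∧ l ≤ n
  · have := (SF_apply hK H hl.1 hl.2 hne).1
    have := H.nonneg l hl.2
    omega
  · simp [SF, hl] at hne

lemma SG_base {n : ℕ} {A : ℕ → ℕ → ℤ} {κ : ℕ → ℚ} (hK : KOK n A κ) (hn : 1 ≤ n) {s : ℤ} {h : ℕ → ℤ}
    (H : ∀ j ≤ n, h j = 0) : SF n κ s h = Yf s n := by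
  funext m i
  simp only [SF, Yf]
  by_cases hi : 1 ≤ i ∧ i ≤ n
  · rw [if_pos hi, H i hi.2]
    unfold sg
    rcases hi.2.lt_or_eq with h3 | h3
    · rw [if_pos h3, H _ (by omega), H _ (by omega), H _ (by omega), if_neg (by omega : ¬ (m = s ∧ i = n))]
      simp
    · subst h3
      rw [if_neg (lt_irrefl i), H _ (by omega), H _ (by omega), hK.last]
      simp
  · rw [if_neg hi, if_neg (by omega)]

lemma SG_low {n : ℕ} {A : ℕ → ℕ → ℤ} {κ : ℕ → ℚ} (hK : KOK n A κ) (hn : 1 ≤ n) {s : ℤ} :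
    SF n κ s (fun j => (j : ℤ)) = - Yf (s + n) n := by
  funext m i
  simp only [SF, Yf, Pi.neg_apply]
  by_cases hi : 1 ≤ i ∧ i ≤ n
  · rw [if_pos hi]
    unfold sg
    rcases hi.2.lt_or_eq with h3 | h3
    · rw [if_pos h3, if_neg (by omega : ¬ (m = s + n ∧ i = n)),
        show ((i + 1 : ℕ) : ℤ) - 2 * (i : ℤ) + ((i - 1 : ℕ) : ℤ) = 0 by omega]
      simp
    · subst h3
      rw [if_neg (lt_irrefl i), hK.last, show 1 - 2 * ((i : ℤ) - ((i - 1 : ℕ) : ℤ)) = -1 by omega]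
      by_cases e : m = s + i
      · rw [if_pos (by omega), if_pos (by simp [e])]; norm_num
      · rw [if_neg (by omega), if_neg (by simp [e])]; norm_num
  · rw [if_neg hi, if_neg (by omega)]; norm_num

lemma LP.exists_last {n : ℕ} {h : ℕ → ℤ} (H : LP n h) : ∀ N, N ≤ n → (∀ j, j ≤ N → h j = 0) ∨
    ∃ t, 1 ≤ t ∧ t ≤ N ∧ h t = h (t - 1) + 1 ∧ ∀ j, t ≤ j → j ≤ N → h j = h t := by
  intro N
  induction N with
  | zero => intro _; left; intro j hj; rw [Nat.le_zero.mp hj]; exact H.1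
  | succ N ih =>
    intro hN
    have h2 := H.2 (N + 1) (by omega) hN
    rw [Nat.add_sub_cancel] at h2
    rcases h2 with h2 | h2
    · rcases ih (by omega) with h3 | ⟨t, t1, t2, t3, t4⟩
      · left
        intro j hj
        rcases Nat.lt_or_ge N j with h4 | h4
        · rw [show j = N + 1 by omega, h2]; exact h3 N le_rfl
        · exact h3 j h4
      · right
        refine ⟨t, t1, by omega, t3, fun j h5 h6 => ?_⟩
        rcases Nat.lt_or_ge N j with h4 | h4
        · rw [show j = N + 1 by omega, h2]; exact t4 N t2 le_rfl
        · exact t4 j h5 h4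
    · right
      refine ⟨N + 1, by omega, le_rfl, by rw [Nat.add_sub_cancel]; exact h2, fun j h5 h6 => ?_⟩
      rw [show j = N + 1 by omega]

lemma sum_upd (h : ℕ → ℤ) (l N : ℕ) (hl : l < N) (v : ℤ) :
    ∑ j ∈ Finset.range N, upd h l v j = ∑ j ∈ Finset.range N, h j + (v - h l) := by
  have : ∀ j, upd h l v j = h j + (if j = l then v - h l else 0) := by
    intro j; unfold upd; split_ifs with e
    · rw [e]; ring
    · ring
  simp only [this, Finset.sum_add_distrib, Finset.sum_ite_eq', Finset.mem_range, hl, if_true]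

lemma SG_reach {n : ℕ} {A : ℕ → ℕ → ℤ} {κ : ℕ → ℚ} (hK : KOK n A κ) (hn : 1 ≤ n) {ι : ℕ → ℕ}
    (hadm : Admissible n ι) (had : Adapted n A ι) {P : ℕ → ℤ} (hP : PotOK n A ι P) (hsl : Slope n P)
    {s : ℤ} (hs : 1 - P n ≤ s) : ∀ (N : ℕ) (h : ℕ → ℤ), LP n h →
      ∑ j ∈ Finset.range (n + 1), h j = N → rho ι P (SF n κ s h) ∈ Xi A ι := by
  intro N
  induction N with
  | zero =>
    intro h H hN
    have h0 : ∀ j ≤ n, h j = 0 := by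
      intro j hj
      have := (Finset.sum_eq_zero_iff_of_nonneg (fun j hj => H.nonneg j (by
        have := Finset.mem_range.mp hj; omega))).mp hN
      exact this j (Finset.mem_range.mpr (by omega))
    rw [SG_base hK hn h0]
    exact Xi_base hadm hn le_rfl (by omega)
  | succ N ih =>
    intro h H hN
    rcases H.exists_last n le_rfl with h0 | ⟨t, t1, t2, t3, t4⟩
    · rw [SG_base hK hn h0]
      exact Xi_base hadm hn le_rfl (by omega)
    · obtain ⟨h6, h7⟩ := SF_shift hK (h := upd h t (h t - 1)) t1 t2
        (by rw [upd_same, upd_ne _ _ (by omega)]; omega)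
        (by intro h8; rw [upd_same, upd_ne _ _ (by omega), t4 (t + 1) (by omega) (by omega)]; ring) s
      rw [upd_same, sub_add_cancel, upd_upd] at h6
      rw [upd_same] at h7
      have H' : LP n (upd h t (h t - 1)) := H.upd_mem t1 (by omega) (by
        intro h8; rw [t4 (t + 1) (by omega) (by omega)]; right; ring)
      have hr := ih (upd h t (h t - 1)) H' (by rw [sum_upd _ _ _ (by omega), hN]; push_cast; ring)
      have hb := (hsl t n t1 t2 le_rfl).2
      have hnn := H.nonneg (t - 1) (by omega)
      refine Xi_step hadm had hP t1 t2 (m := s + (h t - 1) + n - t) ?_ hr ?_ ?_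
      · omega
      · rw [h7]; exact hK.pos t t1 t2
      · rw [h7, h6]


/-! ### Spin columns, type D -/

/-- positions -/
def qD (n : ℕ) (s : ℤ) (h : ℕ → ℤ) (j : ℕ) : ℤ :=
  if j < n then s + h j + n - j - 1 else s + h (n - 1)

/-- curvature -/
def sgD (n : ℕ) (h : ℕ → ℤ) (j : ℕ) : ℤ :=
  if j < n then h (j + 1) - 2 * h j + h (j - 1) else 1 - h n + h (n - 2)

/-- spin forms of type D -/
def SD (n : ℕ) (s : ℤ) (h : ℕ → ℤ) : ℤ → ℕ → ℚ := fun m j =>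
  if 1 ≤ j ∧ j ≤ n then (if m = qD n s h j then (sgD n h j : ℚ) else 0) else 0

lemma SD_shift {n : ℕ} {h h' : ℕ → ℤ} {l : ℕ} (s : ℤ)
    (h1 : 1 ≤ l) (h2 : l ≤ n)
    (ha : sgD n h l = 1) (hb : sgD n h' l = -1) (hq : qD n s h' l = qD n s h l + 1)
    (hfar : ∀ i, 1 ≤ i → i ≤ n → i ≠ l → cartanD n l i = 0 → sgD n h' i = sgD n h i ∧
      (qD n s h' i = qD n s h i ∨ sgD n h i = 0))
    (hnear : ∀ i, 1 ≤ i → i ≤ n → i ≠ l → cartanD n l i ≠ 0 → cartanD n l i = -1 ∧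
      sgD n h' i = sgD n h i + 1 ∧ qD n s h' i = qD n s h i ∧
      qD n s h i = qD n s h l + (if i < l then 1 else 0)) :
    SD n s h' = SD n s h - bh n (cartanD n) (qD n s h l) l ∧
    SD n s h (qD n s h l) l = 1 := by
  constructor
  · funext m i
    by_cases hi : 1 ≤ i ∧ i ≤ n
    swap
    · simp [SD, bh, hi]
    simp only [SD, bh, Pi.sub_apply, if_pos hi]
    by_cases e1 : i = l
    · subst e1
      rw [ha, hb, hq]
      by_cases e2 : m = qD n s h i
      · rw [if_neg (by omega), if_pos e2, if_pos rfl, if_pos e2, if_neg (by omega)]; norm_num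
      · by_cases e3 : m = qD n s h i + 1
        · rw [if_pos e3, if_neg e2, if_pos rfl, if_neg e2, if_pos e3]; norm_num
        · rw [if_neg e3, if_neg e2, if_pos rfl, if_neg e2, if_neg e3]; norm_num
    · rw [if_neg e1]
      by_cases e2 : cartanD n l i = 0
      · obtain ⟨h3, h4⟩ := hfar i hi.1 hi.2 e1 e2
        rw [h3, e2]
        rcases h4 with h4 | h4
        · rw [h4]; simp
        · rw [h4]; simp
      · obtain ⟨h3, h4, h5, h6⟩ := hnear i hi.1 hi.2 e1 e2
        rw [h3, h4, h5, ← h6]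
        split_ifs <;> push_cast <;> ring
  · simp only [SD]
    rw [if_pos ⟨h1, h2⟩, if_pos trivial, ha]; norm_num

lemma SD_shift1 {n : ℕ} (hn : 4 ≤ n) {h : ℕ → ℤ} {l : ℕ} (s : ℤ)
    (h1 : 1 ≤ l) (h2 : l < n) (ha : h (l - 1) = h l) (hb : h (l + 1) = h l + 1) :
    SD n s (upd h l (h l + 1)) = SD n s h - bh n (cartanD n) (qD n s h l) l ∧
    SD n s h (qD n s h l) l = 1 := by
  apply SD_shift s h1 h2.le
  · rw [sgD, if_pos h2, ha, hb]; ring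
  · rw [sgD, if_pos h2, upd_same, upd_ne _ _ (by omega), upd_ne _ _ (by omega), ha, hb]; ring
  · rw [qD, qD, if_pos h2, if_pos h2, upd_same]; ring
  · intro i i1 i2 i3 hA
    have hx : i + 1 ≠ l := by
      rintro rfl
      rw [cartanD, if_neg (by omega), if_neg (by omega), if_pos (by omega)] at hA
      omega
    rcases i2.lt_or_eq with i4 | i4
    · have hy : i ≠ l + 1 := by
        rintro rfl
        rw [cartanD, if_neg (by omega), if_neg (by omega), if_pos (by omega)] at hA
        omega
      refine ⟨?_, Or.inl ?_⟩
      · rw [sgD, sgD, if_pos i4, if_pos i4, upd_ne _ _ hx, upd_ne _ _ i3, upd_ne _ _ (by omega)]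
      · rw [qD, qD, if_pos i4, if_pos i4, upd_ne _ _ i3]
    · subst i4
      have hy : i - 2 ≠ l := by
        rintro rfl
        rw [cartanD, if_neg (by omega), if_neg (by omega), if_pos (by omega)] at hA
        omega
      refine ⟨?_, ?_⟩
      · rw [sgD, sgD, if_neg (lt_irrefl i), if_neg (lt_irrefl i), upd_ne _ _ i3, upd_ne _ _ hy]
      · by_cases hz : l = i - 1
        · right
          subst hz
          rw [sgD, if_neg (lt_irrefl i)]
          rw [show i - 1 - 1 = i - 2 by omega] at ha
          rw [show i - 1 + 1 = i by omega] at hb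
          rw [ha, hb]; ring
        · left
          rw [qD, qD, if_neg (lt_irrefl i), if_neg (lt_irrefl i), upd_ne _ _ (by omega)]
  · intro i i1 i2 i3 hA
    have hcase : (i + 1 = l) ∨ (i = l + 1 ∧ i < n) ∨ (i = n ∧ l = n - 2) := by
      by_contra hcon
      apply hA
      unfold cartanD
      by_cases hc : (l = n - 1 ∧ i = n) ∨ (l = n ∧ i = n - 1)
      · rw [if_neg (by omega), if_pos hc]
      · rw [if_neg (by omega), if_neg hc, if_neg (by omega)]
    have hval : cartanD n l i = -1 := by
      rw [cartanD, if_neg (by omega), if_neg (by omega), if_pos (by omega)]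
    refine ⟨hval, ?_⟩
    rcases hcase with rfl | ⟨rfl, i4⟩ | ⟨rfl, rfl⟩
    · rw [Nat.add_sub_cancel] at ha
      refine ⟨?_, ?_, ?_⟩
      · rw [sgD, sgD, if_pos (by omega), if_pos (by omega), upd_same, upd_ne _ _ (by omega), upd_ne _ _ (by omega)]
        ring
      · rw [qD, qD, if_pos (by omega), if_pos (by omega), upd_ne _ _ (by omega)]
      · rw [qD, qD, if_pos (by omega), if_pos (by omega), if_pos (by omega), ha]; push_cast; ring
    · refine ⟨?_, ?_, ?_⟩
      · rw [sgD, sgD, if_pos (by omega), if_pos (by omega), upd_ne _ _ (by omega), upd_ne _ _ (by omega),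
          Nat.add_sub_cancel, upd_same]
        ring
      · rw [qD, qD, if_pos (by omega), if_pos (by omega), upd_ne _ _ (by omega)]
      · rw [qD, qD, if_pos (by omega), if_pos (by omega), if_neg (by omega), hb]; push_cast; ring
    · rw [show i - 2 + 1 = i - 1 by omega] at hb
      refine ⟨?_, ?_, ?_⟩
      · rw [sgD, sgD, if_neg (by omega), if_neg (by omega), upd_ne _ _ (by omega), upd_same]
        ring
      · rw [qD, qD, if_neg (by omega), if_neg (by omega), upd_ne _ _ (by omega)]
      · rw [qD, qD, if_neg (by omega), if_pos (by omega), if_neg (by omega), hb]; omega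

/-- the move at the letter `n` -/
def upn (n : ℕ) (h : ℕ → ℤ) (v : ℤ) : ℕ → ℤ := upd (upd h (n - 1) (h (n - 1) + v)) n (h n + 2 * v)

lemma upn_n (n : ℕ) (h : ℕ → ℤ) (v : ℤ) : upn n h v n = h n + 2 * v := upd_same _ _ _

lemma upn_n1 {n : ℕ} (hn : 4 ≤ n) (h : ℕ → ℤ) (v : ℤ) : upn n h v (n - 1) = h (n - 1) + v := by
  rw [upn, upd_ne _ _ (by omega), upd_same]

lemma upn_ne {n j : ℕ} (h : ℕ → ℤ) (v : ℤ) (h1 : j ≠ n) (h2 : j ≠ n - 1) : upn n h v j = h j := by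
  rw [upn, upd_ne _ _ h1, upd_ne _ _ h2]

lemma SD_shift2 {n : ℕ} (hn : 4 ≤ n) {h : ℕ → ℤ} (s : ℤ)
    (ha : h n = h (n - 1)) (hb : h (n - 1) = h (n - 2)) :
    SD n s (upn n h 1) = SD n s h - bh n (cartanD n) (qD n s h n) n ∧
    SD n s h (qD n s h n) n = 1 := by
  apply SD_shift s (by omega) le_rfl
  · rw [sgD, if_neg (lt_irrefl n), ha, hb]; ring
  · rw [sgD, if_neg (lt_irrefl n), upn_n, upn_ne _ _ (by omega) (by omega), ha, hb]; ring
  · rw [qD, qD, if_neg (lt_irrefl n), if_neg (lt_irrefl n), upn_n1 hn]; ring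
  · intro i i1 i2 i3 hA
    have hx : i ≠ n - 2 := by
      rintro rfl
      rw [cartanD, if_neg (by omega), if_neg (by omega), if_pos (by omega)] at hA
      omega
    by_cases hz : i = n - 1
    · subst hz
      have e : sgD n h (n - 1) = 0 := by
        rw [sgD, if_pos (by omega), show n - 1 + 1 = n by omega, show n - 1 - 1 = n - 2 by omega, ha, hb]; ring
      refine ⟨?_, Or.inr e⟩
      rw [e, sgD, if_pos (by omega), show n - 1 + 1 = n by omega, show n - 1 - 1 = n - 2 by omega, upn_n,
        upn_n1 hn, upn_ne _ _ (by omega) (by omega), ha, hb]; ring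
    · refine ⟨?_, Or.inl ?_⟩
      · rw [sgD, sgD, if_pos (by omega), if_pos (by omega), upn_ne _ _ (by omega) (by omega),
          upn_ne _ _ (by omega) (by omega), upn_ne _ _ (by omega) (by omega)]
      · rw [qD, qD, if_pos (by omega), if_pos (by omega), upn_ne _ _ (by omega) (by omega)]
  · intro i i1 i2 i3 hA
    have hcase : i = n - 2 := by
      by_contra hcon
      apply hA
      unfold cartanD
      by_cases hc : (n = n - 1 ∧ i = n) ∨ (n = n ∧ i = n - 1)
      · rw [if_neg (by omega), if_pos hc]
      · rw [if_neg (by omega), if_neg hc, if_neg (by omega)]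
    subst hcase
    refine ⟨?_, ?_, ?_, ?_⟩
    · rw [cartanD, if_neg (by omega), if_neg (by omega), if_pos (by omega)]
    · rw [sgD, sgD, if_pos (by omega), if_pos (by omega), show n - 2 + 1 = n - 1 by omega, upn_n1 hn,
        upn_ne _ _ (by omega) (by omega), upn_ne _ _ (by omega) (by omega)]
      ring
    · rw [qD, qD, if_pos (by omega), if_pos (by omega), upn_ne _ _ (by omega) (by omega)]
    · rw [qD, qD, if_pos (by omega), if_neg (by omega), if_pos (by omega), hb]; omega


lemma SD_apply {n : ℕ} (hn : 4 ≤ n) {h : ℕ → ℤ} (H : LP n h) {l : ℕ}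
    (h1 : 1 ≤ l) (h2 : l ≤ n) {s m : ℤ} (hne : SD n s h m l ≠ 0) : m = qD n s h l ∧
    ((0 < SD n s h m l ∧ ((l < n ∧ h (l - 1) = h l ∧ h (l + 1) = h l + 1) ∨
        (l = n ∧ h n = h (n - 1) ∧ h (n - 1) = h (n - 2)))) ∨
     (SD n s h m l = - 1 ∧ ((l < n ∧ h (l - 1) = h l - 1 ∧ h (l + 1) = h l) ∨
        (l = n ∧ h n = h (n - 1) + 1 ∧ h (n - 1) = h (n - 2) + 1)))) := by
  simp only [SD] at *
  rw [if_pos ⟨h1, h2⟩] at *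
  by_cases e : m = qD n s h l
  swap
  · rw [if_neg e] at hne; exact absurd rfl hne
  rw [if_pos e] at *
  refine ⟨e, ?_⟩
  have a1 := H.2 l h1 h2
  have key : (sgD n h l = 0) ∨ (sgD n h l = 1 ∧ ((l < n ∧ h (l - 1) = h l ∧ h (l + 1) = h l + 1) ∨
        (l = n ∧ h n = h (n - 1) ∧ h (n - 1) = h (n - 2)))) ∨
      (sgD n h l = -1 ∧ ((l < n ∧ h (l - 1) = h l - 1 ∧ h (l + 1) = h l) ∨
        (l = n ∧ h n = h (n - 1) + 1 ∧ h (n - 1) = h (n - 2) + 1))) := by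
    unfold sgD
    rcases h2.lt_or_eq with h3 | h3
    · have a2 := H.2 (l + 1) (by omega) h3
      rw [Nat.add_sub_cancel] at a2
      rw [if_pos h3]; omega
    · subst h3
      have a2 := H.2 (l - 1) (by omega) (by omega)
      rw [show l - 1 - 1 = l - 2 by omega] at a2
      rw [if_neg (lt_irrefl l)]; omega
  rcases key with k | ⟨k, k1⟩ | ⟨k, k1⟩
  · rw [k] at hne; simp at hne
  · left; rw [k]; exact ⟨by norm_num, k1⟩
  · right; rw [k]; exact ⟨by norm_num, k1⟩

lemma LP.upn_mem {n : ℕ} (hn : 4 ≤ n) {h : ℕ → ℤ} (H : LP n h) {v : ℤ}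
    (ha : h (n - 1) + v = h (n - 2) ∨ h (n - 1) + v = h (n - 2) + 1)
    (hb : h n + 2 * v = h (n - 1) + v ∨ h n + 2 * v = h (n - 1) + v + 1) : LP n (upn n h v) := by
  refine ⟨?_, ?_⟩
  · rw [upn_ne _ _ (by omega) (by omega)]; exact H.1
  · intro j hj1 hj2
    by_cases e1 : j = n
    · subst e1
      rw [upn_n, upn_n1 hn]; exact hb
    · by_cases e2 : j = n - 1
      · subst e2
        rw [upn_n1 hn, show n - 1 - 1 = n - 2 by omega, upn_ne _ _ (by omega) (by omega)]
        exact ha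
      · rw [upn_ne _ _ e1 e2, upn_ne _ _ (by omega) (by omega)]
        exact H.2 j hj1 hj2

lemma upn_upn {n : ℕ} (hn : 4 ≤ n) (h : ℕ → ℤ) : upn n (upn n h (-1)) 1 = h := by
  funext j
  by_cases e1 : j = n
  · rw [e1, upn_n, upn_n]; ring
  · by_cases e2 : j = n - 1
    · rw [e2, upn_n1 hn, upn_n1 hn]; ring
    · rw [upn_ne _ _ e1 e2, upn_ne _ _ e1 e2]

/-- spin family of type D -/
def SDG (n : ℕ) (P : ℕ → ℤ) (s : ℤ) (F : ℤ → ℕ → ℚ) : Prop :=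
  ∃ h, LP n h ∧ (h n % 2 = 0 → 1 - P n ≤ s) ∧ (h n % 2 = 1 → 1 - P (n - 1) ≤ s) ∧ F = SD n s h

lemma SDG_down {n : ℕ} (hn : 4 ≤ n) {P : ℕ → ℤ} {s : ℤ}
    {F : ℤ → ℕ → ℚ} {m : ℤ} {l : ℕ} (h : SDG n P s F)
    (h1 : 1 ≤ l) (h2 : l ≤ n) (hpos : 0 < F m l) : SDG n P s (F - F m l • bh n (cartanD n) m l) := by
  obtain ⟨h, H, hs, hs', rfl⟩ := h
  obtain ⟨e, ⟨_, ⟨h0, h3, h4⟩ | ⟨h0, h3, h4⟩⟩ | ⟨h3, _⟩⟩ := SD_apply hn H h1 h2 (ne_of_gt hpos)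
  · obtain ⟨h5, h6⟩ := SD_shift1 hn s h1 h0 h3 h4
    rw [e, h6, one_smul]
    refine ⟨_, H.upd_mem h1 (by omega) (by omega), ?_, ?_, h5.symm⟩
    · rw [upd_ne _ _ (by omega)]; exact hs
    · rw [upd_ne _ _ (by omega)]; exact hs'
  · subst h0
    obtain ⟨h5, h6⟩ := SD_shift2 hn s h3 h4
    rw [e, h6, one_smul]
    refine ⟨_, H.upn_mem hn (v := 1) (by omega) (by omega), ?_, ?_, h5.symm⟩
    · rw [upn_n]; intro h7; exact hs (by omega)
    · rw [upn_n]; intro h7; exact hs' (by omega)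
  · rw [h3] at hpos
    norm_num at hpos

lemma SD_raise1 {n : ℕ} (hn : 4 ≤ n) {h : ℕ → ℤ} {l : ℕ} (s : ℤ)
    (h1 : 1 ≤ l) (h2 : l < n) (ha : h (l - 1) = h l - 1) (hb : h (l + 1) = h l) :
    SD n s h = SD n s (upd h l (h l - 1)) - bh n (cartanD n) (qD n s h l - 1) l ∧
    SD n s (upd h l (h l - 1)) (qD n s h l - 1) l = 1 := by
  obtain ⟨h6, h7⟩ := SD_shift1 hn (h := upd h l (h l - 1)) s h1 h2
      (by rw [upd_same, upd_ne _ _ (by omega)]; exact ha)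
      (by rw [upd_same, upd_ne _ _ (by omega), hb]; ring)
  have e : qD n s (upd h l (h l - 1)) l = qD n s h l - 1 := by
    rw [qD, qD, if_pos h2, if_pos h2, upd_same]; ring
  rw [e] at h6 h7
  rw [upd_same, sub_add_cancel, upd_upd] at h6
  exact ⟨h6, h7⟩

lemma SD_raise2 {n : ℕ} (hn : 4 ≤ n) {h : ℕ → ℤ} (s : ℤ)
    (ha : h n = h (n - 1) + 1) (hb : h (n - 1) = h (n - 2) + 1) :
    SD n s h = SD n s (upn n h (-1)) - bh n (cartanD n) (qD n s h n - 1) n ∧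
    SD n s (upn n h (-1)) (qD n s h n - 1) n = 1 := by
  obtain ⟨h6, h7⟩ := SD_shift2 hn (h := upn n h (-1)) s
      (by rw [upn_n, upn_n1 hn, ha]; ring)
      (by rw [upn_n1 hn, upn_ne _ _ (by omega) (by omega), hb]; ring)
  have e : qD n s (upn n h (-1)) n = qD n s h n - 1 := by
    rw [qD, qD, if_neg (lt_irrefl n), if_neg (lt_irrefl n), upn_n1 hn]; ring
  rw [e] at h6 h7
  rw [upn_upn hn] at h6
  exact ⟨h6, h7⟩

lemma SDG_up {n : ℕ} (hn : 4 ≤ n) {P : ℕ → ℤ} {s : ℤ}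
    {F : ℤ → ℕ → ℚ} {m : ℤ} {l : ℕ} (h : SDG n P s F)
    (h1 : 1 ≤ l) (h2 : l ≤ n) (hneg : F m l < 0) :
    SDG n P s (F - F m l • bh n (cartanD n) (m - 1) l) := by
  obtain ⟨h, H, hs, hs', rfl⟩ := h
  obtain ⟨e, ⟨h3, _⟩ | ⟨h3, ⟨h0, h4, h5⟩ | ⟨h0, h4, h5⟩⟩⟩ := SD_apply hn H h1 h2 (ne_of_lt hneg)
  · linarith
  · rw [h3, e]
    refine ⟨upd h l (h l - 1), H.upd_mem h1 (by omega) (by omega), ?_, ?_, ?_⟩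
    · rw [upd_ne _ _ (by omega)]; exact hs
    · rw [upd_ne _ _ (by omega)]; exact hs'
    · obtain ⟨h6, h7⟩ := SD_raise1 hn s h1 h0 h4 h5
      nth_rewrite 1 [h6]
      module
  · subst h0
    rw [h3, e]
    refine ⟨upn l h (-1), H.upn_mem hn (by omega) (by omega), ?_, ?_, ?_⟩
    · rw [upn_n]; intro h7; exact hs (by omega)
    · rw [upn_n]; intro h7; exact hs' (by omega)
    · obtain ⟨h6, h7⟩ := SD_raise2 hn s h4 h5
      nth_rewrite 1 [h6]
      module

lemma SDG_supp {n : ℕ} (hn : 4 ≤ n) {P : ℕ → ℤ} {s : ℤ}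
    {F : ℤ → ℕ → ℚ} {m : ℤ} {l : ℕ} (h : SDG n P s F) (hne : F m l ≠ 0) : s ≤ m := by
  obtain ⟨h, H, hs, hs', rfl⟩ := h
  by_cases hl : 1 ≤ l ∧ l ≤ n
  · have h1 := (SD_apply hn H hl.1 hl.2 hne).1
    have h2 := H.nonneg l hl.2
    have h3 := H.nonneg (n - 1) (by omega)
    unfold qD at h1
    split_ifs at h1 <;> omega
  · simp [SD, hl] at hne

lemma SD_base1 {n : ℕ} (hn : 4 ≤ n) {s : ℤ} {h : ℕ → ℤ}
    (H : ∀ j ≤ n - 1, h j = 0) (H' : h n = 0) : SD n s h = Yf s n := by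
  funext m i
  simp only [SD, Yf]
  by_cases hi : 1 ≤ i ∧ i ≤ n
  · rw [if_pos hi]
    have e : sgD n h i = if i = n then 1 else 0 := by
      unfold sgD
      have h0 : ∀ j ≤ n, h j = 0 := by
        intro j hj
        rcases hj.lt_or_eq with h3 | h3
        · exact H j (by omega)
        · rw [h3]; exact H'
      rcases hi.2.lt_or_eq with h3 | h3
      · rw [if_pos h3, h0 _ (by omega), h0 _ (by omega), h0 _ (by omega), if_neg (by omega)]; ring
      · rw [if_neg (by omega), h0 _ (by omega), h0 _ (by omega), if_pos h3]; ring
    rw [e]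
    by_cases h3 : i = n
    · subst h3
      rw [qD, if_neg (lt_irrefl i), H _ le_rfl]
      simp
    · simp [h3]
  · rw [if_neg hi, if_neg (by omega)]

lemma SD_base2 {n : ℕ} (hn : 4 ≤ n) {s : ℤ} {h : ℕ → ℤ}
    (H : ∀ j ≤ n - 1, h j = 0) (H' : h n = 1) : SD n s h = Yf s (n - 1) := by
  funext m i
  simp only [SD, Yf]
  by_cases hi : 1 ≤ i ∧ i ≤ n
  · rw [if_pos hi]
    have e : sgD n h i = if i = n - 1 then 1 else 0 := by
      unfold sgD
      rcases hi.2.lt_or_eq with h3 | h3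
      · by_cases h4 : i = n - 1
        · subst h4
          rw [if_pos h3, show n - 1 + 1 = n by omega, H', H _ (by omega), H _ (by omega), if_pos rfl]; ring
        · rw [if_pos h3, H _ (by omega), H _ (by omega), H _ (by omega), if_neg (by omega)]; ring
      · rw [if_neg (by omega), H', H _ (by omega), if_neg (by omega)]; ring
    rw [e]
    by_cases h3 : i = n - 1
    · subst h3
      rw [qD, if_pos (show n - 1 < n by omega), H _ le_rfl, show s + 0 + (n : ℤ) - ((n - 1 : ℕ) : ℤ) - 1 = s by omega]
      simp
    · simp [h3]
  · rw [if_neg hi, if_neg (by omega)]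

lemma SD_low1 {n : ℕ} (hn : 4 ≤ n) {s : ℤ} :
    SD n s (fun j => (j : ℤ)) = - Yf (s + (n - 1)) n := by
  funext m i
  simp only [SD, Yf, Pi.neg_apply]
  by_cases hi : 1 ≤ i ∧ i ≤ n
  · rw [if_pos hi]
    have e : sgD n (fun j => (j : ℤ)) i = if i = n then -1 else 0 := by
      unfold sgD
      rcases hi.2.lt_or_eq with h3 | h3
      · rw [if_pos h3, if_neg (by omega)]; beta_reduce; omega
      · rw [if_neg (by omega), if_pos h3]; beta_reduce; omega
    rw [e]
    by_cases h3 : i = n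
    · subst h3
      rw [qD, if_neg (lt_irrefl i), show s + ((i - 1 : ℕ) : ℤ) = s + (i - 1) by omega]
      simp only [and_true, if_true]
      split_ifs <;> norm_num
    · simp [h3]
  · rw [if_neg hi, if_neg (by omega)]; norm_num

lemma SD_low2 {n : ℕ} (hn : 4 ≤ n) {s : ℤ} :
    SD n s (upd (fun j => (j : ℤ)) n (n - 1)) = - Yf (s + (n - 1)) (n - 1) := by
  funext m i
  simp only [SD, Yf, Pi.neg_apply]
  by_cases hi : 1 ≤ i ∧ i ≤ n
  · rw [if_pos hi]
    have e : sgD n (upd (fun j => (j : ℤ)) n (n - 1)) i = if i = n - 1 then -1 else 0 := by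
      unfold sgD
      rcases hi.2.lt_or_eq with h3 | h3
      · by_cases h4 : i = n - 1
        · subst h4
          rw [if_pos h3, show n - 1 + 1 = n by omega, upd_same, upd_ne _ _ (by omega), upd_ne _ _ (by omega),
            if_pos rfl]; beta_reduce; omega
        · rw [if_pos h3, upd_ne _ _ (by omega), upd_ne _ _ (by omega), upd_ne _ _ (by omega),
            if_neg (by omega)]; beta_reduce; omega
      · rw [if_neg (by omega), upd_same, upd_ne _ _ (by omega), if_neg (by omega)]; beta_reduce; omega
    rw [e]
    by_cases h3 : i = n - 1
    · subst h3
      rw [qD, if_pos (show n - 1 < n by omega), upd_ne _ _ (by omega),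
        show s + ((n - 1 : ℕ) : ℤ) + (n : ℤ) - ((n - 1 : ℕ) : ℤ) - 1 = s + (n - 1) by omega]
      simp only [and_true, if_true]
      split_ifs <;> norm_num
    · simp [h3]
  · rw [if_neg hi, if_neg (by omega)]; norm_num

lemma SDG_reach {n : ℕ} (hn : 4 ≤ n) {ι : ℕ → ℕ}
    (hadm : Admissible n ι) (had : Adapted n (cartanD n) ι) {P : ℕ → ℤ} (hP : PotOK n (cartanD n) ι P)
    (hsl : SlopeD n P) {s : ℤ} : ∀ (N : ℕ) (h : ℕ → ℤ), LP n h →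
      (h n % 2 = 0 → 1 - P n ≤ s) → (h n % 2 = 1 → 1 - P (n - 1) ≤ s) →
      ∑ j ∈ Finset.range (n + 1), h j = N → rho ι P (SD n s h) ∈ Xi (cartanD n) ι := by
  intro N
  induction N using Nat.strong_induction_on with
  | _ N ih =>
    intro h H hs hs' hN
    have hsl1 := (hsl.1 (n - 2) (n - 1) (by omega) (by omega) le_rfl)
    have hsl2 := hsl.2
    have hlast := H.2 n (by omega) le_rfl
    have hnn1 := H.nonneg (n - 1) (by omega)
    rcases H.exists_last (n - 1) (by omega) with h0 | ⟨t, t1, t2, t3, t4⟩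
    · have h00 := h0 (n - 1) le_rfl
      rcases hlast with h1 | h1
      · rw [SD_base1 hn h0 (by omega)]
        refine Xi_base hadm (by omega) le_rfl ?_
        have := hs (by omega)
        omega
      · rw [SD_base2 hn h0 (by omega)]
        refine Xi_base hadm (by omega) (by omega) ?_
        have := hs' (by omega)
        omega
    · have hnn := H.nonneg (t - 1) (by omega)
      by_cases ht : t < n - 1 ∨ h n = h (n - 1)
      · have t5 : h (t + 1) = h t := by
          rcases ht with ht | ht
          · exact t4 (t + 1) (by omega) (by omega)
          · by_cases h5 : t < n - 1
            · exact t4 (t + 1) (by omega) (by omega)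
            · have : t = n - 1 := by omega
              subst this
              rw [show n - 1 + 1 = n by omega]; exact ht
        obtain ⟨h6, h7⟩ := SD_raise1 hn s t1 (by omega) (by omega : h (t - 1) = h t - 1) t5
        have H' : LP n (upd h t (h t - 1)) := H.upd_mem t1 (by omega) (by
          intro _; rw [t5]; right; ring)
        have hN' := sum_upd h t (n + 1) (by omega) (h t - 1)
        have hr := ih (N - 1) (by
          have : 0 ≤ ∑ j ∈ Finset.range (n + 1), upd h t (h t - 1) j :=
            Finset.sum_nonneg (fun j hj => H'.nonneg j (by have := Finset.mem_range.mp hj; omega))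
          omega) (upd h t (h t - 1)) H' (by rw [upd_ne _ _ (by omega)]; exact hs)
          (by rw [upd_ne _ _ (by omega)]; exact hs') (by
          have : 0 ≤ ∑ j ∈ Finset.range (n + 1), upd h t (h t - 1) j :=
            Finset.sum_nonneg (fun j hj => H'.nonneg j (by have := Finset.mem_range.mp hj; omega))
          omega)
        refine Xi_step hadm had hP t1 (by omega) (m := qD n s h t - 1) ?_ hr ?_ ?_
        · rw [qD, if_pos (by omega)]
          have hb := (hsl.1 t (n - 1) t1 t2 le_rfl).2
          by_cases h5 : t < n - 1
          · have hb' := (hsl.1 t (n - 2) t1 (by omega) (by omega)).2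
            rcases Int.emod_two_eq_zero_or_one (h n) with h8 | h8
            · have := hs h8
              omega
            · have := hs' h8
              omega
          · have : t = n - 1 := by omega
            subst this
            rcases Int.emod_two_eq_zero_or_one (h n) with h8 | h8
            · have := hs h8
              omega
            · have := hs' h8
              omega
        · rw [h7]; norm_num
        · rw [h7, one_smul]; exact h6
      · have : t = n - 1 := by omega
        subst this
        rw [show n - 1 - 1 = n - 2 by omega] at t3 hnn
        have h9 : h n = h (n - 1) + 1 := by omega
        obtain ⟨h6, h7⟩ := SD_raise2 hn s h9 t3
        have H' : LP n (upn n h (-1)) := H.upn_mem hn (by omega) (by omega)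
        have h10 : 0 ≤ ∑ j ∈ Finset.range (n + 1), upn n h (-1) j :=
            Finset.sum_nonneg (fun j hj => H'.nonneg j (by have := Finset.mem_range.mp hj; omega))
        have h11 : ∑ j ∈ Finset.range (n + 1), upn n h (-1) j = (N : ℤ) - 3 := by
          unfold upn
          rw [sum_upd _ _ _ (by omega), sum_upd _ _ _ (by omega), upd_ne _ _ (by omega), hN]; ring
        have hr := ih (N - 3) (by omega) (upn n h (-1)) H' (by rw [upn_n]; intro h8; exact hs (by omega))
          (by rw [upn_n]; intro h8; exact hs' (by omega)) (by omega)
        refine Xi_step hadm had hP (by omega) le_rfl (m := qD n s h n - 1) ?_ hr ?_ ?_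
        · rw [qD, if_neg (lt_irrefl n)]
          rcases Int.emod_two_eq_zero_or_one (h n) with h8 | h8
          · have := hs h8
            omega
          · have := hs' h8
            omega
        · rw [h7]; norm_num
        · rw [h7, one_smul]; exact h6


/-! ### Strictly increasing enumerations -/

lemma inc_lt {a k : ℕ} {j : ℕ → ℕ} (hj : ∀ i, a ≤ i → i < k → j i < j (i + 1)) {p : ℕ} (hp : a ≤ p) :
    ∀ q, p < q → q ≤ k → j p < j q := by
  intro q
  induction q with
  | zero => intro h; omega
  | succ q ih =>
    intro h1 h2
    have h3 := hj q (by omega) (by omega)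
    rcases Nat.lt_or_ge p q with h | h
    · have := ih h (by omega); omega
    · have : p = q := by omega
      subst this; exact h3

lemma inc_sum {M : Type*} [AddCommMonoid M] {a k : ℕ} {j : ℕ → ℕ}
    (hj : ∀ i, a ≤ i → i < k → j i < j (i + 1)) (f : ℕ → ℕ → M) :
    ∑ i ∈ Finset.Icc a k, f (k - i) (j i) =
      ∑ e ∈ (Finset.Icc a k).image j,
        f ((((Finset.Icc a k).image j).filter (fun e' => e < e')).card) e := by
  have hinj : ∀ p q, a ≤ p → p ≤ k → a ≤ q → q ≤ k → j p = j q → p = q := by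
    intro p q h1 h2 h3 h4 h
    rcases lt_trichotomy p q with h5 | h5 | h5
    · have := inc_lt hj h1 q h5 h4; omega
    · exact h5
    · have := inc_lt hj h3 p h5 h2; omega
  rw [Finset.sum_image]
  · apply Finset.sum_congr rfl
    intro i hi
    rw [Finset.mem_Icc] at hi
    congr 1
    have : ((Finset.Icc a k).image j).filter (fun e' => j i < e') = (Finset.Icc (i + 1) k).image j := by
      ext e
      simp only [Finset.mem_filter, Finset.mem_image, Finset.mem_Icc]
      constructor
      · rintro ⟨⟨p, hp, rfl⟩, h⟩
        refine ⟨p, ⟨?_, hp.2⟩, rfl⟩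
        by_contra h6
        rcases Nat.lt_or_ge p i with h7 | h7
        · have := inc_lt hj hp.1 i h7 hi.2; omega
        · have : p = i := by omega
          subst this; omega
      · rintro ⟨p, hp, rfl⟩
        exact ⟨⟨p, ⟨by omega, hp.2⟩, rfl⟩, inc_lt hj hi.1 p (by omega) hp.2⟩
    rw [this, Finset.card_image_of_injOn]
    · simp
    · intro p hp q hq h
      rw [Finset.mem_coe, Finset.mem_Icc] at hp hq
      exact hinj p q (by omega) hp.2 (by omega) hq.2 h
  · intro p hp q hq h
    rw [Finset.mem_coe, Finset.mem_Icc] at hp hq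
    exact hinj p q hp.1 hp.2 hq.1 hq.2 h

lemma inc_exists (E : Finset ℕ) (a k : ℕ) (hc : E.card + a = k + 1) :
    ∃ j : ℕ → ℕ, (∀ i, a ≤ i → i < k → j i < j (i + 1)) ∧ (∀ i, i < a → j i = 0) ∧
      (Finset.Icc a k).image j = E := by
  classical
  set g : ℕ → ℕ := fun i => if h : i < E.card then E.orderEmbOfFin rfl ⟨i, h⟩ else 0 with hg
  have g1 : ∀ p q, p < q → q < E.card → g p < g q := by
    intro p q h1 h2
    simp only [hg]
    rw [dif_pos (by omega : p < E.card), dif_pos h2]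
    exact (E.orderEmbOfFin rfl).strictMono h1
  have g2 : ∀ p, p < E.card → g p ∈ E := by
    intro p hp
    simp only [hg]
    rw [dif_pos hp]
    exact Finset.orderEmbOfFin_mem E rfl _
  refine ⟨fun i => if i < a then 0 else g (i - a), ?_, ?_, ?_⟩
  · intro i h1 h2
    simp only []
    rw [if_neg (by omega), if_neg (by omega)]
    exact g1 _ _ (by omega) (by omega)
  · intro i hi
    simp only []
    rw [if_pos hi]
  · apply Finset.eq_of_subset_of_card_le
    · intro e he
      simp only [Finset.mem_image, Finset.mem_Icc] at he
      obtain ⟨p, hp, rfl⟩ := he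
      rw [if_neg (by omega)]
      exact g2 _ (by omega)
    · rw [Finset.card_image_of_injOn]
      · rw [Nat.card_Icc]; omega
      · intro p hp q hq h
        rw [Finset.mem_coe, Finset.mem_Icc] at hp hq
        simp only [] at h
        rw [if_neg (by omega), if_neg (by omega)] at h
        rcases lt_trichotomy p q with h5 | h5 | h5
        · have := g1 (p - a) (q - a) (by omega) (by omega); omega
        · exact h5
        · have := g1 (q - a) (p - a) (by omega) (by omega); omega

/-- path attached to a set of codes -/
def hE (n : ℕ) (E : Finset ℕ) (t : ℕ) : ℤ := ((E.filter (fun e => 2 * n + 1 - t ≤ e)).card : ℤ)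

lemma hE_step (n : ℕ) (E : Finset ℕ) {t : ℕ} (h1 : 1 ≤ t) (h2 : t ≤ 2 * n) :
    hE n E t = hE n E (t - 1) + (if 2 * n + 1 - t ∈ E then 1 else 0) := by
  unfold hE
  split_ifs with h
  · rw [show E.filter (fun e => 2 * n + 1 - t ≤ e) =
        insert (2 * n + 1 - t) (E.filter (fun e => 2 * n + 1 - (t - 1) ≤ e)) by
      ext e
      simp only [Finset.mem_insert, Finset.mem_filter]
      constructor
      · rintro ⟨h3, h4⟩
        by_cases h5 : e = 2 * n + 1 - t
        · exact Or.inl h5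
        · exact Or.inr ⟨h3, by omega⟩
      · rintro (h3 | h3)
        · subst h3; exact ⟨h, le_rfl⟩
        · exact ⟨h3.1, by omega⟩]
    rw [Finset.card_insert_of_notMem]
    · push_cast; ring
    · simp only [Finset.mem_filter]; omega
  · rw [add_zero]
    congr 2
    ext e
    simp only [Finset.mem_filter]
    constructor
    · rintro ⟨h3, h4⟩
      refine ⟨h3, ?_⟩
      by_contra h5
      have : e = 2 * n + 1 - t := by omega
      subst this
      exact h h3
    · rintro ⟨h3, h4⟩
      exact ⟨h3, by omega⟩

lemma hE_zero (n : ℕ) (E : Finset ℕ) (hE2 : ∀ e ∈ E, e ≤ 2 * n) : hE n E 0 = 0 := by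
  unfold hE
  rw [Finset.filter_false_of_mem]
  · simp
  · intro e he; have := hE2 e he; omega

lemma hE_LP (n : ℕ) (E : Finset ℕ) (hE2 : ∀ e ∈ E, e ≤ 2 * n) : LP n (hE n E) := by
  refine ⟨hE_zero n E hE2, fun t h1 h2 => ?_⟩
  rw [hE_step n E h1 (by omega)]
  split_ifs
  · right; rfl
  · left; ring

lemma hE_eq {n : ℕ} {E : Finset ℕ} (hE2 : ∀ e ∈ E, e ≤ 2 * n) {h : ℕ → ℤ} (H : LP n h)
    (hm : ∀ t, 1 ≤ t → t ≤ n → (2 * n + 1 - t ∈ E ↔ h t = h (t - 1) + 1)) :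
    ∀ t, t ≤ n → hE n E t = h t := by
  intro t
  induction t with
  | zero => intro _; rw [hE_zero n E hE2, H.1]
  | succ t ih =>
    intro ht
    rw [hE_step n E (by omega) (by omega), Nat.add_sub_cancel, ih (by omega)]
    have h1 := H.2 (t + 1) (by omega) ht
    have h2 := hm (t + 1) (by omega) ht
    rw [Nat.add_sub_cancel] at h1 h2
    split_ifs with h3
    · rw [h2.mp h3]
    · rcases h1 with h1 | h1
      · omega
      · exact absurd (h2.mpr h1) h3

lemma hE_filter (n : ℕ) (E : Finset ℕ) {e : ℕ} (he : e ≤ 2 * n) :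
    ((E.filter (fun e' => e < e')).card : ℤ) = hE n E (2 * n - e) := by
  unfold hE
  congr 2
  ext e'
  simp only [Finset.mem_filter]
  constructor
  · rintro ⟨h1, h2⟩; exact ⟨h1, by omega⟩
  · rintro ⟨h1, h2⟩; exact ⟨h1, by omega⟩

lemma sum_fold {M : Type*} [AddCommMonoid M] (n : ℕ) (g : ℕ → M) :
    ∑ e ∈ Finset.Icc 1 (2 * n), g e = ∑ t ∈ Finset.Icc 1 n, (g t + g (2 * n + 1 - t)) := by
  rw [Finset.sum_add_distrib]
  have h1 : Finset.Icc 1 (2 * n) = Finset.Icc 1 n ∪ Finset.Icc (n + 1) (2 * n) := by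
    ext e; simp only [Finset.mem_union, Finset.mem_Icc]; omega
  rw [h1, Finset.sum_union]
  · congr 1
    apply Finset.sum_nbij' (fun e => 2 * n + 1 - e) (fun e => 2 * n + 1 - e)
    · intro e he; rw [Finset.mem_Icc] at *; omega
    · intro e he; rw [Finset.mem_Icc] at *; omega
    · intro e he; rw [Finset.mem_Icc] at *; omega
    · intro e he; rw [Finset.mem_Icc] at *; omega
    · intro e he
      rw [Finset.mem_Icc] at he
      congr 1; omega
  · rw [Finset.disjoint_left]
    intro e; simp only [Finset.mem_Icc]; omega

lemma sum_codes {M : Type*} [AddCommMonoid M] (n : ℕ) (E : Finset ℕ) (hE1 : ∀ e ∈ E, 1 ≤ e)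
    (hE2 : ∀ e ∈ E, e ≤ 2 * n) (g : ℕ → M) :
    ∑ e ∈ E, g e = ∑ t ∈ Finset.Icc 1 n, ((if t ∈ E then g t else 0) +
      (if 2 * n + 1 - t ∈ E then g (2 * n + 1 - t) else 0)) := by
  rw [← sum_fold n (fun e => if e ∈ E then g e else 0), ← Finset.sum_filter]
  apply Finset.sum_congr _ (fun _ _ => rfl)
  ext e
  simp only [Finset.mem_filter, Finset.mem_Icc]
  constructor
  · intro h; exact ⟨⟨hE1 e h, hE2 e h⟩, h⟩
  · intro h; exact h.2

lemma tab_codes {a k n : ℕ} {j : ℕ → ℕ}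
    (hj : ∀ i, a ≤ i → i < k → j i < j (i + 1)) (hr : ∀ i, a ≤ i → i ≤ k → 1 ≤ j i ∧ j i ≤ 2 * n)
    (box : ℤ → ℕ → ℕ → ℚ) (s : ℤ) {E : Finset ℕ} (hE' : (Finset.Icc a k).image j = E) :
    ∑ i ∈ Finset.Icc a k, box (s + (k : ℤ) - (i : ℤ)) (j i) =
      ∑ t ∈ Finset.Icc 1 n, ((if t ∈ E then box (s + hE n E (2 * n - t)) t else 0) +
      (if 2 * n + 1 - t ∈ E then box (s + hE n E (t - 1)) (2 * n + 1 - t) else 0)) := by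
  have hmem : ∀ e ∈ E, 1 ≤ e ∧ e ≤ 2 * n := by
    intro e he
    rw [← hE'] at he
    simp only [Finset.mem_image, Finset.mem_Icc] at he
    obtain ⟨i, hi, rfl⟩ := he
    exact hr i hi.1 hi.2
  have h1 := inc_sum hj (fun d e => box (s + (d : ℤ)) e)
  rw [hE'] at h1
  have h2 : ∑ i ∈ Finset.Icc a k, box (s + (k : ℤ) - (i : ℤ)) (j i) =
      ∑ e ∈ E, box (s + hE n E (2 * n - e)) e := by
    refine Eq.trans ?_ (h1.trans ?_)
    · apply Finset.sum_congr rfl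
      intro i hi
      rw [Finset.mem_Icc] at hi
      congr 1; omega
    · apply Finset.sum_congr rfl
      intro e he
      rw [hE_filter n E (hmem e he).2]
  rw [h2, sum_codes n E (fun e he => (hmem e he).1) (fun e he => (hmem e he).2)]
  apply Finset.sum_congr rfl
  intro t ht
  rw [Finset.mem_Icc] at ht
  rw [show 2 * n - (2 * n + 1 - t) = t - 1 by omega]


/-! ### Sums of boxes along a path -/

lemma VBC_bar (n : ℕ) (cn : ℚ) (u m : ℤ) {t i : ℕ} (t1 : 1 ≤ t) (t2 : t ≤ n) (i1 : 1 ≤ i) (i2 : i ≤ n) :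
    (VBC n cn).bx u (2 * n + 1 - t) m i = (if i = n then cn else 1) *
      ((if t = i + 1 ∧ m = u + n - i then 1 else 0) - (if t = i ∧ m = u + n - i + 1 then 1 else 0)) := by
  simp only [VBC]
  simp only [VP.bx]
  rw [if_pos ⟨i1, i2⟩]
  congr 1
  rcases i2.lt_or_eq with h | h
  · have e1 : (2 * n + 1 - t = 2 * n - i ∧ m = u + ((n - i : ℕ) : ℤ)) ↔ (t = i + 1 ∧ m = u + n - i) := by omega
    have e2 : (2 * n + 1 - t = 2 * n + 1 - i ∧ m = u + ((n - i : ℕ) : ℤ) + 1) ↔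
      (t = i ∧ m = u + n - i + 1) := by omega
    simp only [if_pos h]
    rw [if_neg (show ¬ (2 * n + 1 - t = i ∧ m = u) by omega),
      if_neg (show ¬ (2 * n + 1 - t = i + 1 ∧ m = u + 1) by omega)]
    simp only [e1, e2]
    ring
  · subst h
    have e2 : (2 * i + 1 - t = i + 1 ∧ m = u + 1) ↔ (t = i ∧ m = u + i - i + 1) := by omega
    rw [if_neg (show ¬ (2 * i + 1 - t = i ∧ m = u) by omega)]
    simp only [e2, lt_irrefl, if_false]
    rw [if_neg (show ¬ (t = i + 1 ∧ m = u + i - i) by omega),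
      if_neg (show ¬ (2 * i + 1 - t = 2 * i + 5 ∧ m = u + ((i - i : ℕ) : ℤ)) by omega),
      if_neg (show ¬ (2 * i + 1 - t = 2 * i + 6 ∧ m = u + ((i - i : ℕ) : ℤ) + 1) by omega)]
    ring

lemma VBC_unb (n : ℕ) (cn : ℚ) (u m : ℤ) {t i : ℕ} (t1 : 1 ≤ t) (t2 : t ≤ n) (i1 : 1 ≤ i) (i2 : i ≤ n) :
    (VBC n cn).bx u t m i = (if i = n then cn else 1) *
      ((if t = i ∧ m = u then 1 else 0) - (if t = i + 1 ∧ m = u + 1 then 1 else 0)) := by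
  simp only [VBC]
  simp only [VP.bx]
  rw [if_pos ⟨i1, i2⟩]
  congr 1
  rcases i2.lt_or_eq with h | h
  · simp only [if_pos h]
    rw [if_neg (show ¬ (t = 2 * n - i ∧ m = u + ((n - i : ℕ) : ℤ)) by omega),
      if_neg (show ¬ (t = 2 * n + 1 - i ∧ m = u + ((n - i : ℕ) : ℤ) + 1) by omega)]
    ring
  · subst h
    simp only [lt_irrefl, if_false]
    rw [if_neg (show ¬ (t = 2 * i + 5 ∧ m = u + ((i - i : ℕ) : ℤ)) by omega),
      if_neg (show ¬ (t = 2 * i + 6 ∧ m = u + ((i - i : ℕ) : ℤ) + 1) by omega)]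
    ring

lemma VD_bar {n : ℕ} (hn : 4 ≤ n) (u m : ℤ) {t i : ℕ} (t1 : 1 ≤ t) (t2 : t ≤ n) (i1 : 1 ≤ i) (i2 : i ≤ n) :
    (VD n).bx u (2 * n + 1 - t) m i = if i < n then
      ((if t = i + 1 ∧ m = u + n - i - 1 then 1 else 0) - (if t = i ∧ m = u + n - i then 1 else 0))
      else (- (if t = n ∧ m = u + 1 then 1 else 0) - (if t = n - 1 ∧ m = u + 1 then 1 else 0)) := by
  simp only [VD]
  simp only [VP.bx]
  rw [if_pos ⟨i1, i2⟩, one_mul]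
  rcases i2.lt_or_eq with h | h
  · have e1 : (2 * n + 1 - t = 2 * n - i ∧ m = u + ((n - i - 1 : ℕ) : ℤ)) ↔
      (t = i + 1 ∧ m = u + n - i - 1) := by omega
    have e2 : (2 * n + 1 - t = 2 * n + 1 - i ∧ m = u + ((n - i - 1 : ℕ) : ℤ) + 1) ↔
      (t = i ∧ m = u + n - i) := by omega
    simp only [if_pos h]
    rw [if_neg (show ¬ (2 * n + 1 - t = i ∧ m = u) by omega),
      if_neg (show ¬ (2 * n + 1 - t = i + 1 ∧ m = u + 1) by omega)]
    simp only [e1, e2]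
    ring
  · subst h
    have e1 : (2 * i + 1 - t = i + 1 ∧ m = u + 1) ↔ (t = i ∧ m = u + 1) := by omega
    have e2 : (2 * i + 1 - t = i + 2 ∧ m = u + ((i - i - 1 : ℕ) : ℤ) + 1) ↔ (t = i - 1 ∧ m = u + 1) := by omega
    simp only [lt_irrefl, if_false]
    simp only [e1, e2]
    rw [if_neg (show ¬ (2 * i + 1 - t = i - 1 ∧ m = u) by omega),
      if_neg (show ¬ (2 * i + 1 - t = i ∧ m = u + ((i - i - 1 : ℕ) : ℤ)) by omega)]
    ring

lemma sum_two {n : ℕ} (f : ℕ → ℚ) {p q : ℕ} (hp : 1 ≤ p ∧ p ≤ n) (hq : 1 ≤ q ∧ q ≤ n) (hpq : p ≠ q)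
    (h : ∀ t, 1 ≤ t → t ≤ n → t ≠ p → t ≠ q → f t = 0) :
    ∑ t ∈ Finset.Icc 1 n, f t = f p + f q := by
  apply Finset.sum_eq_add p q hpq
  · intro t ht h2
    rw [Finset.mem_Icc] at ht
    exact h t ht.1 ht.2 h2.1 h2.2
  · intro h3; exact absurd (Finset.mem_Icc.mpr hp) h3
  · intro h3; exact absurd (Finset.mem_Icc.mpr hq) h3

lemma sum_one {n : ℕ} (f : ℕ → ℚ) {p : ℕ} (hp : 1 ≤ p ∧ p ≤ n)
    (h : ∀ t, 1 ≤ t → t ≤ n → t ≠ p → f t = 0) :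
    ∑ t ∈ Finset.Icc 1 n, f t = f p := by
  apply Finset.sum_eq_single p
  · intro t ht h2
    rw [Finset.mem_Icc] at ht
    exact h t ht.1 ht.2 h2
  · intro h3; exact absurd (Finset.mem_Icc.mpr hp) h3

lemma SF_C {n : ℕ} (hn : 2 ≤ n) {s : ℤ} {h : ℕ → ℤ} (H : LP n h) (m : ℤ) {i : ℕ}
    (i1 : 1 ≤ i) (i2 : i ≤ n) :
    (Yf (s + h n) n + ∑ t ∈ Finset.Icc 1 n,
      (if h t = h (t - 1) + 1 then (VBC n 2).bx (s + h (t - 1)) (2 * n + 1 - t) else 0)) m i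
      = SF n (fun _ => 1) s h m i := by
  simp only [Pi.add_apply, Finset.sum_apply, SF, if_pos (And.intro i1 i2), Yf]
  have hf : ∀ t, 1 ≤ t → t ≤ n →
      (if h t = h (t - 1) + 1 then (VBC n 2).bx (s + h (t - 1)) (2 * n + 1 - t) else 0) m i =
      if h t = h (t - 1) + 1 then (if i = n then 2 else 1) *
      ((if t = i + 1 ∧ m = s + h (t - 1) + n - i then 1 else 0)
        - (if t = i ∧ m = s + h (t - 1) + n - i + 1 then 1 else 0)) else 0 := by
    intro t t1 t2
    split
    · rw [VBC_bar n 2 _ _ t1 t2 i1 i2]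
    · rfl
  have h0 := H.2 i i1 i2
  rcases i2.lt_or_eq with h2 | h2
  · rw [sum_two _ (p := i) (q := i + 1) ⟨i1, i2⟩ (by omega) (by omega)]
    · rw [hf i i1 i2, hf (i + 1) (by omega) (by omega)]
      have h3 := H.2 (i + 1) (by omega) (by omega)
      rw [Nat.add_sub_cancel] at *
      simp only [sg]
      rw [if_pos h2, if_neg (show ¬ (i = n) by omega), if_neg (show ¬ (m = s + h n ∧ i = n) by omega)]
      simp only [true_and]
      rw [if_neg (show ¬ (i = i + 1 ∧ m = s + h (i - 1) + n - i) by omega),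
        if_neg (show ¬ (i + 1 = i ∧ m = s + h i + n - i + 1) by omega)]
      rcases h0 with h0 | h0 <;> rcases h3 with h3 | h3
      · rw [h0, h3, h0]
        try simp only [true_and, and_true, if_true]
        repeat' split
        all_goals first | (exfalso; omega) | (push_cast; ring1)
      · rw [h0, h3, h0]
        try simp only [true_and, and_true, if_true]
        repeat' split
        all_goals first | (exfalso; omega) | (push_cast; ring1)
      · rw [h0, h3, h0]
        try simp only [true_and, and_true, if_true]
        repeat' split
        all_goals first | (exfalso; omega) | (push_cast; ring1)
      · rw [h0, h3, h0]
        try simp only [true_and, and_true, if_true]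
        repeat' split
        all_goals first | (exfalso; omega) | (push_cast; ring1)
    · intro t t1 t2 t3 t4
      rw [hf t t1 t2]
      simp [t3, t4]
  · subst h2
    rw [sum_one _ (p := i) ⟨i1, i2⟩]
    · rw [hf i i1 i2]
      simp only [sg]
      rw [if_neg (show ¬ (i < i) by omega)]
      rcases h0 with h0 | h0
      · rw [h0]
        try simp only [true_and, and_true, if_true]
        repeat' split
        all_goals first | (exfalso; omega) | (push_cast; ring1)
      · rw [h0]
        try simp only [true_and, and_true, if_true]
        repeat' split
        all_goals first | (exfalso; omega) | (push_cast; ring1)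
    · intro t t1 t2 t3
      rw [hf t t1 t2]
      simp [t3, show t ≠ i + 1 by omega]

lemma SF_B {n : ℕ} (hn : 2 ≤ n) {s : ℤ} {h : ℕ → ℤ} (H : LP n h) (m : ℤ) {i : ℕ}
    (i1 : 1 ≤ i) (i2 : i ≤ n) :
    (∑ t ∈ Finset.Icc 1 n,
      (if h t = h (t - 1) + 1 then (VBC n 1).bx (s + h (t - 1)) (2 * n + 1 - t)
        else (VBC n 1).bx (s + (h t + n - t)) t)) m i
      = SF n (fun j => if j = n then 1 else 2) s h m i := by
  simp only [Finset.sum_apply, SF, if_pos (And.intro i1 i2)]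
  have hf : ∀ t, 1 ≤ t → t ≤ n →
      (if h t = h (t - 1) + 1 then (VBC n 1).bx (s + h (t - 1)) (2 * n + 1 - t)
        else (VBC n 1).bx (s + (h t + n - t)) t) m i =
      if h t = h (t - 1) + 1 then
      ((if t = i + 1 ∧ m = s + h (t - 1) + n - i then 1 else 0)
        - (if t = i ∧ m = s + h (t - 1) + n - i + 1 then 1 else 0)) else
      ((if t = i ∧ m = s + (h t + n - t) then 1 else 0)
        - (if t = i + 1 ∧ m = s + (h t + n - t) + 1 then 1 else 0)) := by
    intro t t1 t2
    split
    · rw [VBC_bar n 1 _ _ t1 t2 i1 i2]; simp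
    · rw [VBC_unb n 1 _ _ t1 t2 i1 i2]; simp
  have h0 := H.2 i i1 i2
  have hi : ∀ x : ℤ, (if h i = h (i - 1) + 1 then
      ((if i = i + 1 ∧ m = s + h (i - 1) + n - i then (1 : ℚ) else 0)
        - (if i = i ∧ m = s + h (i - 1) + n - i + 1 then 1 else 0)) else
      ((if i = i ∧ m = s + (h i + n - i) then 1 else 0)
        - (if i = i + 1 ∧ m = s + (h i + n - i) + 1 then 1 else 0))) =
      if m = s + h i + n - i then ((1 - 2 * (h i - h (i - 1)) : ℤ) : ℚ) else 0 := by
    intro x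
    rw [if_neg (show ¬ (i = i + 1 ∧ m = s + h (i - 1) + n - i) by omega),
      if_neg (show ¬ (i = i + 1 ∧ m = s + (h i + n - i) + 1) by omega)]
    simp only [true_and]
    rcases h0 with h0 | h0
    · rw [h0]
      try simp only [true_and, and_true, if_true]
      repeat' split
      all_goals first | (exfalso; omega) | (push_cast; ring1)
    · rw [h0]
      try simp only [true_and, and_true, if_true]
      repeat' split
      all_goals first | (exfalso; omega) | (push_cast; ring1)
  rcases i2.lt_or_eq with h2 | h2
  · rw [sum_two _ (p := i) (q := i + 1) ⟨i1, i2⟩ (by omega) (by omega)]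
    · rw [hf i i1 i2, hf (i + 1) (by omega) (by omega), hi 0]
      have h3 := H.2 (i + 1) (by omega) (by omega)
      rw [Nat.add_sub_cancel] at *
      simp only [sg]
      rw [if_pos h2, if_neg (show ¬ (i = n) by omega)]
      simp only [true_and]
      rw [if_neg (show ¬ (i + 1 = i ∧ m = s + (h (i + 1) + n - (i + 1 : ℕ))) by omega),
        if_neg (show ¬ (i + 1 = i ∧ m = s + h i + n - i + 1) by omega)]
      rcases h3 with h3 | h3
      · rw [h3]
        try simp only [true_and, and_true, if_true]
        repeat' split
        all_goals first | (exfalso; omega) | (push_cast; ring1)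
      · rw [h3]
        try simp only [true_and, and_true, if_true]
        repeat' split
        all_goals first | (exfalso; omega) | (push_cast; ring1)
    · intro t t1 t2 t3 t4
      rw [hf t t1 t2]
      simp [t3, t4]
  · rw [sum_one _ (p := i) ⟨i1, i2⟩]
    · rw [hf i i1 i2, hi 0]
      simp only [sg]
      rw [if_neg (show ¬ (i < n) by omega), if_pos h2, one_mul, ← h2]
    · intro t t1 t2 t3
      rw [hf t t1 t2]
      simp [t3, show t ≠ i + 1 by omega]

lemma SD_D {n : ℕ} (hn : 4 ≤ n) {s : ℤ} {h : ℕ → ℤ} (H : LP n h) (m : ℤ) {i : ℕ}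
    (i1 : 1 ≤ i) (i2 : i ≤ n) :
    (Yf (s + h n) n + ∑ t ∈ Finset.Icc 1 n,
      (if h t = h (t - 1) + 1 then (VD n).bx (s + h (t - 1)) (2 * n + 1 - t) else 0)) m i
      = SD n s h m i := by
  simp only [Pi.add_apply, Finset.sum_apply, SD, if_pos (And.intro i1 i2), Yf]
  have hf : ∀ t, 1 ≤ t → t ≤ n →
      (if h t = h (t - 1) + 1 then (VD n).bx (s + h (t - 1)) (2 * n + 1 - t) else 0) m i =
      if h t = h (t - 1) + 1 then (if i < n then
      ((if t = i + 1 ∧ m = s + h (t - 1) + n - i - 1 then 1 else 0)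
        - (if t = i ∧ m = s + h (t - 1) + n - i then 1 else 0))
      else (- (if t = n ∧ m = s + h (t - 1) + 1 then 1 else 0)
        - (if t = n - 1 ∧ m = s + h (t - 1) + 1 then 1 else 0))) else 0 := by
    intro t t1 t2
    split
    · rw [VD_bar hn _ _ t1 t2 i1 i2]
    · rfl
  have h0 := H.2 i i1 i2
  rcases i2.lt_or_eq with h2 | h2
  · rw [sum_two _ (p := i) (q := i + 1) ⟨i1, i2⟩ (by omega) (by omega)]
    · rw [hf i i1 i2, hf (i + 1) (by omega) (by omega)]
      have h3 := H.2 (i + 1) (by omega) (by omega)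
      rw [Nat.add_sub_cancel] at *
      simp only [sgD, qD]
      simp only [if_pos h2, true_and]
      rw [if_neg (show ¬ (m = s + h n ∧ i = n) by omega)]
      rw [if_neg (show ¬ (i = i + 1 ∧ m = s + h (i - 1) + n - i - 1) by omega),
        if_neg (show ¬ (i + 1 = i ∧ m = s + h i + n - i) by omega)]
      rcases h0 with h0 | h0 <;> rcases h3 with h3 | h3
      · rw [h0, h3, h0]
        try simp only [true_and, and_true, if_true]
        repeat' split
        all_goals first | (exfalso; omega) | (push_cast; ring1)
      · rw [h0, h3, h0]
        try simp only [true_and, and_true, if_true]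
        repeat' split
        all_goals first | (exfalso; omega) | (push_cast; ring1)
      · rw [h0, h3, h0]
        try simp only [true_and, and_true, if_true]
        repeat' split
        all_goals first | (exfalso; omega) | (push_cast; ring1)
      · rw [h0, h3, h0]
        try simp only [true_and, and_true, if_true]
        repeat' split
        all_goals first | (exfalso; omega) | (push_cast; ring1)
    · intro t t1 t2 t3 t4
      rw [hf t t1 t2]
      simp [t3, t4, h2]
  · subst h2
    rw [sum_two _ (p := i - 1) (q := i) (by omega) ⟨i1, i2⟩ (by omega)]
    · rw [hf i i1 i2, hf (i - 1) (by omega) (by omega)]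
      have h3 := H.2 (i - 1) (by omega) (by omega)
      rw [show i - 1 - 1 = i - 2 by omega] at *
      simp only [sgD, qD]
      simp only [lt_irrefl, if_false, true_and, and_true]
      rw [if_neg (show ¬ (i - 1 = i ∧ m = s + h (i - 2) + 1) by omega),
        if_neg (show ¬ (i = i - 1 ∧ m = s + h (i - 1) + 1) by omega)]
      rcases h0 with h0 | h0 <;> rcases h3 with h3 | h3
      · rw [h0, h3]
        try simp only [true_and, and_true, if_true]
        repeat' split
        all_goals first | (exfalso; omega) | (push_cast; ring1)
      · rw [h0, h3]
        try simp only [true_and, and_true, if_true]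
        repeat' split
        all_goals first | (exfalso; omega) | (push_cast; ring1)
      · rw [h0, h3]
        try simp only [true_and, and_true, if_true]
        repeat' split
        all_goals first | (exfalso; omega) | (push_cast; ring1)
      · rw [h0, h3]
        try simp only [true_and, and_true, if_true]
        repeat' split
        all_goals first | (exfalso; omega) | (push_cast; ring1)
    · intro t t1 t2 t3 t4
      rw [hf t t1 t2]
      simp [t3, t4]


lemma KOK_B {n : ℕ} (hn : 2 ≤ n) : KOK n (cartanB n) (fun j => if j = n then 1 else 2) where
  pos := by intro l _ _; split_ifs <;> norm_num
  last := by simp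
  lft := by
    intro l h1 h2
    simp only [cartanB]
    rw [if_neg (show ¬ (l - 1 = n) by omega), if_neg (show ¬ (l = l - 1) by omega)]
    by_cases h : l = n
    · subst h
      simp
    · rw [if_neg h, if_neg (show ¬ (l = n ∧ l - 1 = n - 1) by omega),
        if_pos (show l + 1 = l - 1 ∨ l - 1 + 1 = l by omega)]
      norm_num
  rgt := by
    intro l h1 h2
    simp only [cartanB]
    rw [if_neg (show ¬ (l = n) by omega), if_neg (show ¬ (l = l + 1) by omega),
      if_neg (show ¬ (l = n ∧ l + 1 = n - 1) by omega),
      if_pos (show True ∨ l + 1 + 1 = l from Or.inl trivial)]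
    split_ifs <;> norm_num
  far := by
    intro l i h1 h2 h3 h4 h5
    simp only [cartanB]
    rw [if_neg (show ¬ (l = i) by omega), if_neg (show ¬ (l = n ∧ i = n - 1) by omega),
      if_neg (show ¬ (l + 1 = i ∨ i + 1 = l) by omega)]

lemma KOK_C {n : ℕ} (hn : 2 ≤ n) : KOK n (cartanC n) (fun _ => 1) where
  pos := by intro l _ _; norm_num
  last := rfl
  lft := by
    intro l h1 h2
    simp only [cartanC]
    rw [if_neg (show ¬ (l = l - 1) by omega), if_neg (show ¬ (l = n - 1 ∧ l - 1 = n) by omega),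
        if_pos (show l + 1 = l - 1 ∨ l - 1 + 1 = l by omega)]
    norm_num
  rgt := by
    intro l h1 h2
    simp only [cartanC]
    rw [if_neg (show ¬ (l = l + 1) by omega),
      if_pos (show True ∨ l + 1 + 1 = l from Or.inl trivial)]
    by_cases h : l + 1 = n
    · rw [if_pos h, if_pos (show l = n - 1 ∧ l + 1 = n by omega)]; norm_num
    · rw [if_neg h, if_neg (show ¬ (l = n - 1 ∧ l + 1 = n) by omega)]; norm_num
  far := by
    intro l i h1 h2 h3 h4 h5
    simp only [cartanC]
    rw [if_neg (show ¬ (l = i) by omega), if_neg (show ¬ (l = n - 1 ∧ i = n) by omega),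
      if_neg (show ¬ (l + 1 = i ∨ i + 1 = l) by omega)]

lemma hE_mem_iff (n : ℕ) (E : Finset ℕ) {t : ℕ} (h1 : 1 ≤ t) (h2 : t ≤ 2 * n) :
    2 * n + 1 - t ∈ E ↔ hE n E t = hE n E (t - 1) + 1 := by
  rw [hE_step n E h1 h2]
  split_ifs with h <;> simp [h]

lemma tab_split (box : ℤ → ℕ → ℕ → ℚ) (s : ℤ) {k : ℕ} (hk : 1 ≤ k) (j : ℕ → ℕ) :
    tab box s k j = box (s + k - 1) (j 1) + ∑ i ∈ Finset.Icc 2 k, box (s + (k : ℤ) - (i : ℤ)) (j i) := by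
  unfold tab
  rw [show Finset.Icc 1 k = insert 1 (Finset.Icc 2 k) by
    ext i; simp only [Finset.mem_insert, Finset.mem_Icc]; omega, Finset.sum_insert (by simp)]
  norm_num

/-- sum of barred boxes along a path -/
def barsum (n : ℕ) (box : ℤ → ℕ → ℕ → ℚ) (s : ℤ) (h : ℕ → ℤ) : ℕ → ℚ :=
  ∑ t ∈ Finset.Icc 1 n, (if h t = h (t - 1) + 1 then box (s + h (t - 1)) (2 * n + 1 - t) else 0)

lemma spin0_sum {k n : ℕ} {j : ℕ → ℕ}
    (hj : ∀ i, 2 ≤ i → i < k → j i < j (i + 1)) (hr : ∀ i, 2 ≤ i → i ≤ k → n + 1 ≤ j i ∧ j i ≤ 2 * n)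
    (box : ℤ → ℕ → ℕ → ℚ) (s : ℤ) (E : Finset ℕ) (hE' : (Finset.Icc 2 k).image j = E) :
    ∑ i ∈ Finset.Icc 2 k, box (s + (k : ℤ) - (i : ℤ)) (j i) = barsum n box s (hE n E) := by
  rw [tab_codes hj (fun i h1 h2 => ⟨by have := hr i h1 h2; omega, (hr i h1 h2).2⟩) box s hE', barsum]
  apply Finset.sum_congr rfl
  intro t ht
  rw [Finset.mem_Icc] at ht
  rw [if_neg, zero_add]
  · simp only [hE_mem_iff n E ht.1 (by omega : t ≤ 2 * n)]
  · rw [← hE']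
    simp only [Finset.mem_image, Finset.mem_Icc, not_exists, not_and]
    intro i hi h
    have := hr i hi.1 hi.2
    omega

lemma hE_top {n : ℕ} {E : Finset ℕ} (h : ∀ e ∈ E, n + 1 ≤ e) : hE n E n = E.card := by
  unfold hE
  rw [Finset.filter_true_of_mem]
  intro e he
  have := h e he
  omega

lemma spin0_fwd {k n : ℕ} {j : ℕ → ℕ} (hk : 1 ≤ k)
    (hj : ∀ i, 2 ≤ i → i < k → j i < j (i + 1)) (hr : ∀ i, 2 ≤ i → i ≤ k → n + 1 ≤ j i ∧ j i ≤ 2 * n)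
    (box : ℤ → ℕ → ℕ → ℚ) (s : ℤ) :
    ∃ h, LP n h ∧ h n = k - 1 ∧
      ∑ i ∈ Finset.Icc 2 k, box (s + (k : ℤ) - (i : ℤ)) (j i) = barsum n box s h := by
  have hmem : ∀ e ∈ (Finset.Icc 2 k).image j, n + 1 ≤ e ∧ e ≤ 2 * n := by
    intro e he
    simp only [Finset.mem_image, Finset.mem_Icc] at he
    obtain ⟨i, hi, rfl⟩ := he
    exact hr i hi.1 hi.2
  refine ⟨hE n ((Finset.Icc 2 k).image j), hE_LP n _ (fun e he => (hmem e he).2), ?_,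
    spin0_sum hj hr box s _ rfl⟩
  rw [hE_top (fun e he => (hmem e he).1), Finset.card_image_of_injOn, Nat.card_Icc]
  · omega
  · intro p hp q hq h
    rw [Finset.mem_coe, Finset.mem_Icc] at hp hq
    rcases lt_trichotomy p q with h5 | h5 | h5
    · have := inc_lt hj hp.1 q h5 hq.2; omega
    · exact h5
    · have := inc_lt hj hq.1 p h5 hp.2; omega

lemma barsum_congr {n : ℕ} {box : ℤ → ℕ → ℕ → ℚ} {s : ℤ} {h h' : ℕ → ℤ} (H : ∀ t, t ≤ n → h t = h' t) :
    barsum n box s h = barsum n box s h' := by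
  unfold barsum
  apply Finset.sum_congr rfl
  intro t ht
  rw [Finset.mem_Icc] at ht
  rw [H t ht.2, H (t - 1) (by omega)]

lemma spin0_bwd {n : ℕ} {h : ℕ → ℤ} (H : LP n h) (box : ℤ → ℕ → ℕ → ℚ) (s : ℤ) :
    ∃ (k : ℕ) (j : ℕ → ℕ), 1 ≤ k ∧ k ≤ n + 1 ∧ j 1 = 0 ∧ h n = k - 1 ∧
    (∀ i, 2 ≤ i → i < k → j i < j (i + 1)) ∧ (∀ i, 2 ≤ i → i ≤ k → n + 1 ≤ j i ∧ j i ≤ 2 * n) ∧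
      ∑ i ∈ Finset.Icc 2 k, box (s + (k : ℤ) - (i : ℤ)) (j i) = barsum n box s h := by
  set E := (Finset.Icc (n + 1) (2 * n)).filter (fun e => h (2 * n + 1 - e) = h (2 * n - e) + 1) with hEd
  have hmem : ∀ e ∈ E, n + 1 ≤ e ∧ e ≤ 2 * n := by
    intro e he
    simp only [hEd, Finset.mem_filter, Finset.mem_Icc] at he
    exact he.1
  have hcard : E.card ≤ n := by
    calc E.card ≤ (Finset.Icc (n + 1) (2 * n)).card := Finset.card_filter_le _ _
      _ = n := by rw [Nat.card_Icc]; omega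
  have heq : ∀ t, t ≤ n → hE n E t = h t := by
    apply hE_eq (fun e he => (hmem e he).2) H
    intro t h1 h2
    simp only [hEd, Finset.mem_filter, Finset.mem_Icc]
    rw [show 2 * n + 1 - (2 * n + 1 - t) = t by omega, show 2 * n - (2 * n + 1 - t) = t - 1 by omega]
    constructor
    · exact fun h => h.2
    · exact fun h => ⟨by omega, h⟩
  obtain ⟨j, hj, hj0, hjE⟩ := inc_exists E 2 (E.card + 1) (by omega)
  have hr : ∀ i, 2 ≤ i → i ≤ E.card + 1 → n + 1 ≤ j i ∧ j i ≤ 2 * n := by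
    intro i h1 h2
    apply hmem
    rw [← hjE]
    exact Finset.mem_image_of_mem _ (Finset.mem_Icc.mpr ⟨h1, h2⟩)
  refine ⟨E.card + 1, j, by omega, by omega, hj0 1 (by omega), ?_, hj, hr, ?_⟩
  · rw [← heq n le_rfl, hE_top (fun e he => (hmem e he).1)]; push_cast; ring
  · rw [spin0_sum hj hr box s E hjE]
    exact barsum_congr heq

/-- full sum of type B -/
def fullsum (n : ℕ) (box : ℤ → ℕ → ℕ → ℚ) (s : ℤ) (h : ℕ → ℤ) : ℕ → ℚ :=
  ∑ t ∈ Finset.Icc 1 n, (if h t = h (t - 1) + 1 then box (s + h (t - 1)) (2 * n + 1 - t)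
    else box (s + (h t + n - t)) t)

lemma fullsum_congr {n : ℕ} {box : ℤ → ℕ → ℕ → ℚ} {s : ℤ} {h h' : ℕ → ℤ} (H : ∀ t, t ≤ n → h t = h' t) :
    fullsum n box s h = fullsum n box s h' := by
  unfold fullsum
  apply Finset.sum_congr rfl
  intro t ht
  rw [Finset.mem_Icc] at ht
  rw [H t ht.2, H (t - 1) (by omega)]

lemma hE_xor {n : ℕ} {E : Finset ℕ} (hx : ∀ t, 1 ≤ t → t ≤ n → (t ∈ E ↔ ¬ 2 * n + 1 - t ∈ E)) :
    ∀ d, d ≤ n → hE n E (n + d) = hE n E (n - d) + d := by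
  intro d
  induction d with
  | zero => intro _; simp
  | succ d ih =>
    intro hd
    have h1 := hE_step n E (t := n + (d + 1)) (by omega) (by omega)
    have h2 := hE_step n E (t := n - d) (by omega) (by omega)
    rw [show n + (d + 1) - 1 = n + d by omega, ih (by omega), show 2 * n + 1 - (n + (d + 1)) = n - d by omega] at h1
    have h3 := hx (n - d) (by omega) (by omega)
    rw [show n - d - 1 = n - (d + 1) by omega] at h2
    by_cases h4 : 2 * n + 1 - (n - d) ∈ E
    · rw [if_pos h4] at h2
      rw [if_neg (fun h => h3.mp h h4)] at h1
      push_cast; omega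
    · rw [if_neg h4] at h2
      rw [if_pos (h3.mpr h4)] at h1
      push_cast; omega

lemma spinB_sum {n : ℕ} {j : ℕ → ℕ}
    (hj : ∀ i, 1 ≤ i → i < n → j i < j (i + 1)) (hr : ∀ i, 1 ≤ i → i ≤ n → 1 ≤ j i ∧ j i ≤ 2 * n)
    (box : ℤ → ℕ → ℕ → ℚ) (s : ℤ) (E : Finset ℕ) (hE' : (Finset.Icc 1 n).image j = E)
    (hx : ∀ t, 1 ≤ t → t ≤ n → (t ∈ E ↔ ¬ 2 * n + 1 - t ∈ E)) :
    tab box s n j = fullsum n box s (hE n E) := by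
  rw [tab, tab_codes hj hr box s hE', fullsum]
  apply Finset.sum_congr rfl
  intro t ht
  rw [Finset.mem_Icc] at ht
  have h1 := hE_xor hx (n - t) (by omega)
  rw [show n + (n - t) = 2 * n - t by omega, show n - (n - t) = t by omega] at h1
  rw [h1]
  have h2 := hx t ht.1 ht.2
  have h3 := hE_mem_iff n E ht.1 (by omega : t ≤ 2 * n)
  by_cases h4 : 2 * n + 1 - t ∈ E
  · rw [if_neg (fun h => h2.mp h h4), if_pos h4, if_pos (h3.mp h4), zero_add]
  · rw [if_pos (h2.mpr h4), if_neg h4, if_neg (fun h => h4 (h3.mpr h)), add_zero]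
    congr 1; omega

lemma spinB_fwd {n : ℕ} {j : ℕ → ℕ}
    (hj : ∀ i, 1 ≤ i → i < n → j i < j (i + 1)) (hr : ∀ i, 1 ≤ i → i ≤ n → 1 ≤ j i ∧ j i ≤ 2 * n)
    (hd : ∀ l m, 1 ≤ l → l < m → m ≤ n → absJ n (j l) ≠ absJ n (j m))
    (box : ℤ → ℕ → ℕ → ℚ) (s : ℤ) :
    ∃ h, LP n h ∧ tab box s n j = fullsum n box s h := by
  have hd' : ∀ l m, 1 ≤ l → l ≤ n → 1 ≤ m → m ≤ n → absJ n (j l) = absJ n (j m) → l = m := by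
    intro l m h1 h2 h3 h4 h
    rcases lt_trichotomy l m with h5 | h5 | h5
    · exact absurd h (hd l m h1 h5 h4)
    · exact h5
    · exact absurd h.symm (hd m l h3 h5 h2)
  have himg : (Finset.Icc 1 n).image (fun i => absJ n (j i)) = Finset.Icc 1 n := by
    apply Finset.eq_of_subset_of_card_le
    · intro e he
      simp only [Finset.mem_image, Finset.mem_Icc] at he
      obtain ⟨i, hi, rfl⟩ := he
      have := hr i hi.1 hi.2
      rw [Finset.mem_Icc]
      unfold absJ
      split_ifs <;> omega
    · rw [Finset.card_image_of_injOn]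
      intro p hp q hq h
      rw [Finset.mem_coe, Finset.mem_Icc] at hp hq
      exact hd' p q hp.1 hp.2 hq.1 hq.2 h
  refine ⟨hE n ((Finset.Icc 1 n).image j), hE_LP n _ ?_, spinB_sum hj hr box s _ rfl ?_⟩
  · intro e he
    simp only [Finset.mem_image, Finset.mem_Icc] at he
    obtain ⟨i, hi, rfl⟩ := he
    exact (hr i hi.1 hi.2).2
  · intro t h1 h2
    have ht : t ∈ (Finset.Icc 1 n).image (fun i => absJ n (j i)) := by
      rw [himg]; exact Finset.mem_Icc.mpr ⟨h1, h2⟩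
    simp only [Finset.mem_image, Finset.mem_Icc] at ht ⊢
    obtain ⟨i, hi, he⟩ := ht
    constructor
    · rintro ⟨p, hp, hpt⟩ ⟨q, hq, hqt⟩
      have h3 : absJ n (j p) = t := by rw [hpt, absJ, if_pos h2]
      have h4 : absJ n (j q) = t := by rw [hqt, absJ, if_neg (by omega)]; omega
      have := hd' p q hp.1 hp.2 hq.1 hq.2 (by rw [h3, h4])
      subst this
      omega
    · intro h
      refine ⟨i, hi, ?_⟩
      have h5 := hr i hi.1 hi.2
      unfold absJ at he
      split_ifs at he with h6
      · exact he
      · exact absurd ⟨i, hi, by omega⟩ h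

lemma spinB_bwd {n : ℕ} {h : ℕ → ℤ} (H : LP n h) (box : ℤ → ℕ → ℕ → ℚ) (s : ℤ) :
    ∃ (j : ℕ → ℕ), (∀ i, 1 ≤ i → i < n → j i < j (i + 1)) ∧
      (∀ i, 1 ≤ i → i ≤ n → 1 ≤ j i ∧ j i ≤ 2 * n) ∧
      (∀ l m, 1 ≤ l → l < m → m ≤ n → absJ n (j l) ≠ absJ n (j m)) ∧
      tab box s n j = fullsum n box s h := by
  set E := (Finset.Icc 1 (2 * n)).filter (fun e => if e ≤ n then ¬ h e = h (e - 1) + 1 else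
    h (2 * n + 1 - e) = h (2 * n - e) + 1) with hEd
  have hmem : ∀ e ∈ E, 1 ≤ e ∧ e ≤ 2 * n := by
    intro e he
    simp only [hEd, Finset.mem_filter, Finset.mem_Icc] at he
    exact he.1
  have hbar : ∀ t, 1 ≤ t → t ≤ n → (2 * n + 1 - t ∈ E ↔ h t = h (t - 1) + 1) := by
    intro t h1 h2
    simp only [hEd, Finset.mem_filter, Finset.mem_Icc]
    rw [show 2 * n + 1 - (2 * n + 1 - t) = t by omega, show 2 * n - (2 * n + 1 - t) = t - 1 by omega,
      if_neg (by omega)]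
    constructor
    · exact fun h => h.2
    · exact fun h => ⟨by omega, h⟩
  have hunb : ∀ t, 1 ≤ t → t ≤ n → (t ∈ E ↔ ¬ h t = h (t - 1) + 1) := by
    intro t h1 h2
    simp only [hEd, Finset.mem_filter, Finset.mem_Icc]
    rw [if_pos h2]
    constructor
    · exact fun h => h.2
    · exact fun h => ⟨by omega, h⟩
  have hx : ∀ t, 1 ≤ t → t ≤ n → (t ∈ E ↔ ¬ 2 * n + 1 - t ∈ E) := by
    intro t h1 h2
    rw [hbar t h1 h2, hunb t h1 h2]
  have heq : ∀ t, t ≤ n → hE n E t = h t := hE_eq (fun e he => (hmem e he).2) H hbar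
  have hcard : E.card = n := by
    have h1 := hE_xor hx n le_rfl
    rw [Nat.sub_self, heq 0 (by omega), H.1, zero_add] at h1
    have h2 : hE n E (n + n) = E.card := by
      unfold hE
      rw [Finset.filter_true_of_mem]
      intro e he
      have := hmem e he
      omega
    rw [h2] at h1
    exact_mod_cast h1
  obtain ⟨j, hj, hj0, hjE⟩ := inc_exists E 1 n (by omega)
  have hjm : ∀ i, 1 ≤ i → i ≤ n → j i ∈ E := by
    intro i h1 h2
    rw [← hjE]
    exact Finset.mem_image_of_mem _ (Finset.mem_Icc.mpr ⟨h1, h2⟩)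
  have hr : ∀ i, 1 ≤ i → i ≤ n → 1 ≤ j i ∧ j i ≤ 2 * n := fun i h1 h2 => hmem _ (hjm i h1 h2)
  refine ⟨j, hj, hr, ?_, ?_⟩
  · intro l m h1 h2 h3 he
    have h4 := inc_lt hj h1 m h2 h3
    have h5 := hr l h1 (by omega)
    have h6 := hr m (by omega) h3
    unfold absJ at he
    have h7 : j l ≤ n ∧ j m = 2 * n + 1 - j l := by
      split_ifs at he <;> omega
    have h8 := (hx (j l) h5.1 h7.1).mp (hjm l h1 (by omega))
    rw [← h7.2] at h8
    exact h8 (hjm m (by omega) h3)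
  · rw [spinB_sum hj hr box s E hjE hx]
    exact fullsum_congr heq


/-! ### Types B, C, D -/

lemma rho_zero (ι : ℕ → ℕ) (P : ℕ → ℤ) : rho ι P 0 = 0 := by
  funext p; simp [rho]

lemma boxC_spin {n : ℕ} {ι : ℕ → ℕ} (hadm : Admissible n ι) (hn : 2 ≤ n) {s : ℤ} {h : ℕ → ℤ}
    (H : LP n h) :
    boxC ι n (s + h n) 0 + barsum n (boxC ι n) s h
      = rho ι (fun l => (PABC ι n l : ℤ)) (SF n (fun _ => 1) s h) := by
  rw [← rho_congr hadm _ _ _ (fun m i i1 i2 => SF_C hn H (s := s) m i1 i2), ← rho_add, rho_sum]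
  congr 1
  · simp only [boxC, if_true]
    exact xsj_rho hadm (fun l => (PABC ι n l : ℤ)) _ _ n rfl
  · unfold barsum
    apply Finset.sum_congr rfl
    intro t ht
    rw [Finset.mem_Icc] at ht
    split_ifs
    · exact boxC_rho hadm hn _ _ (by omega) (by simp only [VBC]; omega)
    · rw [rho_zero]

lemma boxD_spin {n : ℕ} {ι : ℕ → ℕ} (hadm : Admissible n ι) (hn : 4 ≤ n) {s : ℤ} {h : ℕ → ℤ}
    (H : LP n h) :
    boxD ι n (s + h n) 0 + barsum n (boxD ι n) s h
      = rho ι (fun l => (PD ι n l : ℤ)) (SD n s h) := by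
  rw [← rho_congr hadm _ _ _ (fun m i i1 i2 => SD_D hn H (s := s) m i1 i2), ← rho_add, rho_sum]
  congr 1
  · simp only [boxD, if_true]
    exact xsj_rho hadm (fun l => (PD ι n l : ℤ)) _ _ n rfl
  · unfold barsum
    apply Finset.sum_congr rfl
    intro t ht
    rw [Finset.mem_Icc] at ht
    split_ifs
    · exact boxD_rho hadm hn _ _ (by omega) (by simp only [VD]; omega)
    · rw [rho_zero]

lemma boxB_spin {n : ℕ} {ι : ℕ → ℕ} (hadm : Admissible n ι) (hn : 2 ≤ n) {s : ℤ} {h : ℕ → ℤ}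
    (H : LP n h) :
    fullsum n (boxB ι n) s h
      = rho ι (fun l => (PABC ι n l : ℤ)) (SF n (fun j => if j = n then 1 else 2) s h) := by
  rw [← rho_congr hadm _ _ _ (fun m i i1 i2 => SF_B hn H (s := s) m i1 i2), rho_sum]
  unfold fullsum
  apply Finset.sum_congr rfl
  intro t ht
  rw [Finset.mem_Icc] at ht
  split_ifs
  · exact boxB_rho hadm _ _ (by omega) (by simp only [VBC]; omega)
  · exact boxB_rho hadm _ _ (by omega) (by simp only [VBC]; omega)

lemma LP.sum_nat {n : ℕ} {h : ℕ → ℤ} (H : LP n h) :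
    ∃ N : ℕ, ∑ j ∈ Finset.range (n + 1), h j = N := by
  refine ⟨(∑ j ∈ Finset.range (n + 1), h j).toNat, ?_⟩
  rw [Int.toNat_of_nonneg]
  apply Finset.sum_nonneg
  intro j hj
  rw [Finset.mem_range] at hj
  exact H.nonneg j (by omega)

lemma LP_zero (n : ℕ) : LP n (fun _ => 0) := ⟨rfl, fun _ _ _ => Or.inl rfl⟩

lemma LP_id (n : ℕ) : LP n (fun j => (j : ℤ)) := by
  refine ⟨rfl, fun j h1 _ => Or.inr ?_⟩
  beta_reduce
  omega

theorem typeBC (n : ℕ) (ι : ℕ → ℕ) (hadm : Admissible n ι) (hn : 2 ≤ n) (cn : ℚ)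
    (A : ℕ → ℕ → ℤ) (hA : (A = cartanB n ∧ cn = 1) ∨ (A = cartanC n ∧ cn = 2)) (κ : ℕ → ℚ)
    (hK : KOK n A κ) (had : Adapted n A ι) (cut : Set (ℕ → ℚ))
    (hcut : ∀ φ, φ ∈ cut ↔ ∃ s F,
      ((VBC n cn).VG (fun l => (PABC ι n l : ℤ)) (n - 1) s F ∨ SG n κ (fun l => (PABC ι n l : ℤ)) s F)
        ∧ s ≤ (n : ℤ) ∧ φ = rho ι (fun l => (PABC ι n l : ℤ)) F) :
      Sig A ι =
        { a | (∀ φ ∈ cut, 0 ≤ evalForm φ a) ∧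
              ∀ m i, n < m → 1 ≤ i → i ≤ n → a (occPos ι i m) = 0 } := by
  set P : ℕ → ℤ := fun l => (PABC ι n l : ℤ) with hPdef
  have hsl : Slope n P := PABC_slope ι n
  have hP : PotOK n A ι P := by
    rcases hA with ⟨rfl, _⟩ | ⟨rfl, _⟩
    · exact PABC_pot hadm had (cartanB_ne n hn)
    · exact PABC_pot hadm had (cartanC_ne n hn)
  have hV := VBC_OK n hn cn A hA
  have h2 := VBC_OK2 n hn cn P hsl
  apply generic hadm had hP (fun l => by simp [hPdef])
    (fun s F => (VBC n cn).VG P (n - 1) s F ∨ SG n κ P s F)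
  · intro s F m l h h1 h2 hp
    exact h.imp (fun h => VP.VG_down hV h h1 h2 hp) (fun h => SG_down hK h h1 h2 hp)
  · intro s F m l h h1 h2 hp
    exact h.imp (fun h => VP.VG_up hV h h1 h2 hp) (fun h => SG_up hK h h1 h2 hp)
  · intro m l hm h1 h3
    refine ⟨m - P l, ?_⟩
    rcases h3.lt_or_eq with h4 | h4
    · exact Or.inl (VP.VG_base hV h2 (by simp only [VBC]; omega) h1 (by omega) (by omega))
    · subst h4
      exact Or.inr ⟨fun _ => 0, LP_zero l, by omega, (SG_base hK h1 (fun _ _ => rfl)).symm⟩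
  · rintro s F (h | ⟨h, H, hs, rfl⟩)
    · exact VP.VG_reach (V := VBC n cn) hadm had hP hV h2 h
    · obtain ⟨N, hN⟩ := H.sum_nat
      exact SG_reach hK (by omega) hadm had hP hsl hs N h H hN
  · intro s F m l h hne
    exact h.elim (fun h => VP.VG_supp hV h hne) (fun h => SG_supp hK h hne)
  · intro m l hm h1 h3
    refine ⟨m - P l - n, ?_⟩
    rcases h3.lt_or_eq with h4 | h4
    · left
      obtain ⟨J, hJ, he⟩ := VBC_low n hn cn A hA (m - P l - n) l h1 (by omega)
      refine ⟨l, J, by omega, by omega, by omega, hJ, ?_⟩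
      rw [he]
      congr 2
      ring
    · subst h4
      refine Or.inr ⟨fun j => (j : ℤ), LP_id l, by omega, ?_⟩
      rw [SG_low hK h1]
      congr 2
      ring
  · exact hcut

theorem typeB (n : ℕ) (ι : ℕ → ℕ) (hadm : Admissible n ι) (hn : 2 ≤ n)
    (had : Adapted n (cartanB n) ι) :
      Sig (cartanB n) ι =
        { a | (∀ φ ∈ TabBcut ι n, 0 ≤ evalForm φ a) ∧
              ∀ m i, n < m → 1 ≤ i → i ≤ n → a (occPos ι i m) = 0 } := by
  have hA : (cartanB n = cartanB n ∧ (1 : ℚ) = 1) ∨ (cartanB n = cartanC n ∧ (1 : ℚ) = 2) :=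
    Or.inl ⟨rfl, rfl⟩
  apply typeBC n ι hadm hn 1 (cartanB n) hA _ (KOK_B hn) had
  intro φ
  have hc := fun s => VP.VG_cut (K := n - 1) (s := s) (ι := ι) (P := fun l => (PABC ι n l : ℤ))
    (VBC_OK n hn 1 _ hA) (box := boxB ι n) (boxB_rho hadm) φ
  constructor
  · rintro ⟨k, s, j, hk1, hk2, hj, hR, hd, hs, hsn, he⟩
    rcases hk2.lt_or_eq with hk | hk
    · obtain ⟨F, hF, hφ⟩ := (hc s).mpr ⟨k, j, hk1, by omega, fun i h1 h2 => ⟨(hj i h1 h2).1, by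
        have := (hj i h1 h2).2; simp only [VBC]; omega⟩, fun i h1 h2 => Or.inl (hR i h1 h2), hs, he⟩
      exact ⟨s, F, Or.inl hF, hsn, hφ⟩
    · subst hk
      obtain ⟨h, H, ht⟩ := spinB_fwd hR hj (hd rfl) (boxB ι k) s
      refine ⟨s, _, Or.inr ⟨h, H, hs, rfl⟩, hsn, ?_⟩
      rw [he, ht, boxB_spin hadm hn H]
  · rintro ⟨s, F, hF | ⟨h, H, hs, rfl⟩, hsn, hφ⟩
    · obtain ⟨k, j, hk1, hk2, hj, hR, hs, he⟩ := (hc s).mp ⟨F, hF, hφ⟩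
      refine ⟨k, s, j, hk1, by omega, fun i h1 h2 => ⟨(hj i h1 h2).1, ?_⟩, fun i h1 h2 => ?_,
        fun h => by omega, hs, hsn, he⟩
      · have := (hj i h1 h2).2; simp only [VBC] at this; omega
      · have h3 := hR i h1 h2
        have h4 := (hj i h1 (by omega)).2
        simp only [VBC, VP.R] at h3 h4
        omega
    · obtain ⟨j, hj, hr, hd, ht⟩ := spinB_bwd H (boxB ι n) s
      refine ⟨n, s, j, by omega, le_rfl, hr, hj, fun _ => hd, hs, hsn, ?_⟩
      rw [hφ, ht, boxB_spin hadm hn H]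

theorem typeC (n : ℕ) (ι : ℕ → ℕ) (hadm : Admissible n ι) (hn : 2 ≤ n)
    (had : Adapted n (cartanC n) ι) :
      Sig (cartanC n) ι =
        { a | (∀ φ ∈ TabCcut ι n, 0 ≤ evalForm φ a) ∧
              ∀ m i, n < m → 1 ≤ i → i ≤ n → a (occPos ι i m) = 0 } := by
  have hA : (cartanC n = cartanB n ∧ (2 : ℚ) = 1) ∨ (cartanC n = cartanC n ∧ (2 : ℚ) = 2) :=
    Or.inr ⟨rfl, rfl⟩
  apply typeBC n ι hadm hn 2 (cartanC n) hA _ (KOK_C hn) had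
  intro φ
  have hc := fun s => VP.VG_cut (K := n - 1) (s := s) (ι := ι) (P := fun l => (PABC ι n l : ℤ))
    (VBC_OK n hn 2 _ hA) (box := boxC ι n) (boxC_rho hadm hn) φ
  constructor
  · rintro ⟨k, s, j, ⟨hk1, hk2, hj, hR, hs⟩ | ⟨hj1, hk1, hk2, hr, hj, hs⟩, hsn, he⟩
    · obtain ⟨F, hF, hφ⟩ := (hc s).mpr ⟨k, j, hk1, by omega, fun i h1 h2 => ⟨(hj i h1 h2).1, by
        have := (hj i h1 h2).2; simp only [VBC]; omega⟩, fun i h1 h2 => Or.inl (hR i h1 h2), hs, he⟩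
      exact ⟨s, F, Or.inl hF, hsn, hφ⟩
    · obtain ⟨h, H, hh, ht⟩ := spin0_fwd hk1 hj hr (boxC ι n) s
      refine ⟨s, _, Or.inr ⟨h, H, hs, rfl⟩, hsn, ?_⟩
      rw [he, tab_split _ _ hk1, ht, hj1, ← boxC_spin hadm hn H, hh]
      congr 2
      ring
  · rintro ⟨s, F, hF | ⟨h, H, hs, rfl⟩, hsn, hφ⟩
    · obtain ⟨k, j, hk1, hk2, hj, hR, hs, he⟩ := (hc s).mp ⟨F, hF, hφ⟩
      refine ⟨k, s, j, Or.inl ⟨hk1, hk2, fun i h1 h2 => ⟨(hj i h1 h2).1, ?_⟩, fun i h1 h2 => ?_,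
        hs⟩, hsn, he⟩
      · have := (hj i h1 h2).2; simp only [VBC] at this; omega
      · have h3 := hR i h1 h2
        have h4 := (hj i h1 (by omega)).2
        simp only [VBC, VP.R] at h3 h4
        omega
    · obtain ⟨k, j, hk1, hk2, hj1, hh, hj, hr, ht⟩ := spin0_bwd H (boxC ι n) s
      refine ⟨k, s, j, Or.inr ⟨hj1, hk1, hk2, hr, hj, hs⟩, hsn, ?_⟩
      rw [hφ, tab_split _ _ hk1, ht, hj1, ← boxC_spin hadm hn H, hh]
      congr 2
      ring

theorem typeD (n : ℕ) (ι : ℕ → ℕ) (hadm : Admissible n ι) (hn : 4 ≤ n)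
    (had : Adapted n (cartanD n) ι) :
      Sig (cartanD n) ι =
        { a | (∀ φ ∈ TabDcut ι n, 0 ≤ evalForm φ a) ∧
              ∀ m i, n < m → 1 ≤ i → i ≤ n → a (occPos ι i m) = 0 } := by
  set P : ℕ → ℤ := fun l => (PD ι n l : ℤ) with hPdef
  have hsl : SlopeD n P := PD_slope ι hn
  have hP : PotOK n (cartanD n) ι P := PD_pot hn hadm had
  have hV := VD_OK n hn
  have h2 := VD_OK2 n hn P hsl
  have hb1 := hsl.1 (n - 2) (n - 1) (by omega) (by omega) (by omega)
  have hb2 := hsl.2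
  apply generic hadm had hP (fun l => by simp [hPdef])
    (fun s F => (VD n).VG P (n - 2) s F ∨ SDG n P s F)
  · intro s F m l h h1 h2 hp
    exact h.imp (fun h => VP.VG_down hV h h1 h2 hp) (fun h => SDG_down hn h h1 h2 hp)
  · intro s F m l h h1 h2 hp
    exact h.imp (fun h => VP.VG_up hV h h1 h2 hp) (fun h => SDG_up hn h h1 h2 hp)
  · intro m l hm h1 h3
    refine ⟨m - P l, ?_⟩
    rcases (show l ≤ n - 2 ∨ l = n - 1 ∨ l = n by omega) with h4 | h4 | h4
    · exact Or.inl (VP.VG_base hV h2 (by simp only [VD]; omega) h1 (by omega) (by omega))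
    · subst h4
      refine Or.inr ⟨fun j => if j = n then 1 else 0, ?_, ?_, ?_, ?_⟩
      · refine ⟨if_neg (by omega), fun j h1 h2 => ?_⟩
        beta_reduce
        rw [if_neg (show ¬ (j - 1 = n) by omega)]
        split_ifs
        · right; norm_num
        · left; rfl
      · beta_reduce; rw [if_pos rfl]; omega
      · intro _; omega
      · rw [SD_base2 hn]
        · intro j hj; exact if_neg (by omega)
        · exact if_pos rfl
    · subst h4
      refine Or.inr ⟨fun _ => 0, LP_zero l, fun _ => by omega, fun h => by beta_reduce at h; omega, ?_⟩
      rw [SD_base1 hn]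
      · intro j hj; rfl
      · rfl
  · rintro s F (h | ⟨h, H, hs, hs', rfl⟩)
    · exact VP.VG_reach (V := VD n) hadm had hP hV h2 h
    · obtain ⟨N, hN⟩ := H.sum_nat
      exact SDG_reach hn hadm had hP hsl N h H hs hs' hN
  · intro s F m l h hne
    exact h.elim (fun h => VP.VG_supp hV h hne) (fun h => SDG_supp hn h hne)
  · intro m l hm h1 h3
    refine ⟨m - P l - (n - 1), ?_⟩
    have e : m - P l - ((n : ℤ) - 1) + ((n : ℤ) - 1) = m - P l := by ring
    rcases (show l ≤ n - 2 ∨ l = n - 1 ∨ l = n by omega) with h4 | h4 | h4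
    · left
      obtain ⟨J, hJ, he⟩ := VD_low n hn (m - P l - (n - 1)) l h1 (by omega)
      refine ⟨l, J, by omega, by omega, by omega, hJ, ?_⟩
      rw [he, e]
    · right
      refine ⟨upd (fun j => (j : ℤ)) n (n - 1), ?_, fun _ => by rw [h4]; push_cast at hb1 ⊢; omega,
        fun _ => by rw [h4]; omega, ?_⟩
      · refine ⟨?_, fun j h1 h2 => ?_⟩
        · rw [upd_ne _ _ (by omega)]; rfl
        · rw [upd_ne _ _ (show j - 1 ≠ n by omega)]
          rcases h2.lt_or_eq with h5 | h5
          · rw [upd_ne _ _ (by omega)]; omega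
          · rw [h5, upd_same]; omega
      · rw [SD_low2 hn, e, h4]
    · right
      refine ⟨fun j => (j : ℤ), LP_id n, fun _ => by rw [h4]; omega,
        fun _ => by rw [h4]; omega, ?_⟩
      rw [SD_low1 hn, e, h4]
  · intro φ
    have hc := fun s => VP.VG_cut (K := n - 2) (s := s) (ι := ι) (P := P)
      hV (box := boxD ι n) (boxD_rho hadm hn) φ
    constructor
    · rintro ⟨k, s, j, ⟨hk1, hk2, hj, hR, hs⟩ | ⟨hj1, hk1, hk2, hr, hj, hs, hs'⟩, hsn, he⟩
      · obtain ⟨F, hF, hφ⟩ := (hc s).mpr ⟨k, j, hk1, by omega, fun i h1 h2 => ⟨(hj i h1 h2).1, by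
          have := (hj i h1 h2).2; simp only [VD]; omega⟩, fun i h1 h2 => by
          have h3 := hR i h1 h2
          unfold leD at h3
          simp only [VD, VP.R]
          omega, hs, he⟩
        exact ⟨s, F, Or.inl hF, hsn, hφ⟩
      · obtain ⟨h, H, hh, ht⟩ := spin0_fwd hk1 hj hr (boxD ι n) s
        refine ⟨s, _, Or.inr ⟨h, H, fun h0 => hs' (by omega), fun h0 => hs (by omega), rfl⟩, hsn, ?_⟩
        rw [he, tab_split _ _ hk1, ht, hj1, ← boxD_spin hadm hn H, hh]
        congr 2
        ring
    · rintro ⟨s, F, hF | ⟨h, H, hs, hs', rfl⟩, hsn, hφ⟩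
      · obtain ⟨k, j, hk1, hk2, hj, hR, hs, he⟩ := (hc s).mp ⟨F, hF, hφ⟩
        refine ⟨k, s, j, Or.inl ⟨hk1, hk2, fun i h1 h2 => ⟨(hj i h1 h2).1, ?_⟩, fun i h1 h2 => ?_,
          hs⟩, hsn, he⟩
        · have := (hj i h1 h2).2; simp only [VD] at this; omega
        · have h3 := hR i h1 h2
          simp only [VD, VP.R] at h3
          unfold leD
          omega
      · obtain ⟨k, j, hk1, hk2, hj1, hh, hj, hr, ht⟩ := spin0_bwd H (boxD ι n) s
        refine ⟨k, s, j, Or.inr ⟨hj1, hk1, hk2, hr, hj, fun h0 => hs' (by omega),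
          fun h0 => hs (by omega)⟩, hsn, ?_⟩
        rw [hφ, tab_split _ _ hk1, ht, hj1, ← boxD_spin hadm hn H, hh]
        congr 2
        ring

/-- Corollary 3.7: for an adapted sequence of type A, B, C (n ≥ 2) or D (n ≥ 4), the cone
`Σ_ι` is cut out by the finitely many inequalities coming from `Tab^n_{X,ι}` together with
the vanishing of the coordinates `a_{m,i}` for `m > n`. -/
theorem polyhedral_finite_description (n : ℕ) (ι : ℕ → ℕ) (hadm : Admissible n ι) :
    (2 ≤ n → Adapted n (cartanA n) ι →
      Sig (cartanA n) ι =
        { a | (∀ φ ∈ TabAcut ι n, 0 ≤ evalForm φ a) ∧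
              ∀ m i, n < m → 1 ≤ i → i ≤ n → a (occPos ι i m) = 0 }) ∧
    (2 ≤ n → Adapted n (cartanB n) ι →
      Sig (cartanB n) ι =
        { a | (∀ φ ∈ TabBcut ι n, 0 ≤ evalForm φ a) ∧
              ∀ m i, n < m → 1 ≤ i → i ≤ n → a (occPos ι i m) = 0 }) ∧
    (2 ≤ n → Adapted n (cartanC n) ι →
      Sig (cartanC n) ι =
        { a | (∀ φ ∈ TabCcut ι n, 0 ≤ evalForm φ a) ∧
              ∀ m i, n < m → 1 ≤ i → i ≤ n → a (occPos ι i m) = 0 }) ∧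
    (4 ≤ n → Adapted n (cartanD n) ι →
      Sig (cartanD n) ι =
        { a | (∀ φ ∈ TabDcut ι n, 0 ≤ evalForm φ a) ∧
              ∀ m i, n < m → 1 ≤ i → i ≤ n → a (occPos ι i m) = 0 }) := by
  exact ⟨typeA n ι hadm, typeB n ι hadm, typeC n ι hadm, typeD n ι hadm⟩
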